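/- arXiv:2409.02034 — 2 statements merged into one kernel-verified Lean document; each statement's English description precedes it below -/
import Mathlib

section
/- For every nonnegative integer n, b̅₅(20n+5) = −c₅(5n+1) and b̅₅(20n+9) = −c₅(5n+2). -/
open scoped BigOperators

/-- The q-Pochhammer infinite product `(a; q)_∞ = ∏_{k≥0} (1 - a q^k)`. -/
noncomputable def qpoch (a q : ℂ) : ℂ := ∏' k : ℕ, (1 - a * q ^ k)

/-- `φ(-q) = (q;q)_∞² / (q²;q²)_∞`. -/
noncomputable def phiNeg (q : ℂ) : ℂ := qpoch q q ^ 2 / qpoch (q ^ 2) (q ^ 2)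

/-- `ψ(-q) = (q;q)_∞ (q⁴;q⁴)_∞ / (q²;q²)_∞`. -/
noncomputable def psiNeg (q : ℂ) : ℂ :=
  qpoch q q * qpoch (q ^ 4) (q ^ 4) / qpoch (q ^ 2) (q ^ 2)

open Filter Topology

theorem qp_mult (a : ℂ) {Q : ℂ} (hQ : ‖Q‖ < 1) : Multipliable (fun k : ℕ => 1 - a * Q ^ k) := by
  have : (fun k : ℕ => 1 - a * Q ^ k) = fun k => 1 + (-(a * Q ^ k)) := by
    funext k; ring
  rw [this]
  apply multipliable_one_add_of_summable
  simp only [norm_neg, norm_mul, norm_pow]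
  exact (summable_geometric_of_lt_one (norm_nonneg _) hQ).mul_left _

theorem qp_tendsto (a : ℂ) {Q : ℂ} (hQ : ‖Q‖ < 1) :
    Tendsto (fun n : ℕ => ∏ k ∈ Finset.range n, (1 - a * Q ^ k)) atTop (𝓝 (qpoch a Q)) :=
  (qp_mult a hQ).tendsto_prod_tprod_nat

theorem qp_ne_zero {a Q : ℂ} (hQ : ‖Q‖ < 1) (ha : ∀ k : ℕ, 1 - a * Q ^ k ≠ 0) :
    qpoch a Q ≠ 0 := by
  have : qpoch a Q = ∏' k : ℕ, (1 + (-(a * Q ^ k))) := by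
    unfold qpoch; simp only [sub_eq_add_neg]
  rw [this]
  apply tprod_one_add_ne_zero_of_summable
  · intro k
    have := ha k
    rwa [← sub_eq_add_neg]
  · simp only [norm_neg, norm_mul, norm_pow]
    exact (summable_geometric_of_lt_one (norm_nonneg _) hQ).mul_left _

theorem one_sub_ne {a Q : ℂ} (hQ : ‖Q‖ < 1) (ha : ‖a‖ < 1) (k : ℕ) : 1 - a * Q ^ k ≠ 0 := by
  intro h
  have h1 : a * Q ^ k = 1 := (sub_eq_zero.mp h).symm
  have h2 : ‖a‖ * ‖Q‖ ^ k = 1 := by rw [← norm_pow, ← norm_mul, h1, norm_one]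
  have h3 : ‖Q‖ ^ k ≤ 1 := pow_le_one₀ (norm_nonneg _) hQ.le
  nlinarith [norm_nonneg a, norm_nonneg Q, pow_nonneg (norm_nonneg Q) k]

theorem qp_ne_zero' {a Q : ℂ} (hQ : ‖Q‖ < 1) (ha : ‖a‖ < 1) : qpoch a Q ≠ 0 :=
  qp_ne_zero hQ (one_sub_ne hQ ha)

theorem npow_lt {q : ℂ} (hq : ‖q‖ < 1) {m : ℕ} (hm : m ≠ 0) : ‖q ^ m‖ < 1 := by
  rw [norm_pow]; exact pow_lt_one₀ (norm_nonneg _) hq hm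

/-- splitting the product according to residues mod `m` -/
theorem qp_split (a : ℂ) {Q : ℂ} (hQ : ‖Q‖ < 1) (m : ℕ) (hm : m ≠ 0) :
    qpoch a Q = ∏ j ∈ Finset.range m, qpoch (a * Q ^ j) (Q ^ m) := by
  have h1 : Tendsto (fun n : ℕ => ∏ k ∈ Finset.range (m * n), (1 - a * Q ^ k)) atTop
      (𝓝 (qpoch a Q)) :=
    (qp_tendsto a hQ).comp (tendsto_id.const_mul_atTop' (Nat.pos_of_ne_zero hm))
  have h2 : Tendsto (fun n : ℕ => ∏ j ∈ Finset.range m,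
      ∏ k ∈ Finset.range n, (1 - (a * Q ^ j) * (Q ^ m) ^ k)) atTop
      (𝓝 (∏ j ∈ Finset.range m, qpoch (a * Q ^ j) (Q ^ m))) :=
    tendsto_finsetProd _ fun j _ => qp_tendsto _ (npow_lt hQ hm)
  refine tendsto_nhds_unique h1 (h2.congr fun n => ?_)
  induction n with
  | zero => simp
  | succ n ih =>
    rw [Nat.mul_succ, Finset.prod_range_add, ← ih, ← Finset.prod_mul_distrib]
    refine Finset.prod_congr rfl fun j _ => ?_
    rw [Finset.prod_range_succ]
    congr 2
    rw [← pow_mul, pow_add]; ring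

theorem qp_mul {a b c Q R : ℂ} (hQ : ‖Q‖ < 1) (hR : ‖R‖ < 1)
    (h : ∀ k : ℕ, (1 - a * Q ^ k) * (1 - b * Q ^ k) = 1 - c * R ^ k) :
    qpoch a Q * qpoch b Q = qpoch c R := by
  refine tendsto_nhds_unique ((qp_tendsto a hQ).mul (qp_tendsto b hQ)) ?_
  refine (qp_tendsto c hR).congr fun n => ?_
  rw [← Finset.prod_mul_distrib]
  exact Finset.prod_congr rfl fun k _ => (h k).symm

theorem qp_neg_mul (a : ℂ) {Q : ℂ} (hQ : ‖Q‖ < 1) :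
    qpoch a Q * qpoch (-a) Q = qpoch (a ^ 2) (Q ^ 2) :=
  qp_mul hQ (npow_lt hQ two_ne_zero) fun k => by ring

/-! ### Jacobi triple product -/

/-- reciprocal of the finite Euler product, extended by zero -/
noncomputable def rr (Q : ℂ) (m : ℤ) : ℂ :=
  if m < 0 then 0 else (∏ k ∈ Finset.range m.toNat, (1 - Q * Q ^ k))⁻¹

theorem rr_rec {Q : ℂ} (hQ : ‖Q‖ < 1) (m : ℤ) : rr Q (m - 1) = (1 - Q ^ m) * rr Q m := by
  unfold rr
  rcases lt_trichotomy m 0 with h | h | h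
  · rw [if_pos (by omega), if_pos h, mul_zero]
  · subst h; simp
  · rw [if_neg (by omega), if_neg (by omega)]
    obtain ⟨n, rfl⟩ : ∃ n : ℕ, m = n + 1 := ⟨(m - 1).toNat, by omega⟩
    have e1 : ((n : ℤ) + 1 - 1).toNat = n := by omega
    have e2 : ((n : ℤ) + 1).toNat = n + 1 := by omega
    rw [e1, e2, Finset.prod_range_succ, mul_inv]
    have h3 : (1 : ℂ) - Q ^ ((n : ℤ) + 1) = 1 - Q * Q ^ n := by
      rw [show ((n : ℤ) + 1) = ((n + 1 : ℕ) : ℤ) by push_cast; ring, zpow_natCast, pow_succ]; ring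
    rw [h3]
    have := one_sub_ne hQ hQ n
    field_simp

theorem rr_tendsto {Q : ℂ} (hQ : ‖Q‖ < 1) : Tendsto (rr Q) atTop (𝓝 (qpoch Q Q)⁻¹) := by
  have h := ((qp_tendsto Q hQ).inv₀ (qp_ne_zero' hQ hQ))
  have h2 : Tendsto Int.toNat atTop atTop :=
    tendsto_atTop.mpr fun b => (eventually_ge_atTop (b : ℤ)).mono fun a ha => by omega
  refine (h.comp h2).congr' ?_
  filter_upwards [eventually_ge_atTop 0] with m hm
  simp [rr, not_lt.mpr hm]

theorem rr_bdd {Q : ℂ} (hQ : ‖Q‖ < 1) : ∃ M, ∀ m, ‖rr Q m‖ ≤ M := by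
  have h := ((qp_tendsto Q hQ).inv₀ (qp_ne_zero' hQ hQ)).norm
  obtain ⟨M, hM⟩ := h.bddAbove_range
  refine ⟨max M 0, fun m => ?_⟩
  unfold rr
  split_ifs
  · simp
  · exact le_max_of_le_left (hM ⟨m.toNat, rfl⟩)

/-- centred Gaussian binomial -/
noncomputable def CC (Q : ℂ) (n : ℕ) (j : ℤ) : ℂ :=
  (∏ k ∈ Finset.range (2 * n), (1 - Q * Q ^ k)) * rr Q (n - j) * rr Q (n + j)

theorem CC_rec {Q : ℂ} (hQ : ‖Q‖ < 1) (h0 : Q ≠ 0) (n : ℕ) (j : ℤ) :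
    CC Q (n + 1) j = (1 + Q ^ (2 * n + 1)) * CC Q n j + Q ^ ((n : ℤ) + 1 - j) * CC Q n (j - 1)
      + Q ^ ((n : ℤ) + 1 + j) * CC Q n (j + 1) := by
  unfold CC
  have a1 : rr Q (n - j) = (1 - Q ^ ((n : ℤ) + 1 - j)) * rr Q (n + 1 - j) := by
    rw [← rr_rec hQ]; congr 1; ring
  have a2 : rr Q (n + j) = (1 - Q ^ ((n : ℤ) + 1 + j)) * rr Q (n + 1 + j) := by
    rw [← rr_rec hQ]; congr 1; ring
  have a3 : rr Q (n - (j + 1)) = (1 - Q ^ ((n : ℤ) - j)) * rr Q (n - j) := by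
    rw [← rr_rec hQ]; congr 1; ring
  have a4 : rr Q (n + (j - 1)) = (1 - Q ^ ((n : ℤ) + j)) * rr Q (n + j) := by
    rw [← rr_rec hQ]; congr 1; ring
  have a5 : ((n : ℤ) - (j - 1)) = n + 1 - j := by ring
  have a6 : ((n : ℤ) + (j + 1)) = n + 1 + j := by ring
  have b1 : Q ^ ((n : ℤ) + 1 - j) = Q * Q ^ ((n : ℤ) - j) := by
    rw [← zpow_one_add₀ h0]; congr 1; ring
  have b2 : Q ^ ((n : ℤ) + 1 + j) = Q * Q ^ ((n : ℤ) + j) := by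
    rw [← zpow_one_add₀ h0]; congr 1; ring
  have b3 : Q ^ (2 * n) = Q ^ ((n : ℤ) - j) * Q ^ ((n : ℤ) + j) := by
    rw [← zpow_add₀ h0, ← zpow_natCast]; congr 1; push_cast; ring
  rw [show 2 * (n + 1) = 2 * n + 1 + 1 by ring, Finset.prod_range_succ, Finset.prod_range_succ]
  push_cast
  rw [a5, a6, a3, a4, a1, a2, b1, b2, pow_succ Q (2 * n), b3]
  ring

theorem CC_zero_of (Q : ℂ) (n : ℕ) (j : ℤ) (h : j ∉ Finset.Icc (-(n : ℤ)) n) : CC Q n j = 0 := by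
  unfold CC rr
  rw [Finset.mem_Icc, not_and_or] at h
  rcases h with h | h
  · rw [if_pos (show (n : ℤ) + j < 0 by omega)]; simp
  · rw [if_pos (show (n : ℤ) - j < 0 by omega)]; simp

theorem CC_bdd {Q : ℂ} (hQ : ‖Q‖ < 1) : ∃ M, ∀ n j, ‖CC Q n j‖ ≤ M := by
  obtain ⟨M, hM⟩ := rr_bdd hQ
  obtain ⟨N, hN⟩ := (qp_tendsto Q hQ).norm.bddAbove_range
  have hM0 : 0 ≤ M := (norm_nonneg _).trans (hM 0)
  have hN0 : 0 ≤ N := (norm_nonneg _).trans (hN ⟨0, rfl⟩)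
  refine ⟨N * M * M, fun n j => ?_⟩
  unfold CC
  rw [norm_mul, norm_mul]
  have := hN ⟨2 * n, rfl⟩
  simp only at this
  gcongr
  · exact hM _
  · exact hM _

theorem CC_tendsto {Q : ℂ} (hQ : ‖Q‖ < 1) (j : ℤ) :
    Tendsto (fun n => CC Q n j) atTop (𝓝 (qpoch Q Q)⁻¹) := by
  have h1 : Tendsto (fun n : ℕ => (n : ℤ) - j) atTop atTop :=
    tendsto_atTop.mpr fun b => (eventually_ge_atTop (b + j).toNat).mono fun a ha => by omega
  have h2 : Tendsto (fun n : ℕ => (n : ℤ) + j) atTop atTop :=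
    tendsto_atTop.mpr fun b => (eventually_ge_atTop (b - j).toNat).mono fun a ha => by omega
  have h3 : Tendsto (fun n : ℕ => 2 * n) atTop atTop :=
    tendsto_atTop.mpr fun b => (eventually_ge_atTop b).mono fun a ha => by omega
  have := (((qp_tendsto Q hQ).comp h3).mul ((rr_tendsto hQ).comp h1)).mul ((rr_tendsto hQ).comp h2)
  rw [mul_inv_cancel₀ (qp_ne_zero' hQ hQ), one_mul] at this
  exact this

theorem CC_sum_tendsto {Q : ℂ} (hQ : ‖Q‖ < 1) {w : ℤ → ℂ} (hw : Summable w) :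
    Tendsto (fun n => ∑' j, CC Q n j * w j) atTop (𝓝 ((qpoch Q Q)⁻¹ * ∑' j, w j)) := by
  obtain ⟨M, hM⟩ := CC_bdd hQ
  rw [← tsum_mul_left]
  refine tendsto_tsum_of_dominated_convergence (bound := fun j => M * ‖w j‖)
    (hw.norm.mul_left M) (fun j => (CC_tendsto hQ j).mul_const _) (.of_forall fun n j => ?_)
  rw [norm_mul]
  exact mul_le_mul_of_nonneg_right (hM _ _) (norm_nonneg _)

theorem finite_jtp {a b Q : ℂ} (hQ : ‖Q‖ < 1) (h0 : Q ≠ 0) (hab : a * b = Q) {w : ℤ → ℂ}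
    (w0 : w 0 = 1) (hw : ∀ j, w (j + 1) = w j * (a * Q ^ j)) (n : ℕ) :
    HasSum (fun j => CC Q n j * w j)
      (∏ k ∈ Finset.range n, ((1 + a * Q ^ k) * (1 + b * Q ^ k))) := by
  induction n with
  | zero =>
    have h : (fun j => CC Q 0 j * w j) = fun j => if j = 0 then 1 else 0 := by
      funext j
      by_cases hj : j = 0
      · subst hj; simp [CC, rr, w0]
      · rw [CC_zero_of, if_neg hj, zero_mul]
        simp only [Finset.mem_Icc, not_and_or]; push_cast; omega
    rw [h]; simpa using hasSum_ite_eq (0 : ℤ) (1 : ℂ)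
  | succ n ih =>
    have s1 := ih.mul_left (1 + Q ^ (2 * n + 1))
    have s2 := ((Equiv.addRight (-1 : ℤ)).hasSum_iff.mpr ih).mul_left (a * Q ^ n)
    have s3 := ((Equiv.addRight (1 : ℤ)).hasSum_iff.mpr ih).mul_left (b * Q ^ n)
    have key := (s1.add s2).add s3
    simp only [Function.comp, Equiv.coe_addRight] at key
    have hf : ∀ j, CC Q (n + 1) j * w j = (1 + Q ^ (2 * n + 1)) * (CC Q n j * w j)
        + a * Q ^ n * (CC Q n (j + -1) * w (j + -1)) + b * Q ^ n * (CC Q n (j + 1) * w (j + 1)) := by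
      intro j
      rw [CC_rec hQ h0]
      have e1 : w j = w (j + -1) * (a * Q ^ (j - 1)) := by
        have := hw (j - 1)
        rw [show j - 1 + 1 = j by ring] at this
        rw [this, show j + -1 = j - 1 by ring]
      have e2 : Q ^ ((n : ℤ) + 1 - j) * (a * Q ^ (j - 1)) = a * Q ^ n := by
        rw [mul_left_comm, ← zpow_add₀ h0]; congr 1
        rw [← zpow_natCast]; congr 1; ring
      have e3 : b * Q ^ n * w (j + 1) = Q ^ ((n : ℤ) + 1 + j) * w j := by
        rw [hw j, show (n : ℤ) + 1 + j = 1 + n + j by ring, zpow_add₀ h0, zpow_add₀ h0,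
          zpow_natCast, zpow_one]
        linear_combination (Q ^ n * w j * Q ^ j) * hab
      have e4 : Q ^ ((n : ℤ) + 1 - j) * w j = a * Q ^ n * w (j + -1) := by
        rw [← e2]; rw [e1]; ring
      rw [show j + -1 = j - 1 by ring] at *
      linear_combination CC Q n (j - 1) * e4 - CC Q n (j + 1) * e3
    have hp : ∏ k ∈ Finset.range (n + 1), ((1 + a * Q ^ k) * (1 + b * Q ^ k)) =
        (1 + Q ^ (2 * n + 1)) * ∏ k ∈ Finset.range n, ((1 + a * Q ^ k) * (1 + b * Q ^ k)) +
        a * Q ^ n * ∏ k ∈ Finset.range n, ((1 + a * Q ^ k) * (1 + b * Q ^ k)) +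
        b * Q ^ n * ∏ k ∈ Finset.range n, ((1 + a * Q ^ k) * (1 + b * Q ^ k)) := by
      rw [Finset.prod_range_succ]
      have : Q ^ (2 * n + 1) = (a * Q ^ n) * (b * Q ^ n) := by
        rw [pow_succ]; linear_combination (-(Q ^ n * Q ^ n)) * hab
      rw [this]; ring
    rw [hp]
    rw [funext hf]
    exact key

theorem w_rec_neg {a b Q : ℂ} (h0 : Q ≠ 0) (hab : a * b = Q) {w : ℤ → ℂ}
    (hw : ∀ j, w (j + 1) = w j * (a * Q ^ j)) (j : ℤ) : w (-(j + 1)) = w (-j) * (b * Q ^ j) := by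
  have h := hw (-(j + 1))
  rw [show -(j + 1) + 1 = -j by ring] at h
  rw [h]
  have e : Q ^ (-(j + 1)) * Q ^ j * Q = 1 := by
    rw [← zpow_add₀ h0, ← zpow_add_one₀ h0, show -(j + 1) + j + 1 = 0 by ring, zpow_zero]
  linear_combination (-w (-(j + 1))) * e - w (-(j + 1)) * Q ^ (-(j + 1)) * Q ^ j * hab

theorem nat_ratio_summable {c Q : ℂ} (hQ : ‖Q‖ < 1) (h0 : Q ≠ 0) (hc : c ≠ 0) {w : ℕ → ℂ}
    (hne : ∀ j, w j ≠ 0)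
    (hw : ∀ j, w (j + 1) = w j * (c * Q ^ j)) : Summable (fun j : ℕ => (j : ℂ) * w j) ∧ Summable w := by
  have hlim : Tendsto (fun n : ℕ => ‖c * Q ^ n‖) atTop (𝓝 0) := by
    have := (tendsto_pow_atTop_nhds_zero_of_norm_lt_one hQ).const_mul c
    simpa using this.norm
  constructor
  · refine summable_of_ratio_test_tendsto_lt_one (l := 0) zero_lt_one ?_ ?_
    · filter_upwards [eventually_ge_atTop 1] with n hn
      exact mul_ne_zero (by exact_mod_cast (by omega : n ≠ 0)) (hne n)
    · have hl2 : Tendsto (fun n : ℕ => ‖((n : ℂ) + 1) / n‖) atTop (𝓝 1) := by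
        have := tendsto_one_div_atTop_nhds_zero_nat (𝕜 := ℂ)
        have := (this.const_add 1).norm
        simp only [add_zero, norm_one] at this
        refine this.congr' ?_
        filter_upwards [eventually_ge_atTop 1] with n hn
        have : (n : ℂ) ≠ 0 := by exact_mod_cast (by omega : n ≠ 0)
        congr 1; field_simp
      have := hl2.mul hlim
      rw [mul_zero] at this
      refine this.congr' ?_
      filter_upwards [eventually_ge_atTop 1] with n hn
      have : (n : ℂ) ≠ 0 := by exact_mod_cast (by omega : n ≠ 0)
      rw [hw, ← norm_mul, ← norm_div]
      congr 1; push_cast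
      have := hne n
      field_simp
  · refine summable_of_ratio_test_tendsto_lt_one (l := 0) zero_lt_one (.of_forall hne) ?_
    refine hlim.congr fun n => ?_
    rw [hw, norm_mul (w n), mul_div_cancel_left₀ _ (norm_ne_zero_iff.mpr (hne n))]

theorem w_ne {a b Q : ℂ} (h0 : Q ≠ 0) (hab : a * b = Q) {w : ℤ → ℂ}
    (w0 : w 0 = 1) (hw : ∀ j, w (j + 1) = w j * (a * Q ^ j)) (j : ℤ) : w j ≠ 0 := by
  have ha : a ≠ 0 := by rintro rfl; simp at hab; exact h0 hab.symm
  have hb : b ≠ 0 := by rintro rfl; simp at hab; exact h0 hab.symm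
  have hp : ∀ n : ℕ, w n ≠ 0 := by
    intro n
    induction n with
    | zero => simp [w0]
    | succ n ih => push_cast; rw [hw]; exact mul_ne_zero ih (mul_ne_zero ha (zpow_ne_zero _ h0))
  have hn : ∀ n : ℕ, w (-(n : ℤ)) ≠ 0 := by
    intro n
    induction n with
    | zero => simp [w0]
    | succ n ih =>
      push_cast; rw [w_rec_neg h0 hab hw]; exact mul_ne_zero ih (mul_ne_zero hb (zpow_ne_zero _ h0))
  obtain ⟨n, rfl | rfl⟩ := j.eq_nat_or_neg
  · exact hp n
  · exact hn n

theorem w_summable {a b Q : ℂ} (hQ : ‖Q‖ < 1) (h0 : Q ≠ 0) (hab : a * b = Q) {w : ℤ → ℂ}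
    (w0 : w 0 = 1) (hw : ∀ j, w (j + 1) = w j * (a * Q ^ j)) :
    Summable (fun j : ℤ => (j : ℂ) * w j) ∧ Summable w := by
  have ha : a ≠ 0 := by rintro rfl; simp at hab; exact h0 hab.symm
  have hb : b ≠ 0 := by rintro rfl; simp at hab; exact h0 hab.symm
  have h1 := nat_ratio_summable (w := fun n : ℕ => w n) hQ h0 ha
    (fun j => w_ne h0 hab w0 hw j) (fun j => by
      have := hw j
      simpa using this)
  have h2 := nat_ratio_summable (w := fun n : ℕ => w (-(n : ℤ))) hQ h0 hb
    (fun j => w_ne h0 hab w0 hw _) (fun j => by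
      have := w_rec_neg h0 hab hw j
      simpa using this)
  constructor
  · refine Summable.of_nat_of_neg (by simpa using h1.1) ?_
    have := h2.1.neg
    refine this.congr fun n => ?_
    push_cast; ring
  · exact Summable.of_nat_of_neg h1.2 h2.2

theorem jtp {a b Q : ℂ} (hQ : ‖Q‖ < 1) (h0 : Q ≠ 0) (hab : a * b = Q) {w : ℤ → ℂ}
    (w0 : w 0 = 1) (hw : ∀ j, w (j + 1) = w j * (a * Q ^ j)) :
    ∑' j, w j = qpoch (-a) Q * qpoch (-b) Q * qpoch Q Q := by
  have h1 := CC_sum_tendsto hQ (w_summable hQ h0 hab w0 hw).2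
  have h2 : Tendsto (fun n => ∑' j, CC Q n j * w j) atTop (𝓝 (qpoch (-a) Q * qpoch (-b) Q)) := by
    refine ((qp_tendsto (-a) hQ).mul (qp_tendsto (-b) hQ)).congr fun n => ?_
    rw [(finite_jtp hQ h0 hab w0 hw n).tsum_eq, ← Finset.prod_mul_distrib]
    refine Finset.prod_congr rfl fun k _ => by ring
  have := tendsto_nhds_unique h1 h2
  have hne := qp_ne_zero' hQ hQ
  rw [← this]; field_simp


/-! ### Euler products and theta series -/

/-- `(q;q)_∞` -/
noncomputable def ee (q : ℂ) : ℂ := qpoch q q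

theorem ee_ne {q : ℂ} (hq : ‖q‖ < 1) : ee q ≠ 0 := qp_ne_zero' hq hq

theorem ee_split {q : ℂ} (hq : ‖q‖ < 1) (m : ℕ) (hm : m ≠ 0) :
    ee q = ∏ j ∈ Finset.range m, qpoch (q ^ (j + 1)) (q ^ m) := by
  unfold ee
  rw [qp_split q hq m hm]
  refine Finset.prod_congr rfl fun j _ => ?_
  rw [pow_succ']

/-- triangular numbers on the integers -/
def TT (j : ℤ) : ℤ := j * (j + 1) / 2

theorem TT_two (j : ℤ) : 2 * TT j = j * (j + 1) := by
  unfold TT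
  exact Int.mul_ediv_cancel' (Int.even_mul_succ_self j).two_dvd

theorem TT_succ (j : ℤ) : TT (j + 1) = TT j + (j + 1) := by
  have h1 := TT_two j
  have h2 := TT_two (j + 1)
  have : 2 * TT (j + 1) = 2 * (TT j + (j + 1)) := by linear_combination h2 - h1
  omega

/-- A sum with quadratic exponent: summability and product formula. -/
theorem quad_jtp {Q : ℂ} (hQ : ‖Q‖ < 1) (h0 : Q ≠ 0) {s : ℂ} (hs : s = 1 ∨ s = -1) (m c d : ℕ)
    (hm : m ≠ 0) (hcd : c + d = m) {e : ℤ → ℤ} (e0 : e 0 = 0)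
    (he : ∀ j, e (j + 1) = e j + (m * j + c)) :
    Summable (fun j : ℤ => s ^ j * Q ^ e j) ∧ Summable (fun j : ℤ => (j : ℂ) * (s ^ j * Q ^ e j)) ∧
    ∑' j : ℤ, s ^ j * Q ^ e j = qpoch (-(s * Q ^ c)) (Q ^ m) * qpoch (-(s * Q ^ d)) (Q ^ m)
      * qpoch (Q ^ m) (Q ^ m) := by
  have hs0 : s ≠ 0 := by rcases hs with rfl | rfl <;> norm_num
  have hs2 : s * s = 1 := by rcases hs with rfl | rfl <;> norm_num
  have hab : (s * Q ^ c) * (s * Q ^ d) = Q ^ m := by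
    rw [← hcd, pow_add]; linear_combination (Q ^ c * Q ^ d) * hs2
  have w0 : s ^ (0 : ℤ) * Q ^ e 0 = 1 := by simp [e0]
  have hw : ∀ j : ℤ, s ^ (j + 1) * Q ^ e (j + 1) = s ^ j * Q ^ e j * ((s * Q ^ c) * (Q ^ m) ^ j) := by
    intro j
    rw [he, zpow_add₀ h0, zpow_add₀ h0, zpow_add_one₀ hs0, ← zpow_natCast Q m, ← zpow_mul,
      zpow_natCast]
    ring
  have hm' := npow_lt hQ hm
  have hm0 : Q ^ m ≠ 0 := pow_ne_zero _ h0
  have hsum := w_summable (w := fun j : ℤ => s ^ j * Q ^ e j) hm' hm0 hab w0 hw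
  exact ⟨hsum.2, hsum.1, jtp (w := fun j : ℤ => s ^ j * Q ^ e j) hm' hm0 hab w0 hw⟩

/-- version without sign -/
theorem quad_jtp1 {Q : ℂ} (hQ : ‖Q‖ < 1) (h0 : Q ≠ 0) (m c d : ℕ)
    (hm : m ≠ 0) (hcd : c + d = m) {e : ℤ → ℤ} (e0 : e 0 = 0)
    (he : ∀ j, e (j + 1) = e j + (m * j + c)) :
    Summable (fun j : ℤ => Q ^ e j) ∧
    ∑' j : ℤ, Q ^ e j = qpoch (-Q ^ c) (Q ^ m) * qpoch (-Q ^ d) (Q ^ m)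
      * qpoch (Q ^ m) (Q ^ m) := by
  have h := quad_jtp hQ h0 (s := 1) (Or.inl rfl) m c d hm hcd e0 he
  simp only [one_zpow, one_mul] at h
  exact ⟨h.1, h.2.2⟩

/-- The index-5 sublattice decomposition of `ℤ × ℤ`. -/
def latEquiv (β : ℤ) : Fin 5 × (ℤ × ℤ) ≃ ℤ × ℤ where
  toFun p := (p.2.1 + 2 * p.2.2 + (p.1 : ℕ), p.2.2 - 2 * p.2.1 + β)
  invFun x := (⟨((x.1 - 2 * (x.2 - β)) % 5).toNat, by omega⟩,
    ((x.1 - 2 * (x.2 - β)) / 5, x.2 - β + 2 * ((x.1 - 2 * (x.2 - β)) / 5)))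
  left_inv p := by
    obtain ⟨⟨r, hr⟩, k, l⟩ := p
    simp only [Prod.mk.injEq, Fin.mk.injEq]
    refine ⟨?_, ?_, ?_⟩ <;> omega
  right_inv x := by
    obtain ⟨x, y⟩ := x
    simp only [Prod.mk.injEq]
    constructor <;> omega

theorem lattice_sum (β : ℤ) {g : ℤ × ℤ → ℂ} (hg : Summable g) :
    ∑' p, g p = ∑ r : Fin 5, ∑' p : ℤ × ℤ, g (p.1 + 2 * p.2 + (r : ℕ), p.2 - 2 * p.1 + β) := by
  rw [← (latEquiv β).tsum_eq, Summable.tsum_prod, tsum_fintype]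
  · rfl
  · exact (latEquiv β).summable_iff.mpr hg

theorem sum_prod_mul {f g : ℤ → ℂ} (hf : Summable f) (hg : Summable g) :
    ∑' p : ℤ × ℤ, f p.1 * g p.2 = (∑' k, f k) * ∑' l, g l := by
  rw [tsum_mul_tsum_of_summable_norm hf.norm hg.norm]

theorem shift_sum (f : ℤ → ℂ) (c : ℤ) : ∑' k, f (k + c) = ∑' k, f k :=
  (Equiv.addRight c).tsum_eq f

theorem neg_sum (f : ℤ → ℂ) (c : ℤ) : ∑' k, f (-(k + c)) = ∑' k, f k := by
  rw [shift_sum (fun k => f (-k)) c]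
  exact (Equiv.neg ℤ).tsum_eq f

theorem shift_summable {f : ℤ → ℂ} (hf : Summable f) (c : ℤ) : Summable fun k => f (k + c) :=
  (Equiv.addRight c).summable_iff.mpr hf

theorem neg_summable {f : ℤ → ℂ} (hf : Summable f) (c : ℤ) : Summable fun k => f (-(k + c)) :=
  shift_summable (f := fun k => f (-k)) ((Equiv.neg ℤ).summable_iff.mpr hf) c

/-- evaluation of one class of the lattice sum -/
theorem class_sum {Q : ℂ} (h0 : Q ≠ 0) {ex : ℤ × ℤ → ℤ} {e1 e2 : ℤ → ℤ} (c : ℤ)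
    (h1 : Summable fun k => Q ^ e1 k) (h2 : Summable fun k => Q ^ e2 k)
    {u v : ℤ → ℤ}
    (hu : (∃ a, ∀ k, u k = k + a) ∨ (∃ a, ∀ k, u k = -(k + a)))
    (hv : (∃ a, ∀ k, v k = k + a) ∨ (∃ a, ∀ k, v k = -(k + a)))
    (hex : ∀ k l, ex (k, l) = c + e1 (u k) + e2 (v l)) :
    ∑' p : ℤ × ℤ, Q ^ ex p = Q ^ c * (∑' k, Q ^ e1 k) * ∑' k, Q ^ e2 k := by
  have key : ∀ (e : ℤ → ℤ) (u : ℤ → ℤ), Summable (fun k => Q ^ e k) →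
      ((∃ a, ∀ k, u k = k + a) ∨ (∃ a, ∀ k, u k = -(k + a))) →
      Summable (fun k => Q ^ e (u k)) ∧ ∑' k, Q ^ e (u k) = ∑' k, Q ^ e k := by
    intro e u hs hu
    rcases hu with ⟨a, ha⟩ | ⟨a, ha⟩
    · simp only [ha]
      exact ⟨shift_summable hs a, shift_sum (fun k => Q ^ e k) a⟩
    · simp only [ha]
      exact ⟨neg_summable hs a, neg_sum (fun k => Q ^ e k) a⟩
  have k1 := key e1 u h1 hu
  have k2 := key e2 v h2 hv
  have : ∀ p : ℤ × ℤ, Q ^ ex p = Q ^ c * (Q ^ e1 (u p.1) * Q ^ e2 (v p.2)) := by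
    rintro ⟨k, l⟩
    rw [hex, zpow_add₀ h0, zpow_add₀ h0]; ring
  rw [tsum_congr this, tsum_mul_left, sum_prod_mul k1.1 k2.1, k1.2, k2.2]; ring

theorem theta_lattice {Q : ℂ} (hQ : ‖Q‖ < 1) (h0 : Q ≠ 0) :
    (∑' j : ℤ, Q ^ (j ^ 2)) ^ 2 = (∑' j : ℤ, Q ^ (5 * j ^ 2)) ^ 2
      + 4 * Q * (∑' j : ℤ, Q ^ (5 * j ^ 2 + 2 * j)) * ∑' j : ℤ, Q ^ (5 * j ^ 2 + 4 * j) := by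
  have s1 := (quad_jtp1 hQ h0 2 1 1 (by norm_num) rfl (e := fun j => j ^ 2) (by simp)
    (fun j => by push_cast; ring)).1
  have s5 := (quad_jtp1 hQ h0 10 5 5 (by norm_num) rfl (e := fun j => 5 * j ^ 2) (by simp)
    (fun j => by push_cast; ring)).1
  have sX := (quad_jtp1 hQ h0 10 7 3 (by norm_num) rfl (e := fun j => 5 * j ^ 2 + 2 * j) (by simp)
    (fun j => by push_cast; ring)).1
  have sY := (quad_jtp1 hQ h0 10 9 1 (by norm_num) rfl (e := fun j => 5 * j ^ 2 + 4 * j) (by simp)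
    (fun j => by push_cast; ring)).1
  have hg : Summable fun p : ℤ × ℤ => Q ^ (p.1 ^ 2 + p.2 ^ 2) := by
    have := summable_mul_of_summable_norm s1.norm s1.norm
    refine this.congr fun p => ?_
    rw [zpow_add₀ h0]
  have h1 : (∑' j : ℤ, Q ^ (j ^ 2)) ^ 2 = ∑' p : ℤ × ℤ, Q ^ (p.1 ^ 2 + p.2 ^ 2) := by
    rw [sq, ← sum_prod_mul s1 s1]
    refine tsum_congr fun p => ?_
    rw [zpow_add₀ h0]
  rw [h1, lattice_sum 0 hg, Fin.sum_univ_five]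
  simp only [Fin.val_zero, Fin.val_one, Fin.val_two]
  rw [class_sum h0 0 s5 s5 (u := fun k => k + 0) (v := fun k => k + 0) (Or.inl ⟨0, fun _ => rfl⟩)
      (Or.inl ⟨0, fun _ => rfl⟩) (fun k l => by push_cast; ring),
    class_sum h0 1 sX sY (u := fun k => k + 0) (v := fun k => k + 0) (Or.inl ⟨0, fun _ => rfl⟩)
      (Or.inl ⟨0, fun _ => rfl⟩) (fun k l => by push_cast; ring),
    class_sum h0 1 sY sX (u := fun k => k + 0) (v := fun k => -(k + 1)) (Or.inl ⟨0, fun _ => rfl⟩)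
      (Or.inr ⟨1, fun _ => rfl⟩) (fun k l => by push_cast; ring),
    class_sum h0 1 sY sX (u := fun k => -(k + 1)) (v := fun k => (k + 1)) (Or.inr ⟨1, fun _ => rfl⟩)
      (Or.inl ⟨1, fun _ => rfl⟩) (fun k l => by
        rw [show (((3 : Fin 5) : ℕ) : ℤ) = 3 from rfl]; ring),
    class_sum h0 1 sX sY (u := fun k => -(k + 1)) (v := fun k => -(k + 2))
      (Or.inr ⟨1, fun _ => rfl⟩) (Or.inr ⟨2, fun _ => rfl⟩) (fun k l => by
        rw [show (((4 : Fin 5) : ℕ) : ℤ) = 4 from rfl]; ring)]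
  simp only [zpow_zero, zpow_one]
  ring


theorem psi_lattice {Q : ℂ} (hQ : ‖Q‖ < 1) (h0 : Q ≠ 0) :
    (∑' j : ℤ, Q ^ (TT j)) ^ 2 = Q * (∑' j : ℤ, Q ^ (5 * TT j)) ^ 2
      + 4 * (∑' j : ℤ, Q ^ (5 * TT j - j)) * ∑' j : ℤ, Q ^ (5 * TT j - 2 * j) := by
  have t0 : TT 0 = 0 := rfl
  have s1 := (quad_jtp1 hQ h0 1 1 0 (by norm_num) rfl (e := fun j => TT j) (by simp [t0])
    (fun j => by rw [TT_succ]; push_cast; ring)).1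
  have s5 := (quad_jtp1 hQ h0 5 5 0 (by norm_num) rfl (e := fun j => 5 * TT j) (by simp [t0])
    (fun j => by rw [TT_succ]; push_cast; ring)).1
  have sU := (quad_jtp1 hQ h0 5 4 1 (by norm_num) rfl (e := fun j => 5 * TT j - j) (by simp [t0])
    (fun j => by rw [TT_succ]; push_cast; ring)).1
  have sV := (quad_jtp1 hQ h0 5 3 2 (by norm_num) rfl (e := fun j => 5 * TT j - 2 * j)
    (by simp [t0]) (fun j => by rw [TT_succ]; push_cast; ring)).1
  have hg : Summable fun p : ℤ × ℤ => Q ^ (TT p.1 + TT p.2) := by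
    have := summable_mul_of_summable_norm s1.norm s1.norm
    refine this.congr fun p => ?_
    rw [zpow_add₀ h0]
  have h1 : (∑' j : ℤ, Q ^ (TT j)) ^ 2 = ∑' p : ℤ × ℤ, Q ^ (TT p.1 + TT p.2) := by
    rw [sq, ← sum_prod_mul s1 s1]
    refine tsum_congr fun p => ?_
    rw [zpow_add₀ h0]
  have red : ∀ A B : ℤ, 2 * A = 2 * B → A = B := fun A B h => by omega
  rw [h1, lattice_sum 1 hg, Fin.sum_univ_five]
  simp only [Fin.val_zero, Fin.val_one, Fin.val_two]
  rw [class_sum h0 1 s5 s5 (u := fun k => k + -1) (v := fun k => k + 0)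
      (Or.inl ⟨-1, fun _ => rfl⟩) (Or.inl ⟨0, fun _ => rfl⟩) (fun k l => by
        apply red; push_cast
        linear_combination TT_two (k + 2 * l + 0) + TT_two (l - 2 * k + 1)
          - 5 * TT_two (k + -1) - 5 * TT_two (l + 0)),
    class_sum h0 0 sU sV (u := fun k => -(k + 0)) (v := fun k => -(k + 1))
      (Or.inr ⟨0, fun _ => rfl⟩) (Or.inr ⟨1, fun _ => rfl⟩) (fun k l => by
        apply red; push_cast
        linear_combination TT_two (k + 2 * l + 1) + TT_two (l - 2 * k + 1)
          - 5 * TT_two (-(k + 0)) - 5 * TT_two (-(l + 1))),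
    class_sum h0 0 sV sU (u := fun k => -(k + 0)) (v := fun k => (k + 1))
      (Or.inr ⟨0, fun _ => rfl⟩) (Or.inl ⟨1, fun _ => rfl⟩) (fun k l => by
        apply red; push_cast
        linear_combination TT_two (k + 2 * l + 2) + TT_two (l - 2 * k + 1)
          - 5 * TT_two (-(k + 0)) - 5 * TT_two (l + 1)),
    class_sum h0 0 sV sU (u := fun k => (k + 0)) (v := fun k => -(k + 2))
      (Or.inl ⟨0, fun _ => rfl⟩) (Or.inr ⟨2, fun _ => rfl⟩) (fun k l => by
        rw [show (((3 : Fin 5) : ℕ) : ℤ) = 3 from rfl]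
        apply red
        linear_combination TT_two (k + 2 * l + 3) + TT_two (l - 2 * k + 1)
          - 5 * TT_two (k + 0) - 5 * TT_two (-(l + 2))),
    class_sum h0 0 sU sV (u := fun k => (k + 0)) (v := fun k => (k + 2))
      (Or.inl ⟨0, fun _ => rfl⟩) (Or.inl ⟨2, fun _ => rfl⟩) (fun k l => by
        rw [show (((4 : Fin 5) : ℕ) : ℤ) = 4 from rfl]
        apply red
        linear_combination TT_two (k + 2 * l + 4) + TT_two (l - 2 * k + 1)
          - 5 * TT_two (k + 0) - 5 * TT_two (l + 2))]
  simp only [zpow_zero, zpow_one]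
  ring

/-! ### Eta quotient identities of level 10 -/

theorem qp_zero_mul (a : ℂ) {Q : ℂ} (hQ : ‖Q‖ < 1) : qpoch a Q = (1 - a) * qpoch (a * Q) Q := by
  have h1 := ((qp_tendsto a hQ).comp (tendsto_add_atTop_nat 1))
  refine tendsto_nhds_unique h1 (((qp_tendsto (a * Q) hQ).const_mul (1 - a)).congr fun n => ?_)
  simp only [Function.comp]
  rw [Finset.prod_range_succ' _ n, mul_comm]
  congr 1
  · exact Finset.prod_congr rfl fun k _ => by ring
  · simp

theorem R1 {q : ℂ} (hq : ‖q‖ < 1) (h0 : q ≠ 0) :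
    ee q ^ 3 * ee (q ^ 5) / (ee (q ^ 2) * ee (q ^ 10) ^ 3)
      = ee (q ^ 2) * ee (q ^ 5) ^ 5 / (ee q * ee (q ^ 10) ^ 5) - 4 * q := by
  have hQ : ‖-q‖ < 1 := by rwa [norm_neg]
  have hQ0 : -q ≠ 0 := neg_ne_zero.mpr h0
  have h := theta_lattice hQ hQ0
  rw [(quad_jtp1 hQ hQ0 2 1 1 (by norm_num) rfl (e := fun j => j ^ 2) (by simp)
      (fun j => by push_cast; ring)).2,
    (quad_jtp1 hQ hQ0 10 5 5 (by norm_num) rfl (e := fun j => 5 * j ^ 2) (by simp)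
      (fun j => by push_cast; ring)).2,
    (quad_jtp1 hQ hQ0 10 7 3 (by norm_num) rfl (e := fun j => 5 * j ^ 2 + 2 * j) (by simp)
      (fun j => by push_cast; ring)).2,
    (quad_jtp1 hQ hQ0 10 9 1 (by norm_num) rfl (e := fun j => 5 * j ^ 2 + 4 * j) (by simp)
      (fun j => by push_cast; ring)).2] at h
  have e1 : -(-q) ^ 1 = q := by ring
  have e2 : (-q) ^ 2 = q ^ 2 := by ring
  have e10 : (-q) ^ 10 = q ^ 10 := by ring
  have e5 : -(-q) ^ 5 = q ^ 5 := by ring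
  have e7 : -(-q) ^ 7 = q ^ 7 := by ring
  have e3 : -(-q) ^ 3 = q ^ 3 := by ring
  have e9 : -(-q) ^ 9 = q ^ 9 := by ring
  rw [e1, e2, e10, e5, e7, e3, e9] at h
  have n1 := ee_ne hq
  have n2 := ee_ne (npow_lt hq (m := 2) (by norm_num))
  have n5 := ee_ne (npow_lt hq (m := 5) (by norm_num))
  have n10 := ee_ne (npow_lt hq (m := 10) (by norm_num))
  have s1 := ee_split hq 10 (by norm_num)
  have s1' := ee_split hq 2 (by norm_num)
  have s2 := ee_split (npow_lt hq (m := 2) (by norm_num)) 5 (by norm_num)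
  have s5 := ee_split (npow_lt hq (m := 5) (by norm_num)) 2 (by norm_num)
  simp only [Finset.prod_range_succ, Finset.prod_range_zero, ← pow_mul, one_mul, zero_add,
    pow_one, Nat.reduceAdd, Nat.reduceMul] at s1 s1' s2 s5
  change ee q = qpoch q (q ^ 2) * ee (q ^ 2) at s1'
  change ee (q ^ 5) = qpoch (q ^ 5) (q ^ 10) * ee (q ^ 10) at s5
  change (qpoch q (q ^ 2) * qpoch q (q ^ 2) * ee (q ^ 2)) ^ 2 =
    (qpoch (q ^ 5) (q ^ 10) * qpoch (q ^ 5) (q ^ 10) * ee (q ^ 10)) ^ 2 +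
    4 * -q * (qpoch (q ^ 7) (q ^ 10) * qpoch (q ^ 3) (q ^ 10) * ee (q ^ 10)) *
      (qpoch (q ^ 9) (q ^ 10) * qpoch q (q ^ 10) * ee (q ^ 10)) at h
  have f1 : qpoch q (q ^ 2) = ee q / ee (q ^ 2) := by rw [s1']; field_simp
  have f5 : qpoch (q ^ 5) (q ^ 10) = ee (q ^ 5) / ee (q ^ 10) := by rw [s5]; field_simp
  have f : (qpoch (q ^ 7) (q ^ 10) * qpoch (q ^ 3) (q ^ 10)) *
      (qpoch (q ^ 9) (q ^ 10) * qpoch q (q ^ 10)) = ee q * ee (q ^ 10) / (ee (q ^ 2) * ee (q ^ 5)) := by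
    rw [eq_div_iff (mul_ne_zero n2 n5), s1, s2, s5]
    ring
  have h' : (ee q / ee (q ^ 2) * (ee q / ee (q ^ 2)) * ee (q ^ 2)) ^ 2 =
    (ee (q ^ 5) / ee (q ^ 10) * (ee (q ^ 5) / ee (q ^ 10)) * ee (q ^ 10)) ^ 2 +
    4 * -q * (ee q * ee (q ^ 10) / (ee (q ^ 2) * ee (q ^ 5))) * ee (q ^ 10) ^ 2 := by
    rw [← f, ← f1, ← f5, h]; ring
  generalize ee q = E1 at *
  generalize ee (q ^ 2) = E2 at *
  generalize ee (q ^ 5) = E5 at *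
  generalize ee (q ^ 10) = E10 at *
  clear f f1 f5 s1 s1' s2 s5 h
  field_simp at h' ⊢
  linear_combination h'

theorem qneg {q : ℂ} (hq : ‖q‖ < 1) : qpoch (-q) q = ee (q ^ 2) / ee q := by
  rw [eq_div_iff (ee_ne hq), mul_comm]
  exact qp_neg_mul q hq

theorem R2 {q : ℂ} (hq : ‖q‖ < 1) (h0 : q ≠ 0) :
    ee (q ^ 2) ^ 4 * ee (q ^ 5) ^ 2 / (ee q ^ 2 * ee (q ^ 10) ^ 4)
      = ee (q ^ 2) * ee (q ^ 5) ^ 5 / (ee q * ee (q ^ 10) ^ 5) + q := by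
  have h := psi_lattice hq h0
  have t0 : TT 0 = 0 := rfl
  rw [(quad_jtp1 hq h0 1 1 0 (by norm_num) rfl (e := fun j => TT j) (by simp [t0])
      (fun j => by rw [TT_succ]; push_cast; ring)).2,
    (quad_jtp1 hq h0 5 5 0 (by norm_num) rfl (e := fun j => 5 * TT j) (by simp [t0])
      (fun j => by rw [TT_succ]; push_cast; ring)).2,
    (quad_jtp1 hq h0 5 4 1 (by norm_num) rfl (e := fun j => 5 * TT j - j) (by simp [t0])
      (fun j => by rw [TT_succ]; push_cast; ring)).2,
    (quad_jtp1 hq h0 5 3 2 (by norm_num) rfl (e := fun j => 5 * TT j - 2 * j) (by simp [t0])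
      (fun j => by rw [TT_succ]; push_cast; ring)).2] at h
  simp only [pow_one, pow_zero] at h
  have hq5 := npow_lt hq (m := 5) (by norm_num)
  rw [qp_zero_mul (-1) hq, qp_zero_mul (-1) hq5, neg_one_mul, neg_one_mul] at h
  have n1 := ee_ne hq
  have n2 := ee_ne (npow_lt hq (m := 2) (by norm_num))
  have n5 := ee_ne (npow_lt hq (m := 5) (by norm_num))
  have n10 := ee_ne (npow_lt hq (m := 10) (by norm_num))
  have g1 := qneg hq
  have g5 := qneg hq5
  rw [← pow_mul] at g5
  norm_num only at g5
  have s := qp_split (-q) hq 5 (by norm_num)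
  simp only [Finset.prod_range_succ, Finset.prod_range_zero, one_mul, neg_mul, ← pow_succ',
    Nat.reduceAdd, zero_add, pow_one] at s
  rw [g1, g5] at s h
  have f : qpoch (-q) (q ^ 5) * qpoch (-q ^ 2) (q ^ 5) * qpoch (-q ^ 3) (q ^ 5) *
      qpoch (-q ^ 4) (q ^ 5) = ee (q ^ 2) * ee (q ^ 5) / (ee q * ee (q ^ 10)) := by
    rw [eq_div_iff (mul_ne_zero n1 n10)]
    field_simp at s
    linear_combination -s
  change (ee (q ^ 2) / ee q * ((1 - -1) * (ee (q ^ 2) / ee q)) * ee q) ^ 2 =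
    q * (ee (q ^ 10) / ee (q ^ 5) * ((1 - -1) * (ee (q ^ 10) / ee (q ^ 5))) * ee (q ^ 5)) ^ 2 +
    4 * (qpoch (-q ^ 4) (q ^ 5) * qpoch (-q) (q ^ 5) * ee (q ^ 5)) *
      (qpoch (-q ^ 3) (q ^ 5) * qpoch (-q ^ 2) (q ^ 5) * ee (q ^ 5)) at h
  have h' : (ee (q ^ 2) / ee q * ((1 - -1) * (ee (q ^ 2) / ee q)) * ee q) ^ 2 =
    q * (ee (q ^ 10) / ee (q ^ 5) * ((1 - -1) * (ee (q ^ 10) / ee (q ^ 5))) * ee (q ^ 5)) ^ 2 +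
    4 * (ee (q ^ 2) * ee (q ^ 5) / (ee q * ee (q ^ 10))) * ee (q ^ 5) ^ 2 := by
    rw [← f, h]; ring
  generalize ee q = E1 at *
  generalize ee (q ^ 2) = E2 at *
  generalize ee (q ^ 5) = E5 at *
  generalize ee (q ^ 10) = E10 at *
  clear f g1 g5 s h
  field_simp at h' ⊢
  linear_combination h' / 4

theorem ee_neg {q : ℂ} (hq : ‖q‖ < 1) : ee (-q) = ee (q ^ 2) ^ 3 / (ee q * ee (q ^ 4)) := by
  have hQ : ‖-q‖ < 1 := by rwa [norm_neg]
  have hq2 := npow_lt hq (m := 2) (by norm_num)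
  rw [eq_div_iff (mul_ne_zero (ee_ne hq) (ee_ne (npow_lt hq (by norm_num))))]
  have s1 := ee_split hq 2 (by norm_num)
  have s2 := ee_split hQ 2 (by norm_num)
  have s3 := ee_split hq2 2 (by norm_num)
  have s := qp_neg_mul q hq2
  simp only [Finset.prod_range_succ, Finset.prod_range_zero, ← pow_mul, one_mul, zero_add,
    pow_one, Nat.reduceAdd, Nat.reduceMul, even_two.neg_pow] at s1 s2 s3 s
  change _ = _ * ee (q ^ 2) at s1
  change _ = _ * ee (q ^ 2) at s2
  change _ = _ * ee (q ^ 4) at s3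
  rw [s1, s2]
  rw [← s] at s3
  linear_combination (-ee (q^2)^2) * s3

/-! ### The functions F, G, H -/

noncomputable def FF (q : ℂ) : ℂ := q * ee (q ^ 5) ^ 5 / ee q

noncomputable def HH (q : ℂ) : ℂ := ee q ^ 5 / ee (q ^ 5)

noncomputable def GG (q : ℂ) : ℂ := FF q * FF (q ^ 4) / FF (q ^ 2)

theorem FF_ne {q : ℂ} (hq : ‖q‖ < 1) (h0 : q ≠ 0) : FF q ≠ 0 :=
  div_ne_zero (mul_ne_zero h0 (pow_ne_zero _ (ee_ne (npow_lt hq (by norm_num))))) (ee_ne hq)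

theorem FF_neg {q : ℂ} (hq : ‖q‖ < 1) (h0 : q ≠ 0) :
    FF (-q) = -(FF (q ^ 2) ^ 3 / (FF q * FF (q ^ 4))) := by
  have h5 := ee_neg (npow_lt hq (m := 5) (by norm_num))
  have n1 := ee_ne hq
  have n2 := ee_ne (npow_lt hq (m := 2) (by norm_num))
  have n4 := ee_ne (npow_lt hq (m := 4) (by norm_num))
  have n5 := ee_ne (npow_lt hq (m := 5) (by norm_num))
  have n10 := ee_ne (npow_lt hq (m := 10) (by norm_num))
  have n20 := ee_ne (npow_lt hq (m := 20) (by norm_num))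
  unfold FF
  rw [Odd.neg_pow (by decide), ee_neg hq, h5]
  simp only [← pow_mul, Nat.reduceMul]
  field_simp

theorem GG_neg {q : ℂ} (hq : ‖q‖ < 1) (h0 : q ≠ 0) : GG (-q) = -(FF (q ^ 2) ^ 2 / FF q) := by
  have n1 := FF_ne hq h0
  have n2 := FF_ne (npow_lt hq (m := 2) (by norm_num)) (pow_ne_zero 2 h0)
  have n4 := FF_ne (npow_lt hq (m := 4) (by norm_num)) (pow_ne_zero 4 h0)
  unfold GG
  rw [FF_neg hq h0, Even.neg_pow (by decide), Even.neg_pow (by decide)]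
  field_simp

theorem ident_i {q : ℂ} (hq : ‖q‖ < 1) (h0 : q ≠ 0) :
    GG q + GG (-q) = 2 * FF (q ^ 4) - 4 * GG (-q ^ 2) := by
  have hQ : ‖-q‖ < 1 := by rwa [norm_neg]
  have hQ0 : -q ≠ 0 := neg_ne_zero.mpr h0
  have hq2 := npow_lt hq (m := 2) (by norm_num)
  rw [GG_neg hq h0, GG_neg hq2 (pow_ne_zero 2 h0)]
  have r1 := R1 hq h0
  have r2 := R1 hQ hQ0
  have r3 := R1 hq2 (pow_ne_zero 2 h0)
  rw [show (-q) ^ 2 = q ^ 2 by ring, show (-q) ^ 10 = q ^ 10 by ring, show (-q) ^ 5 = -q ^ 5 by ring,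
    ee_neg (npow_lt hq (m := 5) (by norm_num)), ee_neg hq] at r2
  unfold GG FF
  simp only [← pow_mul, Nat.reduceMul] at *
  have n1 := ee_ne hq
  have n2 := ee_ne (npow_lt hq (m := 2) (by norm_num))
  have n4 := ee_ne (npow_lt hq (m := 4) (by norm_num))
  have n5 := ee_ne (npow_lt hq (m := 5) (by norm_num))
  have n10 := ee_ne (npow_lt hq (m := 10) (by norm_num))
  have n20 := ee_ne (npow_lt hq (m := 20) (by norm_num))
  generalize ee q = E1 at *
  generalize ee (q ^ 2) = E2 at *
  generalize ee (q ^ 4) = E4 at *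
  generalize ee (q ^ 5) = E5 at *
  generalize ee (q ^ 10) = E10 at *
  generalize ee (q ^ 20) = E20 at *
  set s := E2 * E5 ^ 5 / (E1 * E10 ^ 5) with hs
  set S := E4 * E10 ^ 5 / (E2 * E20 ^ 5) with hS
  have s0 : s ≠ 0 := div_ne_zero (mul_ne_zero n2 (pow_ne_zero _ n5)) (mul_ne_zero n1 (pow_ne_zero _ n10))
  have S0 : S ≠ 0 := div_ne_zero (mul_ne_zero n4 (pow_ne_zero _ n10)) (mul_ne_zero n2 (pow_ne_zero _ n20))
  have es : E2 * (E10 ^ 3 / (E5 * E20)) ^ 5 / (E2 ^ 3 / (E1 * E4) * E10 ^ 5) = S / s := by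
    rw [hs, hS]; field_simp
  rw [es] at r2
  have key : (S - 4 * q ^ 2) ^ 2 = S * ((s - 4 * q) * (S / s - 4 * -q)) := by
    rw [← r1, ← r2, ← r3, hS]
    field_simp
  have key2 : (s - S / s) * S = 2 * q * S + 4 * q ^ 3 := by
    have : 4 * q * ((s - S / s) * S) = 4 * q * (2 * q * S + 4 * q ^ 3) := by
      have e : s * (S / s) = S := by field_simp
      linear_combination -key - S * e
    exact mul_left_cancel₀ (mul_ne_zero (by norm_num) h0) this
  have f1 : q * E5 ^ 5 / E1 = s / q * (q ^ 2 * E10 ^ 5 / E2) := by rw [hs]; field_simp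
  have f4 : q ^ 4 * E20 ^ 5 / E4 = q ^ 2 / S * (q ^ 2 * E10 ^ 5 / E2) := by rw [hS]; field_simp
  rw [f1, f4]
  have m0 : q ^ 2 * E10 ^ 5 / E2 ≠ 0 :=
    div_ne_zero (mul_ne_zero (pow_ne_zero _ h0) (pow_ne_zero _ n10)) n2
  generalize q ^ 2 * E10 ^ 5 / E2 = F2 at *
  clear_value s S
  field_simp at key2 ⊢
  linear_combination key2

theorem ident_ii {q : ℂ} (hq : ‖q‖ < 1) (h0 : q ≠ 0) :
    -20 * GG (-q) = 5 * FF q - 15 * FF (q ^ 2) + HH q - HH (q ^ 2) := by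
  rw [GG_neg hq h0]
  have r1 := R1 hq h0
  have r2 := R2 hq h0
  unfold FF HH
  simp only [← pow_mul, Nat.reduceMul] at *
  have n1 := ee_ne hq
  have n2 := ee_ne (npow_lt hq (m := 2) (by norm_num))
  have n5 := ee_ne (npow_lt hq (m := 5) (by norm_num))
  have n10 := ee_ne (npow_lt hq (m := 10) (by norm_num))
  generalize ee q = E1 at *
  generalize ee (q ^ 2) = E2 at *
  generalize ee (q ^ 5) = E5 at *
  generalize ee (q ^ 10) = E10 at *
  set s := E2 * E5 ^ 5 / (E1 * E10 ^ 5) with hs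
  have s0 : s ≠ 0 := div_ne_zero (mul_ne_zero n2 (pow_ne_zero _ n5)) (mul_ne_zero n1 (pow_ne_zero _ n10))
  have f1 : q * E5 ^ 5 / E1 = s / q * (q ^ 2 * E10 ^ 5 / E2) := by rw [hs]; field_simp
  have f2 : E1 ^ 5 / E5 = (s - 4 * q) ^ 2 * (s + q) / (s * q ^ 2) * (q ^ 2 * E10 ^ 5 / E2) := by
    rw [← r1, ← r2, hs]; field_simp
  have f3 : E2 ^ 5 / E10 = (s - 4 * q) * (s + q) ^ 2 / (s * q ^ 2) * (q ^ 2 * E10 ^ 5 / E2) := by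
    rw [← r1, ← r2, hs]; field_simp
  rw [f1, f2, f3]
  have m0 : q ^ 2 * E10 ^ 5 / E2 ≠ 0 :=
    div_ne_zero (mul_ne_zero (pow_ne_zero _ h0) (pow_ne_zero _ n10)) n2
  generalize q ^ 2 * E10 ^ 5 / E2 = F2 at *
  clear_value s
  field_simp
  ring

/-! ### Jacobi identity -/

theorem jacobi_fin {q : ℂ} (hq : ‖q‖ < 1) (h0 : q ≠ 0) (m : ℕ) :
    ∑' j : ℤ, CC q (m + 1) j * ((j : ℂ) * ((-1) ^ j * q ^ TT j))
      = (∏ k ∈ Finset.range (m + 1), (1 - q * q ^ k)) * ∏ k ∈ Finset.range m, (1 - q * q ^ k) := by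
  set I := Finset.Icc (-((m + 1 : ℕ) : ℤ)) ((m + 1 : ℕ) : ℤ)
  set R : ℂ → ℂ := fun z => (∏ k ∈ Finset.range (m + 1), (1 + (-(z * q)) * q ^ k)) *
    ∏ k ∈ Finset.range m, (1 + (-z⁻¹) * q ^ (k + 1)) with hR
  have hz : ∀ z : ℂ, z ≠ 0 → ∑ j ∈ I, CC q (m + 1) j * ((-1) ^ j * q ^ TT j) * z ^ j
      = (1 - z⁻¹) * R z := by
    intro z z0
    have h := finite_jtp (a := -(z * q)) (b := -z⁻¹) hq h0 (by field_simp)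
      (w := fun j => ((-1) ^ j * q ^ TT j) * z ^ j) (by simp [TT])
      (fun j => by
        rw [TT_succ, zpow_add_one₀ (by norm_num), zpow_add_one₀ z0, zpow_add₀ h0, zpow_add_one₀ h0]
        ring) (m + 1)
    have h2 := hasSum_sum_of_ne_finset_zero (L := .unconditional ℤ) (s := I)
      (f := fun j => CC q (m + 1) j * (((-1) ^ j * q ^ TT j) * z ^ j))
      (fun j hj => by rw [CC_zero_of q (m + 1) j hj, zero_mul])
    have h3 := h2.unique h
    simp only [← mul_assoc] at h3 ⊢
    rw [h3, hR, Finset.prod_mul_distrib, Finset.prod_range_succ' (fun k => 1 + -z⁻¹ * q ^ k)]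
    simp only [pow_zero]
    ring
  have d1 : HasDerivAt (fun z : ℂ => ∑ j ∈ I, CC q (m + 1) j * ((-1) ^ j * q ^ TT j) * z ^ j)
      (∑ j ∈ I, CC q (m + 1) j * ((-1) ^ j * q ^ TT j) * ((j : ℂ) * 1 ^ (j - 1))) 1 :=
    HasDerivAt.fun_sum fun j _ => (hasDerivAt_zpow j 1 (Or.inl one_ne_zero)).const_mul _
  have dR : DifferentiableAt ℂ R 1 := by
    refine DifferentiableAt.mul (DifferentiableAt.fun_finsetProd fun k _ => ?_)
      (DifferentiableAt.fun_finsetProd fun k _ => ?_)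
    · fun_prop
    · have : DifferentiableAt ℂ (fun z : ℂ => z⁻¹) 1 := differentiableAt_inv one_ne_zero
      fun_prop
  have d2 : HasDerivAt (fun z : ℂ => 1 - z⁻¹) 1 1 := by
    simpa using (hasDerivAt_inv (one_ne_zero (α := ℂ))).const_sub 1
  have d3 := d2.mul dR.hasDerivAt
  have d4 := d1.unique (d3.congr_of_eventuallyEq
    ((eventually_ne_nhds one_ne_zero).mono fun z z0 => hz z z0))
  rw [tsum_eq_sum (s := I) (fun j hj => by rw [CC_zero_of q (m + 1) j hj, zero_mul])]
  refine Eq.trans (Finset.sum_congr rfl fun j _ => ?_) (d4.trans ?_)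
  · simp; ring
  · simp only [hR, inv_one, sub_self, zero_mul, add_zero, one_mul]
    congr 1
    · exact Finset.prod_congr rfl fun k _ => by ring
    · exact Finset.prod_congr rfl fun k _ => by ring

theorem quad_TT {q : ℂ} (hq : ‖q‖ < 1) (h0 : q ≠ 0) :
    Summable (fun j : ℤ => (j : ℂ) * ((-1) ^ j * q ^ TT j)) :=
  (quad_jtp hq h0 (s := -1) (Or.inr rfl) 1 1 0 one_ne_zero rfl (e := TT) rfl
    (fun j => by rw [TT_succ]; push_cast; ring)).2.1

theorem jacobi {q : ℂ} (hq : ‖q‖ < 1) (h0 : q ≠ 0) :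
    ee q ^ 3 = ∑' j : ℤ, (j : ℂ) * ((-1) ^ j * q ^ TT j) := by
  have h1 := (CC_sum_tendsto hq (quad_TT hq h0)).comp (tendsto_add_atTop_nat 1)
  have h2 := ((qp_tendsto q hq).comp (tendsto_add_atTop_nat 1)).mul (qp_tendsto q hq)
  have h3 := tendsto_nhds_unique h1 (h2.congr fun m => (jacobi_fin hq h0 m).symm)
  have n := ee_ne hq
  change (ee q)⁻¹ * _ = ee q * ee q at h3
  rw [inv_mul_eq_iff_eq_mul₀ n] at h3
  rw [h3]; ring

theorem euler {q : ℂ} (hq : ‖q‖ < 1) (h0 : q ≠ 0) :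
    Summable (fun j : ℤ => (-1 : ℂ) ^ j * q ^ (3 * TT j - j)) ∧
    ee q = ∑' j : ℤ, (-1) ^ j * q ^ (3 * TT j - j) := by
  have h := quad_jtp hq h0 (s := -1) (Or.inr rfl) 3 2 1 (by norm_num) rfl
    (e := fun j => 3 * TT j - j) rfl (fun j => by rw [TT_succ]; push_cast; ring)
  refine ⟨h.1, ?_⟩
  rw [h.2.2, ee_split hq 3 (by norm_num)]
  simp only [Finset.prod_range_succ, Finset.prod_range_zero, one_mul, neg_mul, neg_neg,
    Nat.reduceAdd, zero_add]
  ring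

/-! ### 5-dissection -/

theorem sum_mod5 {f : ℤ → ℂ} (hf : Summable f) :
    ∑' j, f j = ∑ r : Fin 5, ∑' k : ℤ, f (5 * k + (r : ℕ)) := by
  let e : Fin 5 × ℤ ≃ ℤ :=
    { toFun := fun p => 5 * p.2 + (p.1 : ℕ)
      invFun := fun j => (⟨(j % 5).toNat, by omega⟩, j / 5)
      left_inv := by
        rintro ⟨⟨r, hr⟩, k⟩
        simp only [Prod.mk.injEq, Fin.mk.injEq]
        refine ⟨?_, ?_⟩ <;> omega
      right_inv := fun j => by
        simp only
        omega }
  rw [← e.tsum_eq, Summable.tsum_prod, tsum_fintype]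
  · rfl
  · exact e.summable_iff.mpr hf

theorem dissect {q : ℂ} {u : ℤ → ℂ} {e : ℤ → ℤ} (ρ : Fin 5 → ℕ)
    (he : ∀ (r : Fin 5) (k : ℤ), ∃ l : ℤ, e (5 * k + (r : ℕ)) = 5 * l + ρ r)
    {ζ : ℂ} (hζ : ζ ^ 5 = 1) (hs : Summable fun j => u j * (ζ * q) ^ e j) :
    ∑' j, u j * (ζ * q) ^ e j
      = ∑ r : Fin 5, ζ ^ ρ r * ∑' k : ℤ, u (5 * k + (r : ℕ)) * q ^ e (5 * k + (r : ℕ)) := by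
  have z0 : ζ ≠ 0 := by rintro rfl; norm_num at hζ
  rw [sum_mod5 hs]
  refine Finset.sum_congr rfl fun r _ => ?_
  rw [← tsum_mul_left]
  refine tsum_congr fun k => ?_
  obtain ⟨l, hl⟩ := he r k
  have : ζ ^ e (5 * k + (r : ℕ)) = ζ ^ ρ r := by
    rw [hl, zpow_add₀ z0, zpow_mul, zpow_natCast]
    have : ζ ^ (5 : ℤ) = 1 := by exact_mod_cast hζ
    rw [this, one_zpow, one_mul]
  rw [mul_zpow, this]; ring

theorem root_norm {ζ : ℂ} (hζ : ζ ^ 5 = 1) : ‖ζ‖ = 1 :=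
  Complex.norm_eq_one_of_pow_eq_one hζ (by norm_num)

/-- terms of the Euler series in a residue class -/
noncomputable def eT (q : ℂ) (r : Fin 5) : ℂ :=
  ∑' k : ℤ, (-1 : ℂ) ^ (5 * k + (r : ℕ)) * q ^ (3 * TT (5 * k + (r : ℕ)) - (5 * k + (r : ℕ)))

theorem TT_eq {j x : ℤ} (h : j * (j + 1) = 2 * x) : TT j = x := by
  have := TT_two j; omega

theorem ee_dissect {q : ℂ} (hq : ‖q‖ < 1) (h0 : q ≠ 0) {ζ : ℂ} (hζ : ζ ^ 5 = 1) :
    ee (ζ * q) = (eT q 0 + eT q 3) + ζ * eT q 4 + ζ ^ 2 * (eT q 1 + eT q 2) := by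
  have z0 : ζ ≠ 0 := by rintro rfl; norm_num at hζ
  have hz : ‖ζ * q‖ < 1 := by rw [norm_mul, root_norm hζ, one_mul]; exact hq
  have h := euler hz (mul_ne_zero z0 h0)
  rw [h.2, dissect (e := fun j => 3 * TT j - j) ![0, 2, 2, 0, 1] ?_ hζ h.1]
  · simp only [Fin.sum_univ_five]
    change ζ ^ 0 * eT q 0 + ζ ^ 2 * eT q 1 + ζ ^ 2 * eT q 2 + ζ ^ 0 * eT q 3 + ζ ^ 1 * eT q 4 = _
    ring
  · intro r k
    have h2 := TT_two (5 * k + (r : ℕ))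
    have h3 := TT_two k
    have h4 := TT_two ((r : ℕ) : ℤ)
    have h5 : TT (5 * k + (r : ℕ)) = 25 * TT k - 10 * k + 5 * k * (r : ℕ) + TT (r : ℕ) := by
      linarith
    rw [h5]
    refine ⟨15 * TT k - 7 * k + 3 * k * (r : ℕ) + ![0, 0, 1, 3, 5] r, ?_⟩
    fin_cases r <;> simp [TT] <;> ring

theorem cube_dissect {q : ℂ} (hq : ‖q‖ < 1) (h0 : q ≠ 0) :
    ∃ t0 t1 t3 : ℂ, ∀ ζ : ℂ, ζ ^ 5 = 1 → ee (ζ * q) ^ 3 = t0 + ζ * t1 + ζ ^ 3 * t3 := by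
  let T : Fin 5 → ℂ := fun r => ∑' k : ℤ, (((5 * k + (r : ℕ) : ℤ) : ℂ) * (-1 : ℂ) ^ (5 * k + (r : ℕ)))
    * q ^ TT (5 * k + (r : ℕ))
  refine ⟨T 0 + T 4, T 1 + T 3, T 2, fun ζ hζ => ?_⟩
  have z0 : ζ ≠ 0 := by rintro rfl; norm_num at hζ
  have hz : ‖ζ * q‖ < 1 := by rw [norm_mul, root_norm hζ, one_mul]; exact hq
  have h := jacobi hz (mul_ne_zero z0 h0)
  have hs := quad_TT hz (mul_ne_zero z0 h0)
  simp only [← mul_assoc] at h hs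
  rw [h, dissect (u := fun j => (j : ℂ) * (-1) ^ j) (e := TT) ![0, 1, 3, 1, 0] ?_ hζ hs]
  · simp only [Fin.sum_univ_five]
    change ζ ^ 0 * T 0 + ζ ^ 1 * T 1 + ζ ^ 3 * T 2 + ζ ^ 1 * T 3 + ζ ^ 0 * T 4 = _
    ring
  · intro r k
    have h2 := TT_two (5 * k + (r : ℕ))
    have h3 := TT_two k
    have h4 := TT_two ((r : ℕ) : ℤ)
    have h5 : TT (5 * k + (r : ℕ)) = 25 * TT k - 10 * k + 5 * k * (r : ℕ) + TT (r : ℕ) := by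
      linarith
    rw [h5]
    refine ⟨5 * TT k - 2 * k + k * (r : ℕ) + ![0, 0, 0, 1, 2] r, ?_⟩
    fin_cases r <;> simp [TT] <;> ring

theorem eT4 {q : ℂ} (hq : ‖q‖ < 1) (h0 : q ≠ 0) : eT q 4 = -(q * ee (q ^ 25)) := by
  rw [(euler (npow_lt hq (m := 25) (by norm_num)) (pow_ne_zero _ h0)).2]
  unfold eT
  rw [← neg_sum _ 1, ← tsum_mul_left, ← tsum_neg]
  refine tsum_congr fun k => ?_
  have h1 := TT_two k
  have h2 := TT_two (5 * -(k + 1) + ((4 : Fin 5) : ℕ))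
  have c : (((4 : Fin 5) : ℕ) : ℤ) = 4 := rfl
  rw [c] at h2 ⊢
  have e1 : 3 * TT (5 * -(k + 1) + 4) - (5 * -(k + 1) + 4) = 25 * (3 * TT k - k) + 1 := by linarith
  have e2 : (-1 : ℂ) ^ (5 * -(k + 1) + 4) = -(-1) ^ k := by
    rw [show 5 * -(k + 1) + 4 = k + (2 * (-3 * k - 1) + 1) by ring, zpow_add₀ (by norm_num),
      zpow_add₀ (by norm_num), zpow_mul]
    norm_num
  rw [e1, e2, zpow_add_one₀ h0, zpow_mul]
  norm_cast
  ring

/-! ### Consequences of the 5-dissection -/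

theorem five {ω : ℂ} (hω : IsPrimitiveRoot ω 5) {d : Fin 5 → ℂ}
    (h : ∀ ζ : ℂ, ζ ^ 5 = 1 → ∑ i : Fin 5, ζ ^ (i : ℕ) * d i = 0) : d = 0 := by
  refine Matrix.eq_zero_of_forall_index_sum_pow_mul_eq_zero (f := fun j : Fin 5 => ω ^ (j : ℕ)) ?_ ?_
  · intro i j hij
    exact Fin.ext (hω.pow_inj i.2 j.2 hij)
  · intro j
    exact h _ (by rw [← pow_mul, mul_comm, pow_mul, hω.pow_eq_one, one_pow])

theorem AC_eq {q : ℂ} (hq : ‖q‖ < 1) (h0 : q ≠ 0) (hsm : ee q + q * ee (q ^ 25) ≠ 0) :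
    (eT q 0 + eT q 3) * (eT q 1 + eT q 2) = -eT q 4 ^ 2 := by
  obtain ⟨ω, hω⟩ : ∃ ω : ℂ, IsPrimitiveRoot ω 5 := ⟨_, Complex.isPrimitiveRoot_exp 5 (by norm_num)⟩
  obtain ⟨t0, t1, t3, ht⟩ := cube_dissect hq h0
  have hE := fun ζ hζ => ee_dissect hq h0 (ζ := ζ) hζ
  have hB := eT4 hq h0
  generalize eT q 0 + eT q 3 = A at *
  generalize eT q 1 + eT q 2 = C at *
  generalize eT q 4 = B at *
  have h5 := five hω (d := ![A ^ 3 + 3 * B * C ^ 2 - t0, 3 * A ^ 2 * B + C ^ 3 - t1,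
    3 * A * (A * C + B ^ 2), 6 * A * B * C + B ^ 3 - t3, 3 * C * (A * C + B ^ 2)])
    (fun ζ hζ => by
      have := ht ζ hζ
      rw [hE ζ hζ] at this
      simp [Fin.sum_univ_five]
      linear_combination this - (3 * B * C ^ 2 + C ^ 3 * ζ) * hζ)
  have c2 : 3 * A * (A * C + B ^ 2) = 0 := congrFun h5 2
  have c4 : 3 * C * (A * C + B ^ 2) = 0 := congrFun h5 4
  by_contra hne
  have hne' : A * C + B ^ 2 ≠ 0 := fun h => hne (by linear_combination h)
  have hA : A = 0 := by simpa [hne'] using c2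
  have hC : C = 0 := by simpa [hne'] using c4
  have := hE 1 (by norm_num)
  rw [hA, hC, hB, one_mul] at this
  exact hsm (by rw [this]; ring)

theorem prod_root {ω : ℂ} (hω : IsPrimitiveRoot ω 5) (x y : ℂ) :
    ∏ k ∈ Finset.range 5, (x - ω ^ k * y) = x ^ 5 - y ^ 5 := by
  have h1 : ω ^ 5 = 1 := hω.pow_eq_one
  have h2 := hω.geom_sum_eq_zero (by norm_num)
  simp only [Finset.sum_range_succ, Finset.sum_range_zero, Finset.prod_range_succ,
    Finset.prod_range_zero, pow_zero, pow_one, zero_add, one_mul] at h2 ⊢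
  have a1 : (x - ω * y) * (x - ω ^ 4 * y) = x ^ 2 - (ω + ω ^ 4) * (x * y) + y ^ 2 := by
    linear_combination y ^ 2 * h1
  have a2 : (x - ω ^ 2 * y) * (x - ω ^ 3 * y) = x ^ 2 - (ω ^ 2 + ω ^ 3) * (x * y) + y ^ 2 := by
    linear_combination y ^ 2 * h1
  have b2 : (ω + ω ^ 4) * (ω ^ 2 + ω ^ 3) = -1 := by
    linear_combination h2 + (ω + ω ^ 2) * h1
  calc _ = (x - y) * (((x - ω * y) * (x - ω ^ 4 * y)) * ((x - ω ^ 2 * y) * (x - ω ^ 3 * y))) := by ring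
    _ = _ := by
      rw [a1, a2]
      linear_combination (x - y) * (x * y) ^ 2 * b2 - (x - y) * (x * y) * (x ^ 2 + y ^ 2) * h2

theorem prod_qp {ω : ℂ} (hω : IsPrimitiveRoot ω 5) (a : ℂ) {Q : ℂ} (hQ : ‖Q‖ < 1) :
    ∏ k ∈ Finset.range 5, qpoch (ω ^ k * a) Q = qpoch (a ^ 5) (Q ^ 5) := by
  have h1 := tendsto_finsetProd (Finset.range 5) (fun k _ => qp_tendsto (ω ^ k * a) hQ)
  refine tendsto_nhds_unique h1
    ((qp_tendsto (a ^ 5) (npow_lt hQ (m := 5) (by norm_num))).congr fun n => ?_)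
  rw [Finset.prod_comm]
  refine Finset.prod_congr rfl fun i _ => ?_
  have := prod_root hω 1 (a * Q ^ i)
  simp only [← mul_assoc] at this
  rw [this]; ring

theorem prod_ee {ω : ℂ} (hω : IsPrimitiveRoot ω 5) {q : ℂ} (hq : ‖q‖ < 1) :
    (∏ k ∈ Finset.range 5, ee (ω ^ k * q)) * ee (q ^ 25) = ee (q ^ 5) ^ 6 := by
  have h1 : ω ^ 5 = 1 := hω.pow_eq_one
  have hq5 := npow_lt hq (m := 5) (by norm_num)
  have key : ∀ k, ee (ω ^ k * q) = (∏ j ∈ Finset.range 4,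
      qpoch ((ω ^ (j + 1)) ^ k * q ^ (j + 1)) (q ^ 5)) * ee (q ^ 5) := by
    intro k
    have hk : (ω ^ k) ^ 5 = 1 := by rw [← pow_mul, mul_comm, pow_mul, h1, one_pow]
    have hz : ‖ω ^ k * q‖ < 1 := by rw [norm_mul, root_norm hk, one_mul]; exact hq
    have e5 : (ω ^ k * q) ^ 5 = q ^ 5 := by rw [mul_pow, hk, one_mul]
    rw [ee_split hz 5 (by norm_num), Finset.prod_range_succ, e5]
    congr 1
    exact Finset.prod_congr rfl fun j _ => by rw [mul_pow, ← pow_mul, ← pow_mul, mul_comm k]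
  simp only [key]
  rw [Finset.prod_mul_distrib, Finset.prod_const, Finset.card_range, Finset.prod_comm]
  have key2 : ∀ j ∈ Finset.range 4, ∏ k ∈ Finset.range 5,
      qpoch ((ω ^ (j + 1)) ^ k * q ^ (j + 1)) (q ^ 5) = qpoch ((q ^ 5) ^ (j + 1)) ((q ^ 5) ^ 5) := by
    intro j hj
    have hj' := Finset.mem_range.mp hj
    have hcop : (j + 1).Coprime 5 := by interval_cases j <;> norm_num
    rw [prod_qp (hω.pow_of_coprime (j + 1) hcop) _ hq5, ← pow_mul q (j + 1) 5,
      ← pow_mul q 5 (j + 1), mul_comm (j + 1)]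
  rw [Finset.prod_congr rfl key2]
  have s := ee_split hq5 5 (by norm_num)
  rw [Finset.prod_range_succ, ← pow_mul q 5 5] at s
  change _ = _ * ee (q ^ 25) at s
  rw [← pow_mul q 5 5]
  change _ * _ * ee (q ^ 25) = _
  linear_combination -ee (q ^ 5) ^ 5 * s

theorem prod_quad {ω : ℂ} (hω : IsPrimitiveRoot ω 5) (x : ℂ) :
    ∏ k ∈ Finset.range 5, (1 + ω ^ k * x - (ω ^ k * x) ^ 2) = 1 + 11 * x ^ 5 - x ^ 10 := by
  obtain ⟨α, hα⟩ : ∃ α : ℂ, α ^ 2 = α + 1 := by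
    obtain ⟨s, hs⟩ := IsAlgClosed.exists_pow_nat_eq (5 : ℂ) (n := 2) (by norm_num)
    exact ⟨(1 + s) / 2, by linear_combination hs / 4⟩
  have h : ∀ k ∈ Finset.range 5, (1 + ω ^ k * x - (ω ^ k * x) ^ 2) =
      (1 - ω ^ k * (x * (α - 1))) * (1 - ω ^ k * (x * (-α))) := by
    intro k _
    linear_combination (ω ^ k * x) ^ 2 * hα
  rw [Finset.prod_congr rfl h, Finset.prod_mul_distrib, prod_root hω, prod_root hω]
  have e5 : (-α) ^ 5 = -5 * α - 3 := by
    linear_combination - (α ^ 3 + α ^ 2 + 2 * α + 3) * hα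
  have e5' : (α - 1) ^ 5 = 5 * α - 8 := by
    linear_combination - (-α ^ 3 + 4 * α ^ 2 - 7 * α + 7) * hα
  rw [mul_pow, mul_pow, e5, e5']
  linear_combination -25 * x ^ 10 * hα

theorem HF_dissect {q : ℂ} (hq : ‖q‖ < 1) (h0 : q ≠ 0) (hsm : ee q + q * ee (q ^ 25) ≠ 0) :
    (∃ k0 k1 k4 : ℂ, ∀ ζ : ℂ, ζ ^ 5 = 1 →
      HH (ζ * q) - 5 * FF (ζ * q) = k0 + k1 * ζ + k4 * ζ ^ 4) ∧
    (∃ k0 k2 k3 : ℂ, ∀ ζ : ℂ, ζ ^ 5 = 1 →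
      HH (ζ * q) + 5 * FF (ζ * q) = k0 + k2 * ζ ^ 2 + k3 * ζ ^ 3) := by
  obtain ⟨ω, hω⟩ : ∃ ω : ℂ, IsPrimitiveRoot ω 5 := ⟨_, Complex.isPrimitiveRoot_exp 5 (by norm_num)⟩
  have hE := fun ζ hζ => ee_dissect hq h0 (ζ := ζ) hζ
  have hB := eT4 hq h0
  have hAC := AC_eq hq h0 hsm
  have n5 := ee_ne (npow_lt hq (m := 5) (by norm_num))
  have n25 := ee_ne (npow_lt hq (m := 25) (by norm_num))
  have hP := prod_ee hω hq
  generalize eT q 0 + eT q 3 = A at *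
  generalize eT q 1 + eT q 2 = C at *
  generalize eT q 4 = B at *
  have B0 : B ≠ 0 := by rw [hB]; exact neg_ne_zero.mpr (mul_ne_zero h0 n25)
  have A0 : A ≠ 0 := by
    rintro rfl
    rw [zero_mul] at hAC
    exact B0 (pow_eq_zero_iff two_ne_zero |>.mp (neg_eq_zero.mp hAC.symm))
  obtain ⟨x, rfl⟩ : ∃ x, B = A * x := ⟨B / A, by field_simp⟩
  have hC : C = -(A * x ^ 2) := mul_left_cancel₀ A0 (by rw [hAC]; ring)
  have hE' : ∀ ζ : ℂ, ζ ^ 5 = 1 → ee (ζ * q) = A * (1 + ζ * x - (ζ * x) ^ 2) := by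
    intro ζ hζ
    rw [hE ζ hζ, hC]; ring
  have hN : A ^ 5 * (1 + 11 * x ^ 5 - x ^ 10) * ee (q ^ 25) = ee (q ^ 5) ^ 6 := by
    rw [← hP, ← prod_quad hω, Finset.prod_congr rfl fun k _ => hE' (ω ^ k)
      (by rw [← pow_mul, mul_comm, pow_mul, hω.pow_eq_one, one_pow]), Finset.prod_mul_distrib]
    simp
  have hF : ∀ ζ : ℂ, ζ ^ 5 = 1 → FF (ζ * q) = -(A ^ 5 / ee (q ^ 5)) * (ζ * x - ζ ^ 2 * x ^ 2
      + 2 * ζ ^ 3 * x ^ 3 - 3 * ζ ^ 4 * x ^ 4 + 5 * x ^ 5 + 3 * ζ * x ^ 6 + 2 * ζ ^ 2 * x ^ 7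
      + ζ ^ 3 * x ^ 8 + ζ ^ 4 * x ^ 9) := by
    intro ζ hζ
    have z0 : ζ ≠ 0 := by rintro rfl; norm_num at hζ
    have hz : ‖ζ * q‖ < 1 := by rw [norm_mul, root_norm hζ, one_mul]; exact hq
    have nz := ee_ne hz
    have e5 : (ζ * q) ^ 5 = q ^ 5 := by rw [mul_pow, hζ, one_mul]
    unfold FF
    rw [e5, div_eq_iff nz]
    have h1 : ζ * q * ee (q ^ 5) ^ 6 = -(A ^ 5 * (ζ * x - ζ ^ 2 * x ^ 2
      + 2 * ζ ^ 3 * x ^ 3 - 3 * ζ ^ 4 * x ^ 4 + 5 * x ^ 5 + 3 * ζ * x ^ 6 + 2 * ζ ^ 2 * x ^ 7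
      + ζ ^ 3 * x ^ 8 + ζ ^ 4 * x ^ 9) * ee (ζ * q)) := by
      rw [← hN, hE' ζ hζ]
      have hB' : q * ee (q ^ 25) = -(A * x) := by rw [hB, neg_neg]
      linear_combination ζ * A ^ 5 * (1 + 11 * x ^ 5 - x ^ 10) * hB' + A ^ 6 *
        (ζ * x * (11 * x ^ 5 - x ^ 10 * (ζ ^ 5 + 1)) - (5 * x ^ 5 + 3 * ζ * x ^ 6 + 2 * ζ ^ 2 * x ^ 7
          + ζ ^ 3 * x ^ 8 + ζ ^ 4 * x ^ 9) * (1 + ζ * x - (ζ * x) ^ 2)) * hζ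
    field_simp
    linear_combination h1
  have hH : ∀ ζ : ℂ, ζ ^ 5 = 1 → HH (ζ * q) = A ^ 5 / ee (q ^ 5) * (1 + 5 * ζ * x + 5 * ζ ^ 2 * x ^ 2
      - 10 * ζ ^ 3 * x ^ 3 - 15 * ζ ^ 4 * x ^ 4 + 11 * x ^ 5 + 15 * ζ * x ^ 6 - 10 * ζ ^ 2 * x ^ 7
      - 5 * ζ ^ 3 * x ^ 8 + 5 * ζ ^ 4 * x ^ 9 - x ^ 10) := by
    intro ζ hζ
    have e5 : (ζ * q) ^ 5 = q ^ 5 := by rw [mul_pow, hζ, one_mul]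
    unfold HH
    rw [e5, hE' ζ hζ]
    have : (1 + ζ * x - (ζ * x) ^ 2) ^ 5 = (1 + 5 * ζ * x + 5 * ζ ^ 2 * x ^ 2
      - 10 * ζ ^ 3 * x ^ 3 - 15 * ζ ^ 4 * x ^ 4 + 11 * x ^ 5 + 15 * ζ * x ^ 6 - 10 * ζ ^ 2 * x ^ 7
      - 5 * ζ ^ 3 * x ^ 8 + 5 * ζ ^ 4 * x ^ 9 - x ^ 10) := by
      linear_combination (11 * x ^ 5 + 15 * ζ * x ^ 6 - 10 * ζ ^ 2 * x ^ 7
        - 5 * ζ ^ 3 * x ^ 8 + 5 * ζ ^ 4 * x ^ 9 - x ^ 10 * (ζ ^ 5 + 1)) * hζ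
    rw [mul_pow, this]; ring
  generalize A ^ 5 / ee (q ^ 5) = D at *
  constructor
  · refine ⟨D * (1 + 36 * x ^ 5 - x ^ 10), D * (10 * x + 30 * x ^ 6),
      D * (-30 * x ^ 4 + 10 * x ^ 9), fun ζ hζ => ?_⟩
    rw [hH ζ hζ, hF ζ hζ]; ring
  · refine ⟨D * (1 - 14 * x ^ 5 - x ^ 10), D * (10 * x ^ 2 - 20 * x ^ 7),
      D * (-20 * x ^ 3 - 10 * x ^ 8), fun ζ hζ => ?_⟩
    rw [hH ζ hζ, hF ζ hζ]; ring

/-! ### Power series representations near zero -/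

def PSer (f : ℂ → ℂ) (u : ℕ → ℂ) : Prop :=
  ∀ᶠ q in 𝓝[≠] (0 : ℂ), HasSum (fun n : ℕ => u n * q ^ n) (f q)

theorem PSer.congr {f g : ℂ → ℂ} {u : ℕ → ℂ} (h : PSer f u) (hfg : ∀ᶠ q in 𝓝[≠] (0 : ℂ), f q = g q) :
    PSer g u := by
  filter_upwards [h, hfg] with q h1 h2
  rwa [← h2]

theorem PSer.add {f g : ℂ → ℂ} {u v : ℕ → ℂ} (h : PSer f u) (h' : PSer g v) :
    PSer (fun q => f q + g q) (fun n => u n + v n) := by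
  filter_upwards [h, h'] with q h1 h2
  simpa only [add_mul] using h1.add h2

theorem PSer.smul {f : ℂ → ℂ} {u : ℕ → ℂ} (h : PSer f u) (c : ℂ) :
    PSer (fun q => c * f q) (fun n => c * u n) := by
  filter_upwards [h] with q h1
  simpa only [mul_assoc] using h1.mul_left c

theorem PSer.sum {f : ℕ → ℂ → ℂ} {u : ℕ → ℕ → ℂ} (s : Finset ℕ) (h : ∀ k, PSer (f k) (u k)) :
    PSer (fun q => ∑ k ∈ s, f k q) (fun n => ∑ k ∈ s, u k n) := by
  have : ∀ᶠ q in 𝓝[≠] (0 : ℂ), ∀ k ∈ s, HasSum (fun n : ℕ => u k n * q ^ n) (f k q) :=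
    (Filter.eventually_all_finset s).mpr fun k _ => h k
  filter_upwards [this] with q h1
  simpa only [Finset.sum_mul] using hasSum_sum h1

theorem PSer.scale {f : ℂ → ℂ} {u : ℕ → ℂ} (h : PSer f u) {ζ : ℂ} (hζ : ζ ≠ 0) :
    PSer (fun q => f (ζ * q)) (fun n => ζ ^ n * u n) := by
  have ht : Tendsto (fun q : ℂ => ζ * q) (𝓝[≠] 0) (𝓝[≠] 0) := by
    refine tendsto_nhdsWithin_iff.mpr ⟨?_, ?_⟩
    · have : Tendsto (fun q : ℂ => ζ * q) (𝓝 0) (𝓝 (ζ * 0)) := (continuous_const_mul ζ).tendsto 0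
      rw [mul_zero] at this
      exact this.mono_left nhdsWithin_le_nhds
    · filter_upwards [self_mem_nhdsWithin] with q hq
      exact mul_ne_zero hζ hq
  filter_upwards [ht.eventually h] with q h1
  convert h1 using 2 with n
  rw [mul_pow]; ring

theorem PSer.pow {f : ℂ → ℂ} {u : ℕ → ℂ} (h : PSer f u) {k : ℕ} (hk : k ≠ 0) :
    PSer (fun q => f (q ^ k)) (fun n => if k ∣ n then u (n / k) else 0) := by
  have ht : Tendsto (fun q : ℂ => q ^ k) (𝓝[≠] 0) (𝓝[≠] 0) := by
    refine tendsto_nhdsWithin_iff.mpr ⟨?_, ?_⟩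
    · have : Tendsto (fun q : ℂ => q ^ k) (𝓝 0) (𝓝 (0 ^ k)) := (continuous_pow k).tendsto 0
      rw [zero_pow hk] at this
      exact this.mono_left nhdsWithin_le_nhds
    · filter_upwards [self_mem_nhdsWithin] with q hq
      exact pow_ne_zero k hq
  filter_upwards [ht.eventually h] with q h1
  have hinj : Function.Injective (fun n : ℕ => k * n) := fun a b hab =>
    Nat.eq_of_mul_eq_mul_left (Nat.pos_of_ne_zero hk) hab
  rw [← hinj.hasSum_iff]
  · convert h1 using 2 with n
    simp only [Function.comp, dvd_mul_right, if_true, Nat.mul_div_cancel_left n (Nat.pos_of_ne_zero hk),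
      pow_mul]
  · intro n hn
    rw [if_neg, zero_mul]
    rintro ⟨m, rfl⟩
    exact hn ⟨m, rfl⟩

theorem PSer.shift {f : ℂ → ℂ} {u : ℕ → ℂ} (h : PSer f u) (k : ℕ) :
    PSer (fun q => q ^ k * f q) (fun n => if k ≤ n then u (n - k) else 0) := by
  filter_upwards [h] with q h1
  have hinj : Function.Injective (fun n : ℕ => n + k) := add_left_injective k
  rw [← hinj.hasSum_iff]
  · refine Eq.mpr (congrArg (fun F => HasSum F (q ^ k * f q)) (funext fun n => ?_))
      (h1.mul_left (q ^ k))
    change (if k ≤ n + k then u (n + k - k) else 0) * q ^ (n + k) = _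
    rw [if_pos (Nat.le_add_left k n), Nat.add_sub_cancel]
    ring
  · intro n hn
    rw [if_neg, zero_mul]
    intro hkn
    exact hn ⟨n - k, Nat.sub_add_cancel hkn⟩

theorem PSer.zero {u : ℕ → ℂ} (h : PSer (fun _ => 0) u) : ∀ n, u n = 0 := by
  set p := FormalMultilinearSeries.ofScalars ℂ u with hp
  have hF : HasFPowerSeriesAt (fun q => ∑' n, u n * q ^ n) p 0 := by
    rw [hasFPowerSeriesAt_iff]
    have h' := eventually_nhdsWithin_iff.mp h
    filter_upwards [h'] with q hq
    simp only [hp, FormalMultilinearSeries.coeff_ofScalars, zero_add, smul_eq_mul, mul_comm (q ^ _)]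
    by_cases h0 : q = 0
    · subst h0
      exact (summable_of_ne_finset_zero (s := {0}) (fun n hn => by
        rw [zero_pow (by simpa using hn), mul_zero])).hasSum
    · exact (hq h0).summable.hasSum
  have ha : AnalyticAt ℂ (fun q => ∑' n, u n * q ^ n) 0 := ⟨p, hF⟩
  have hz : ∀ᶠ q in 𝓝 (0 : ℂ), ∑' n, u n * q ^ n = 0 := by
    rw [← ha.frequently_zero_iff_eventually_zero]
    exact (h.mono fun q hq => hq.tsum_eq).frequently
  have hp0 : p = 0 := hF.eq_zero_of_eventually hz
  intro n
  have := congrArg (fun p => p.coeff n) hp0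
  have h0 : (0 : FormalMultilinearSeries ℂ ℂ ℂ).coeff n = 0 := rfl
  simp only [hp, FormalMultilinearSeries.coeff_ofScalars, h0] at this
  exact this

theorem PSer.unique {f : ℂ → ℂ} {u v : ℕ → ℂ} (h : PSer f u) (h' : PSer f v) (n : ℕ) : u n = v n := by
  have := ((h.add (h'.smul (-1))).congr (.of_forall fun q => by ring)).zero n
  linear_combination this

theorem PSer.coeff_zero {f : ℂ → ℂ} {u : ℕ → ℂ} (h : PSer f u) (t e1 e2 : ℕ) (h1 : t.Coprime 5)
    (h2 : (t + e1).Coprime 5) (h3 : (t + e2).Coprime 5)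
    (hf : ∀ᶠ q in 𝓝[≠] (0 : ℂ), ∃ k0 k1 k2 : ℂ, ∀ ζ : ℂ, ζ ^ 5 = 1 →
      f (ζ * q) = k0 + k1 * ζ ^ e1 + k2 * ζ ^ e2) (n : ℕ) (hn : 5 ∣ t + n) : u n = 0 := by
  obtain ⟨ω, hω⟩ : ∃ ω : ℂ, IsPrimitiveRoot ω 5 := ⟨_, Complex.isPrimitiveRoot_exp 5 (by norm_num)⟩
  have hk : ∀ k, (ω ^ k) ^ 5 = 1 := fun k => by
    rw [← pow_mul, mul_comm, pow_mul, hω.pow_eq_one, one_pow]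
  have hr := PSer.sum (Finset.range 5) fun k =>
    (h.scale (ζ := ω ^ k) (pow_ne_zero k (hω.ne_zero (by norm_num)))).smul ((ω ^ k) ^ t)
  have orth : ∀ s : ℕ, s.Coprime 5 → ∑ k ∈ Finset.range 5, (ω ^ k) ^ s = 0 := by
    intro s hs
    rw [← (hω.pow_of_coprime s hs).geom_sum_eq_zero (by norm_num)]
    exact Finset.sum_congr rfl fun k _ => by rw [← pow_mul, ← pow_mul, mul_comm]
  have hz := (hr.congr (g := fun _ => 0) (by
    filter_upwards [hf] with q ⟨k0, k1, k2, hq⟩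
    have : ∀ k ∈ Finset.range 5, (ω ^ k) ^ t * f (ω ^ k * q) = k0 * (ω ^ k) ^ t
        + k1 * (ω ^ k) ^ (t + e1) + k2 * (ω ^ k) ^ (t + e2) := fun k _ => by
      rw [hq _ (hk k)]; ring
    rw [Finset.sum_congr rfl this, Finset.sum_add_distrib, Finset.sum_add_distrib,
      ← Finset.mul_sum, ← Finset.mul_sum, ← Finset.mul_sum, orth _ h1, orth _ h2, orth _ h3]
    simp)).zero n
  have : ∀ k ∈ Finset.range 5, (ω ^ k) ^ t * ((ω ^ k) ^ n * u n) = u n := fun k _ => by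
    obtain ⟨m, hm⟩ := hn
    rw [← mul_assoc, ← pow_add, hm, pow_mul, hk, one_pow, one_mul]
  rw [Finset.sum_congr rfl this] at hz
  simpa using hz

theorem ee_analytic : AnalyticAt ℂ ee 0 := by
  have h := ModularForm.differentiableOn_tprod_one_sub_pow.analyticAt
    (Metric.ball_mem_nhds (0 : ℂ) one_pos)
  have : ee = fun q => ∏' n : ℕ, (1 - q ^ (n + 1)) := by
    funext q
    simp only [ee, qpoch, pow_succ']
  rwa [this]

theorem ee_zero : ee 0 = 1 := by simp [ee, qpoch]

theorem ee_pow_analytic {k : ℕ} (hk : k ≠ 0) : AnalyticAt ℂ (fun q => ee (q ^ k)) 0 := by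
  have h : AnalyticAt ℂ ee ((0 : ℂ) ^ k) := by rw [zero_pow hk]; exact ee_analytic
  exact AnalyticAt.comp (f := fun q : ℂ => q ^ k) (x := 0) h (by fun_prop)

theorem HH_rep : ∃ h, PSer HH h := by
  have ha : AnalyticAt ℂ HH 0 := by
    refine (ee_analytic.pow 5).div (ee_pow_analytic (by norm_num)) ?_
    simp [ee_zero]
  obtain ⟨p, hp⟩ := ha
  refine ⟨p.coeff, ?_⟩
  rw [hasFPowerSeriesAt_iff] at hp
  refine (hp.mono fun q hq => ?_).filter_mono nhdsWithin_le_nhds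
  simpa only [smul_eq_mul, mul_comm, zero_add] using hq

theorem near : ∀ᶠ q in 𝓝[≠] (0 : ℂ), ‖q‖ < 1 ∧ q ≠ 0 ∧ ee q + q * ee (q ^ 25) ≠ 0 := by
  have h1 : ∀ᶠ q in 𝓝[≠] (0 : ℂ), ‖q‖ < 1 := by
    refine Filter.Eventually.filter_mono nhdsWithin_le_nhds ?_
    filter_upwards [Metric.ball_mem_nhds (0 : ℂ) one_pos] with q hq
    simpa using hq
  have hc : ContinuousAt (fun q => ee q + q * ee (q ^ 25)) 0 :=
    ee_analytic.continuousAt.add (continuousAt_id.mul (ee_pow_analytic (by norm_num)).continuousAt)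
  have h3 : ∀ᶠ q in 𝓝[≠] (0 : ℂ), ee q + q * ee (q ^ 25) ≠ 0 :=
    (hc.eventually_ne (by simp [ee_zero])).filter_mono nhdsWithin_le_nhds
  filter_upwards [h1, h3, self_mem_nhdsWithin] with q a b c
  exact ⟨a, c, b⟩

theorem rep_of_tsum {f : ℂ → ℂ} {u : ℕ → ℂ} (h : ∀ q : ℂ, ‖q‖ < 1 → ∑' n : ℕ, u n * q ^ n = f q)
    (hne : ∀ q : ℂ, ‖q‖ < 1 → f q ≠ 0) : PSer f u := by
  filter_upwards [near] with q hq
  have hs : Summable fun n : ℕ => u n * q ^ n := by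
    by_contra hns
    exact hne q hq.1 (by rw [← h q hq.1, tsum_eq_zero_of_not_summable hns])
  rw [← h q hq.1]
  exact hs.hasSum

/-- the combinatorics of the coefficients -/
theorem final_coeff {a g : ℕ → ℂ} (ha : PSer FF a) (hg : PSer GG g) (m : ℕ)
    (hm : m % 5 = 2 ∨ m % 5 = 3) : g (4 * m) = -a m := by
  obtain ⟨h, hh⟩ := HH_rep
  have u1 : ∀ n, n % 5 = 2 ∨ n % 5 = 3 → h n = 5 * a n := by
    intro n hn
    have hr := (hh.add (ha.smul (-5)))
    have hf : ∀ᶠ q in 𝓝[≠] (0 : ℂ), ∃ k0 k1 k2 : ℂ, ∀ ζ : ℂ, ζ ^ 5 = 1 →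
      HH (ζ * q) + -5 * FF (ζ * q) = k0 + k1 * ζ ^ 1 + k2 * ζ ^ 4 := by
      filter_upwards [near] with q hq
      obtain ⟨k0, k1, k2, hk⟩ := (HF_dissect hq.1 hq.2.1 hq.2.2).1
      exact ⟨k0, k1, k2, fun ζ hζ => by rw [pow_one, ← hk ζ hζ]; ring⟩
    have : h n + -5 * a n = 0 := by
      rcases hn with hn | hn
      · exact hr.coeff_zero 3 1 4 (by norm_num) (by norm_num) (by norm_num) hf n (by omega)
      · exact hr.coeff_zero 2 1 4 (by norm_num) (by norm_num) (by norm_num) hf n (by omega)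
    linear_combination this
  have u2 : ∀ n, n % 5 = 1 ∨ n % 5 = 4 → h n = -5 * a n := by
    intro n hn
    have hr := (hh.add (ha.smul 5))
    have hf : ∀ᶠ q in 𝓝[≠] (0 : ℂ), ∃ k0 k1 k2 : ℂ, ∀ ζ : ℂ, ζ ^ 5 = 1 →
      HH (ζ * q) + 5 * FF (ζ * q) = k0 + k1 * ζ ^ 2 + k2 * ζ ^ 3 := by
      filter_upwards [near] with q hq
      exact (HF_dissect hq.1 hq.2.1 hq.2.2).2
    have : h n + 5 * a n = 0 := by
      rcases hn with hn | hn
      · exact hr.coeff_zero 4 2 3 (by norm_num) (by norm_num) (by norm_num) hf n (by omega)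
      · exact hr.coeff_zero 1 2 3 (by norm_num) (by norm_num) (by norm_num) hf n (by omega)
    linear_combination this
  have hgn := hg.scale (ζ := -1) (by norm_num)
  have i1 := (hg.add hgn).congr (g := fun q => 2 * FF (q ^ 4) + -4 * GG (-1 * q ^ 2)) (by
    filter_upwards [near] with q hq
    have := ident_i hq.1 hq.2.1
    rw [neg_one_mul, neg_one_mul, this]; ring)
  have i2 := i1.unique (((ha.pow (k := 4) (by norm_num)).smul 2).add
    ((hgn.pow (k := 2) (by norm_num)).smul (-4)))
  have j1 := (hgn.smul (-20)).congr
    (g := fun q => (5 * FF q + -15 * FF (q ^ 2)) + (HH q + -1 * HH (q ^ 2))) (by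
    filter_upwards [near] with q hq
    have := ident_ii hq.1 hq.2.1
    rw [neg_one_mul, this]; ring)
  have j2 := j1.unique (((ha.smul 5).add ((ha.pow (k := 2) (by norm_num)).smul (-15))).add
    (hh.add ((hh.pow (k := 2) (by norm_num)).smul (-1)))) m
  have k4 := i2 (4 * m)
  have k2 := i2 (2 * m)
  have e1 : 4 * m / 2 = 2 * m := by omega
  have e4 : 4 * m / 4 = m := by omega
  have e2 : 2 * m / 2 = m := by omega
  have d1 : 2 ∣ 4 * m := by omega
  have d2 : 2 ∣ 2 * m := by omega
  have p4 : (-1 : ℂ) ^ (4 * m) = 1 := by rw [pow_mul]; norm_num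
  have p2 : (-1 : ℂ) ^ (2 * m) = 1 := by rw [pow_mul]; norm_num
  rw [if_pos (dvd_mul_right 4 m), if_pos d1, e1, e4, p4, p2] at k4
  rw [if_pos d2, e2, p2] at k2
  rw [u1 m hm] at j2
  by_cases hev : 2 ∣ m
  · obtain ⟨l, rfl⟩ := hev
    rw [if_pos (by omega), show 2 * (2 * l) / 4 = l by omega] at k2
    rw [if_pos (by omega), if_pos (by omega), show 2 * l / 2 = l by omega,
      u2 l (by omega)] at j2
    linear_combination k4 / 2 - k2 - j2 / 5
  · rw [if_neg (by omega)] at k2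
    rw [if_neg hev, if_neg hev] at j2
    linear_combination k4 / 2 - k2 - j2 / 5

theorem final_nat (c b : ℕ → ℤ)
    (hc : ∀ q : ℂ, ‖q‖ < 1 →
      ∑' n : ℕ, (c n : ℂ) * q ^ n = qpoch (q ^ 5) (q ^ 5) ^ 5 / qpoch q q)
    (hb : ∀ q : ℂ, ‖q‖ < 1 →
      ∑' n : ℕ, (b n : ℂ) * q ^ n = psiNeg (q ^ 5) ^ 5 / psiNeg q) :
    ∀ n : ℕ, b (20 * n + 5) = -c (5 * n + 1) ∧ b (20 * n + 9) = -c (5 * n + 2) := by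
  have psi_ne : ∀ q : ℂ, ‖q‖ < 1 → psiNeg q ≠ 0 := fun q hq =>
    div_ne_zero (mul_ne_zero (ee_ne hq) (ee_ne (npow_lt hq (by norm_num))))
      (ee_ne (npow_lt hq (by norm_num)))
  have rc := (rep_of_tsum hc (fun q hq => div_ne_zero
    (pow_ne_zero _ (ee_ne (npow_lt hq (by norm_num)))) (ee_ne hq))).shift 1
  have rb := (rep_of_tsum hb (fun q hq => div_ne_zero
    (pow_ne_zero _ (psi_ne _ (npow_lt hq (by norm_num)))) (psi_ne q hq))).shift 3
  have ra := rc.congr (g := FF) (.of_forall fun q => by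
    change _ = q * qpoch (q ^ 5) (q ^ 5) ^ 5 / qpoch q q
    rw [pow_one, mul_div_assoc])
  have rg := rb.congr (g := GG) (by
    filter_upwards [near] with q ⟨hq, h0, _⟩
    have n1 := ee_ne hq
    have n2 := ee_ne (npow_lt hq (m := 2) (by norm_num))
    have n4 := ee_ne (npow_lt hq (m := 4) (by norm_num))
    have n5 := ee_ne (npow_lt hq (m := 5) (by norm_num))
    have n10 := ee_ne (npow_lt hq (m := 10) (by norm_num))
    have n20 := ee_ne (npow_lt hq (m := 20) (by norm_num))
    change q ^ 3 * ((ee (q ^ 5) * ee ((q ^ 5) ^ 4) / ee ((q ^ 5) ^ 2)) ^ 5 /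
      (ee q * ee (q ^ 4) / ee (q ^ 2))) = _
    unfold GG FF
    simp only [← pow_mul, Nat.reduceMul]
    field_simp)
  intro n
  have h1 := final_coeff ra rg (5 * n + 2) (by omega)
  have h2 := final_coeff ra rg (5 * n + 3) (by omega)
  rw [if_pos (by omega), if_pos (by omega), show 4 * (5 * n + 2) - 3 = 20 * n + 5 by omega,
    show 5 * n + 2 - 1 = 5 * n + 1 by omega] at h1
  rw [if_pos (by omega), if_pos (by omega), show 4 * (5 * n + 3) - 3 = 20 * n + 9 by omega,
    show 5 * n + 3 - 1 = 5 * n + 2 by omega] at h2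
  exact ⟨by exact_mod_cast h1, by exact_mod_cast h2⟩


theorem stmt_17 (c b : ℕ → ℤ)
    (hc : ∀ q : ℂ, ‖q‖ < 1 →
      ∑' n : ℕ, (c n : ℂ) * q ^ n = qpoch (q ^ 5) (q ^ 5) ^ 5 / qpoch q q)
    (hb : ∀ q : ℂ, ‖q‖ < 1 →
      ∑' n : ℕ, (b n : ℂ) * q ^ n = psiNeg (q ^ 5) ^ 5 / psiNeg q) :
    ∀ n : ℕ, b (20 * n + 5) = -c (5 * n + 1) ∧ b (20 * n + 9) = -c (5 * n + 2) :=
  final_nat c b hc hb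
end

section
/- For every nonnegative integer n, 2·b̅₅(20n+7) = a̅₅(2n+1) + 2·c₅(2n). -/
open scoped BigOperators

open Filter Topology Set

/-! ### Infinite products -/

lemma summable_qterm {q : ℂ} (hq : ‖q‖ < 1) (a : ℂ) : Summable (fun k : ℕ => ‖-(a * q ^ k)‖) := by
  simp only [norm_neg, norm_mul, norm_pow]
  exact (summable_geometric_of_lt_one (norm_nonneg _) hq).mul_left _

lemma multipliable_q {q : ℂ} (hq : ‖q‖ < 1) (a : ℂ) :
    Multipliable (fun k : ℕ => 1 - a * q ^ k) := by
  simpa [sub_eq_add_neg] using multipliable_one_add_of_summable (summable_qterm hq a)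

lemma qpoch_rec {q : ℂ} (hq : ‖q‖ < 1) (a : ℂ) : qpoch a q = (1 - a) * qpoch (q * a) q := by
  have h2 : (fun k : ℕ => 1 - q * a * q ^ k) = fun k => 1 - a * q ^ (k + 1) := by
    funext k; ring
  have h1 := multipliable_q hq (q * a)
  rw [h2] at h1
  have h3 := tprod_eq_zero_mul' (f := fun k : ℕ => 1 - a * q ^ k) h1
  have h4 : qpoch (q * a) q = ∏' k : ℕ, (1 - a * q ^ (k + 1)) := by
    unfold qpoch; rw [h2]
  rw [h4]
  unfold qpoch
  rw [h3, pow_zero, mul_one]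

lemma qpoch_ne_zero {q : ℂ} (hq : ‖q‖ < 1) {a : ℂ} (h : ∀ k : ℕ, a * q ^ k ≠ 1) :
    qpoch a q ≠ 0 := by
  have := tprod_one_add_ne_zero_of_summable (f := fun k : ℕ => -(a * q ^ k))
    (fun k => by rw [← sub_eq_add_neg]; exact sub_ne_zero.2 (h k).symm) (summable_qterm hq a)
  simpa [qpoch, sub_eq_add_neg] using this

lemma qpoch_ne_zero' {q : ℂ} (hq : ‖q‖ < 1) {a : ℂ} (h : ‖a‖ < 1) : qpoch a q ≠ 0 := by
  refine qpoch_ne_zero hq fun k hk => ?_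
  have : ‖a * q ^ k‖ < 1 := by
    rw [norm_mul, norm_pow]
    have : ‖q‖ ^ k ≤ 1 := pow_le_one₀ (norm_nonneg _) hq.le
    nlinarith [norm_nonneg a]
  rw [hk] at this; simp at this

lemma qpoch_diff {q : ℂ} (hq : ‖q‖ < 1) : Differentiable ℂ (fun a => qpoch a q) := by
  intro a
  have hU : IsOpen (Metric.ball (0 : ℂ) (‖a‖ + 1)) := Metric.isOpen_ball
  have h := Summable.hasProdLocallyUniformlyOn_nat_one_add (K := Metric.ball (0 : ℂ) (‖a‖ + 1))
    (f := fun (k : ℕ) (x : ℂ) => -(x * q ^ k)) hU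
    ((summable_geometric_of_lt_one (norm_nonneg q) hq).mul_left (‖a‖ + 1))
    (Eventually.of_forall fun n x hx => by
      simp only [norm_neg, norm_mul, norm_pow]
      have : ‖x‖ < ‖a‖ + 1 := by simpa using hx
      gcongr) (fun n => by fun_prop)
  have h2 := h.differentiableOn (.of_forall fun _ ↦ by
      simpa [Finset.prod_fn] using DifferentiableOn.finsetProd (fun _ _ ↦ by fun_prop)) hU
  have h3 := h2.differentiableAt (hU.mem_nhds (by simp : a ∈ _))
  simpa [qpoch, sub_eq_add_neg] using h3

/-! ### Theta function -/

noncomputable def th (q z : ℂ) : ℂ := qpoch z q * qpoch (q / z) q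

noncomputable def th1 (q z : ℂ) : ℂ := qpoch (q * z) q * qpoch (q / z) q

lemma th_eq {q : ℂ} (hq : ‖q‖ < 1) (z : ℂ) : th q z = (1 - z) * th1 q z := by
  unfold th th1; rw [qpoch_rec hq z]; ring

lemma th_inv {q : ℂ} (hq : ‖q‖ < 1) {z : ℂ} (hz : z ≠ 0) : th q z⁻¹ = - th q z / z := by
  rw [th_eq hq, th_eq hq]; unfold th1
  rw [show q / z⁻¹ = q * z by field_simp, show q * z⁻¹ = q / z by field_simp]
  field_simp; ring

lemma th_q_div {q : ℂ} (hq0 : q ≠ 0) {z : ℂ} : th q (q / z) = th q z := by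
  unfold th
  rw [show q / (q / z) = z by field_simp]; ring

lemma th_q_mul {q : ℂ} (hq : ‖q‖ < 1) (hq0 : q ≠ 0) {z : ℂ} (hz : z ≠ 0) :
    th q (q * z) = - th q z / z := by
  rw [← th_inv hq hz, ← th_q_div hq0, show q / (q * z) = z⁻¹ by field_simp]

lemma th1_inv {q z : ℂ} : th1 q z⁻¹ = th1 q z := by
  unfold th1
  rw [show q / z⁻¹ = q * z by field_simp, show q * z⁻¹ = q / z by field_simp]; ring

lemma th_diff {q : ℂ} (hq : ‖q‖ < 1) {z : ℂ} (hz : z ≠ 0) : DifferentiableAt ℂ (th q) z := by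
  unfold th
  exact ((qpoch_diff hq) z).mul
    (((qpoch_diff hq) (q / z)).comp z (f := fun z => q / z) (by fun_prop (disch := assumption)))

lemma th1_diff {q : ℂ} (hq : ‖q‖ < 1) {z : ℂ} (hz : z ≠ 0) : DifferentiableAt ℂ (th1 q) z := by
  unfold th1
  exact (((qpoch_diff hq) (q * z)).comp z (f := fun z => q * z) (by fun_prop)).mul
    (((qpoch_diff hq) (q / z)).comp z (f := fun z => q / z) (by fun_prop (disch := assumption)))

/-- the open annulus -/
def Ann (q : ℂ) : Set ℂ := {z | ‖q‖ < ‖z‖ ∧ ‖q‖ * ‖z‖ < 1}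

lemma Ann_open (q : ℂ) : IsOpen (Ann q) :=
  (isOpen_lt continuous_const continuous_norm).inter
    (isOpen_lt (continuous_const.mul continuous_norm) continuous_const)

lemma Ann_ne {q z : ℂ} (hz : z ∈ Ann q) : z ≠ 0 := by
  rintro rfl
  have := hz.1
  simp at this
  exact absurd this (not_lt.2 (norm_nonneg q))

lemma th1_ne {q z : ℂ} (hq : ‖q‖ < 1) (hz : z ∈ Ann q) : th1 q z ≠ 0 := by
  have h0 : 0 < ‖z‖ := norm_pos_iff.2 (Ann_ne hz)
  refine mul_ne_zero (qpoch_ne_zero' hq ?_) (qpoch_ne_zero' hq ?_)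
  · rw [norm_mul]; exact hz.2
  · rw [norm_div, div_lt_one h0]; exact hz.1

/-! ### The one-sided Lambert series and the elliptic function -/

noncomputable def lam (x : ℂ) : ℂ := x / (1 - x) ^ 2

noncomputable def Qs (q z : ℂ) : ℂ := ∑' k : ℕ, lam (z * q ^ k)

noncomputable def Ps (q z : ℂ) : ℂ := Qs q z + Qs q (q / z)

lemma lam_bound {x : ℂ} {r : ℝ} (hr : r < 1) (hx : ‖x‖ ≤ r) :
    ‖lam x‖ ≤ ‖x‖ / (1 - r) ^ 2 := by
  unfold lam
  rw [norm_div, norm_pow]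
  have h1 : 1 - r ≤ ‖1 - x‖ := by
    have := norm_sub_norm_le (1 : ℂ) x
    simp at this; linarith
  have : 0 < 1 - r := by linarith
  gcongr

lemma lam_summable {q : ℂ} (hq : ‖q‖ < 1) (z : ℂ) : Summable (fun k : ℕ => lam (z * q ^ k)) := by
  have ht : Tendsto (fun k : ℕ => z * q ^ k) atTop (𝓝 0) := by
    simpa using (tendsto_pow_atTop_nhds_zero_of_norm_lt_one hq).const_mul z
  have ht' := ht.norm
  rw [norm_zero] at ht'
  refine Summable.of_norm_bounded_eventually_nat
    (g := fun k => ‖z‖ * ‖q‖ ^ k / (1 - 1/2) ^ 2) ?_ ?_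
  · exact ((summable_geometric_of_lt_one (norm_nonneg q) hq).mul_left _).div_const _
  · filter_upwards [ht'.eventually (ge_mem_nhds (show (0:ℝ) < 1/2 by norm_num))] with k hk
    have := lam_bound (by norm_num) hk
    simpa using this

lemma Qs_rec {q : ℂ} (hq : ‖q‖ < 1) (z : ℂ) : Qs q z = lam z + Qs q (q * z) := by
  unfold Qs
  rw [(lam_summable hq z).tsum_eq_zero_add]
  congr 1
  · simp
  · congr 1; funext k; congr 1; ring

lemma lam_inv {z : ℂ} (hz : z ≠ 0) : lam z⁻¹ = lam z := by
  unfold lam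
  by_cases h : z = 1
  · simp [h]
  have h1 : 1 - z ≠ 0 := sub_ne_zero.2 (Ne.symm h)
  have h2 : (1 - z⁻¹) ^ 2 = (1 - z) ^ 2 / z ^ 2 := by field_simp; ring
  rw [h2]; field_simp

lemma Ps_q_mul {q : ℂ} (hq : ‖q‖ < 1) (hq0 : q ≠ 0) {z : ℂ} (hz : z ≠ 0) :
    Ps q (q * z) = Ps q z := by
  unfold Ps
  rw [show q / (q * z) = z⁻¹ by field_simp, Qs_rec hq z, Qs_rec hq z⁻¹, lam_inv hz,
    show q * z⁻¹ = q / z by field_simp]; ring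

lemma Qs_diff {q z : ℂ} (hq : ‖q‖ < 1) (hz : ‖z‖ < 1) : DifferentiableAt ℂ (Qs q) z := by
  obtain ⟨r, h1, h2⟩ := exists_between hz
  have hb : ∀ (k : ℕ) (w : ℂ), w ∈ Metric.ball (0 : ℂ) r → ‖w * q ^ k‖ ≤ r * ‖q‖ ^ k ∧
      ‖w * q ^ k‖ ≤ r := by
    intro k w hw
    have hw : ‖w‖ < r := by simpa using hw
    rw [norm_mul, norm_pow]
    have : ‖q‖ ^ k ≤ 1 := pow_le_one₀ (norm_nonneg _) hq.le
    have h3 : ‖w‖ * ‖q‖ ^ k ≤ r * ‖q‖ ^ k := by gcongr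
    have hr : 0 < r := (norm_nonneg _).trans_lt hw
    exact ⟨h3, by nlinarith⟩
  have := Complex.differentiableOn_tsum_of_summable_norm (U := Metric.ball (0 : ℂ) r)
    (F := fun k w => lam (w * q ^ k)) (u := fun k => r * ‖q‖ ^ k / (1 - r) ^ 2)
    (((summable_geometric_of_lt_one (norm_nonneg q) hq).mul_left _).div_const _)
    (fun k w hw => by
      have h := (hb k w hw).2
      have hne : (1 - w * q ^ k) ^ 2 ≠ 0 := by
        refine pow_ne_zero _ (sub_ne_zero.2 fun h' => ?_)
        rw [← h'] at h; simp at h; linarith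
      unfold lam
      exact (DifferentiableAt.fun_div (𝕜 := ℂ) (c := fun w : ℂ => w * q ^ k)
        (d := fun w : ℂ => (1 - w * q ^ k) ^ 2) (by fun_prop) (by fun_prop) hne).differentiableWithinAt)
    Metric.isOpen_ball
    (fun k w hw => (lam_bound h2 (hb k w hw).2).trans (by gcongr; exact (hb k w hw).1))
  exact this.differentiableAt (Metric.isOpen_ball.mem_nhds (by simpa using h1))

/-- The fundamental formula `℘(z) - ℘(b) = σ(z+b)σ(z-b)/...` in multiplicative form. -/
theorem wp_diff {q z b : ℂ} (hq : ‖q‖ < 1) (hq0 : q ≠ 0) (hz : z ∈ Ann q) (hb : b ∈ Ann q)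
    (hb1 : b ≠ 1) (hz1 : z ≠ 1) :
    Ps q z - Ps q b = - b * qpoch q q ^ 4 * th q (z * b) * th q (z / b) /
      (th q z ^ 2 * th q b ^ 2) := by
  have hqp : 0 < ‖q‖ := norm_pos_iff.2 hq0
  have hb0 := Ann_ne hb
  have hthb : th q b ≠ 0 := by
    rw [th_eq hq]; exact mul_ne_zero (sub_ne_zero.2 hb1.symm) (th1_ne hq hb)
  set κ : ℂ := - b * qpoch q q ^ 4 / th q b ^ 2 with hκ
  have h1A : (1 : ℂ) ∈ Ann q := by simp [Ann, hq]
  set M : ℂ → ℂ := fun z => z - κ * (th q (z * b) * th q (z / b)) / th1 q z ^ 2 with hM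
  have hth11 : th1 q 1 = qpoch q q ^ 2 := by simp [th1, sq]
  have hE : qpoch q q ≠ 0 := qpoch_ne_zero' hq hq
  have hM1 : M 1 = 0 := by
    simp only [hM, hth11, one_mul, one_div, th_inv hq hb0, hκ]
    field_simp; ring
  have hMd : DifferentiableOn ℂ M (Ann q) := by
    intro x hx
    have hx0 := Ann_ne hx
    have e1 : DifferentiableAt ℂ (fun z => th q (z * b)) x :=
      (th_diff hq (mul_ne_zero hx0 hb0)).comp x (f := fun z => z * b) (by fun_prop)
    have e2 : DifferentiableAt ℂ (fun z => th q (z / b)) x :=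
      (th_diff hq (div_ne_zero hx0 hb0)).comp x (f := fun z => z / b) (by fun_prop)
    have e3 := th1_diff hq hx0
    exact (differentiableAt_id.sub (((e1.mul e2).const_mul κ).div (e3.pow 2)
      (pow_ne_zero _ (th1_ne hq hx)))).differentiableWithinAt
  have hMinv : ∀ z, z ≠ 0 → M z⁻¹ * z ^ 2 = M z := by
    intro z hz
    simp only [hM, th1_inv]
    rw [show z⁻¹ * b = (z / b)⁻¹ by field_simp, show z⁻¹ / b = (z * b)⁻¹ by field_simp,
      th_inv hq (div_ne_zero hz hb0), th_inv hq (mul_ne_zero hz hb0)]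
    field_simp
  have hM' : deriv M 1 = 0 := by
    have h1 : HasDerivAt M (deriv M 1) 1 :=
      (hMd.differentiableAt ((Ann_open q).mem_nhds h1A)).hasDerivAt
    have h1' : HasDerivAt M (deriv M 1) (1 : ℂ)⁻¹ := by simpa using h1
    have h2 : HasDerivAt (fun z : ℂ => M z⁻¹ * z ^ 2) (-deriv M 1) 1 := by
      have := (h1'.comp (1 : ℂ) (hasDerivAt_inv one_ne_zero)).mul (hasDerivAt_pow 2 (1 : ℂ))
      refine HasDerivAt.congr_deriv this ?_
      simp [hM1]
    have h3 : HasDerivAt M (-deriv M 1) 1 := by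
      refine h2.congr_of_eventuallyEq ?_
      filter_upwards [isOpen_ne.mem_nhds (one_ne_zero : (1 : ℂ) ≠ 0)] with z hz
      exact (hMinv z hz).symm
    have := h1.unique h3
    linear_combination this / 2
  set H : ℂ → ℂ := fun z => Qs q (q * z) + Qs q (q / z) - Ps q b +
    dslope (dslope M 1) 1 z with hH
  have hH1 : ∀ z, z ≠ 1 → H z = Ps q z - Ps q b - κ * (th q (z * b) * th q (z / b)) / th q z ^ 2 := by
    intro z hz
    have hz' : z - 1 ≠ 0 := sub_ne_zero.2 hz
    have hz'' : 1 - z ≠ 0 := sub_ne_zero.2 hz.symm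
    simp only [hH]
    rw [dslope_of_ne _ hz, slope_def_field, dslope_same, hM', dslope_of_ne _ hz, slope_def_field,
      hM1, th_eq hq z]
    unfold Ps
    rw [Qs_rec hq z]
    simp only [hM, lam]
    have e : (1 - z) ^ 2 = (z - 1) ^ 2 := by ring
    rw [mul_pow, e]
    field_simp
    ring
  have hHd : DifferentiableOn ℂ H (Ann q) := by
    have hn := (Ann_open q).mem_nhds h1A
    refine DifferentiableOn.add (DifferentiableOn.sub (DifferentiableOn.add ?_ ?_)
      (differentiableOn_const _)) ?_
    · intro x hx
      exact ((Qs_diff hq (by rw [norm_mul]; exact hx.2)).comp x (f := fun z => q * z)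
        (by fun_prop)).differentiableWithinAt
    · intro x hx
      have hx0 := Ann_ne hx
      exact ((Qs_diff hq (by rw [norm_div, div_lt_one (norm_pos_iff.2 hx0)]; exact hx.1)).comp x
        (f := fun z => q / z) (by fun_prop (disch := assumption))).differentiableWithinAt
    · exact (Complex.differentiableOn_dslope hn).2 ((Complex.differentiableOn_dslope hn).2 hMd)
  have hper : ∀ z, ‖z‖ < 1 / ‖q‖ → 1 < ‖z‖ → H (q * z) = H z := by
    intro z h1 h2
    rw [lt_div_iff₀ hqp] at h1
    have hz0 : z ≠ 0 := by rintro rfl; simp at h2; linarith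
    have n1 : z ≠ 1 := by rintro rfl; simp at h2
    have n2 : q * z ≠ 1 := by
      intro h
      have := congrArg norm h
      rw [norm_mul, norm_one] at this; linarith
    rw [hH1 _ n1, hH1 _ n2, Ps_q_mul hq hq0 hz0, mul_assoc q z b, mul_div_assoc q z b,
      th_q_mul hq hq0 hz0, th_q_mul hq hq0 (mul_ne_zero hz0 hb0),
      th_q_mul hq hq0 (div_ne_zero hz0 hb0)]
    congr 1
    by_cases ht : th q z = 0
    · simp [ht]
    field_simp
  set r : ℝ := Real.sqrt ‖q‖ with hr
  have hr0 : 0 < r := Real.sqrt_pos.2 hqp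
  have hr2 : r * r = ‖q‖ := Real.mul_self_sqrt hqp.le
  have hr1 : r < 1 := by nlinarith
  have hqr : ‖q‖ < r := by nlinarith
  let K : Set ℂ := {z | r ≤ ‖z‖ ∧ r * ‖z‖ ≤ 1}
  have hKA : K ⊆ Ann q := by
    intro x hx
    refine ⟨hqr.trans_le hx.1, ?_⟩
    rcases hx with ⟨h1, h2⟩
    have : 0 < ‖x‖ := hr0.trans_le h1
    calc ‖q‖ * ‖x‖ < r * ‖x‖ := by gcongr
      _ ≤ 1 := h2
  have hKc : IsCompact K := by
    refine Metric.isCompact_of_isClosed_isBounded ?_ ?_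
    · exact (isClosed_le continuous_const continuous_norm).inter
        (isClosed_le (continuous_const.mul continuous_norm) continuous_const)
    · refine (Metric.isBounded_closedBall (x := (0 : ℂ)) (r := 1 / r)).subset fun x hx => ?_
      simp only [Metric.mem_closedBall, dist_zero_right]
      rw [le_div_iff₀ hr0, mul_comm]; exact hx.2
  have hKn : K.Nonempty := ⟨1, by simp [K, hr1.le]⟩
  obtain ⟨z0, hz0K, hz0⟩ := hKc.exists_isMaxOn hKn (hHd.continuousOn.mono hKA).norm
  have hmax : ∀ z ∈ Ann q, ‖H z‖ ≤ ‖H z0‖ := by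
    intro z hz
    have hzp : 0 < ‖z‖ := norm_pos_iff.2 (Ann_ne hz)
    by_cases c1 : ‖z‖ < r
    · have hzq : q * (z / q) = z := by field_simp
      have nz : ‖z / q‖ = ‖z‖ / ‖q‖ := norm_div _ _
      have a1 : 1 < ‖z / q‖ := by rw [nz, lt_div_iff₀ hqp]; linarith [hz.1]
      have a2 : r * ‖z / q‖ ≤ 1 := by
        rw [nz, ← mul_div_assoc, div_le_one hqp, ← hr2]; gcongr
      have a3 : ‖z / q‖ < 1 / ‖q‖ := by
        rw [nz]; gcongr; linarith
      rw [← hzq, hper _ a3 a1]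
      exact hz0 (show z / q ∈ K from ⟨by linarith, a2⟩)
    by_cases c2 : 1 < r * ‖z‖
    · have a1 : 1 < ‖z‖ := by nlinarith
      rw [← hper z (by rw [lt_div_iff₀ hqp, mul_comm]; exact hz.2) a1]
      refine hz0 (show q * z ∈ K from ⟨?_, ?_⟩)
      · rw [norm_mul, ← hr2]; nlinarith
      · rw [norm_mul]; nlinarith [hz.2]
    · exact hz0 (show z ∈ K from ⟨not_lt.1 c1, not_lt.1 c2⟩)
  have hconst : ∀ z ∈ Ann q, H z = H z0 := by
    let S : Set ℂ := {w | Real.log ‖q‖ < w.re ∧ w.re < - Real.log ‖q‖}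
    have hSA : ∀ w, w ∈ S ↔ Complex.exp w ∈ Ann q := by
      intro w
      simp only [S, Ann, mem_ofPred_eq, Complex.norm_exp]
      rw [Real.log_lt_iff_lt_exp hqp]
      refine and_congr_right fun _ => ?_
      rw [lt_neg, ← sub_pos, ← Real.exp_lt_exp (x := _), ← Real.exp_log hqp, ← Real.exp_add,
        Real.exp_log hqp, Real.exp_lt_one_iff, Real.exp_lt_exp]
      constructor <;> intro <;> linarith
    have hSo : IsOpen S := (isOpen_lt continuous_const Complex.continuous_re).inter
      (isOpen_lt Complex.continuous_re continuous_const)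
    have hSc : IsPreconnected S := by
      have : Convex ℝ S := (convex_halfSpace_re_gt _).inter (convex_halfSpace_re_lt _)
      exact this.isPreconnected
    have hz00 := Ann_ne (hKA hz0K)
    have hd : DifferentiableOn ℂ (fun w => H (Complex.exp w)) S :=
      hHd.comp Complex.differentiable_exp.differentiableOn (fun w hw => (hSA w).1 hw)
    have hw0 : Complex.log z0 ∈ S := (hSA _).2 (by rw [Complex.exp_log hz00]; exact hKA hz0K)
    have := Complex.eqOn_of_isPreconnected_of_isMaxOn_norm hSc hSo hd hw0
      (fun w hw => by
        simp only [Function.comp, mem_ofPred_eq, Complex.exp_log hz00]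
        exact hmax _ ((hSA w).1 hw))
    intro z hz
    have h := this ((hSA (Complex.log z)).2 (by rw [Complex.exp_log (Ann_ne hz)]; exact hz))
    simpa [Complex.exp_log (Ann_ne hz), Complex.exp_log hz00] using h
  have hHb : H b = 0 := by
    rw [hH1 b hb1, div_self hb0, th_eq hq 1]; simp
  have hHz : H z = 0 := by rw [hconst z hz, ← hconst b hb, hHb]
  rw [hH1 z hz1] at hHz
  have : Ps q z - Ps q b = κ * (th q (z * b) * th q (z / b)) / th q z ^ 2 := by
    linear_combination hHz
  rw [this, hκ]
  by_cases ht : th q z = 0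
  · simp [ht]
  field_simp

/-! ### The character and Lambert series -/

/-- the quadratic character mod 5 -/
def chi (n : ℕ) : ℤ :=
  if n % 5 = 1 ∨ n % 5 = 4 then 1 else if n % 5 = 2 ∨ n % 5 = 3 then -1 else 0

lemma chi_mul (m n : ℕ) : chi (m * n) = chi m * chi n := by
  unfold chi
  rw [Nat.mul_mod]
  have h1 : m % 5 < 5 := Nat.mod_lt _ (by norm_num)
  have h2 : n % 5 < 5 := Nat.mod_lt _ (by norm_num)
  generalize m % 5 = a at *
  generalize n % 5 = b at *
  interval_cases a <;> interval_cases b <;> rfl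

lemma chi_add (j k : ℕ) : chi (j + 5 * k) = chi j := by
  unfold chi; rw [Nat.add_mul_mod_self_left]

lemma chi_norm (n : ℕ) : ‖(chi n : ℂ)‖ ≤ 1 := by
  unfold chi; split_ifs <;> simp

def sC (n : ℕ) : ℤ := ∑ x ∈ n.divisorsAntidiagonal, chi x.1 * (x.2 : ℤ)

def sD (n : ℕ) : ℤ := ∑ x ∈ n.divisorsAntidiagonal, chi x.2 * (x.2 : ℤ)

def chiA : ArithmeticFunction ℤ := ⟨chi, rfl⟩
def idA : ArithmeticFunction ℤ := ⟨fun n => (n : ℤ), rfl⟩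
def chiIdA : ArithmeticFunction ℤ := ⟨fun n => chi n * (n : ℤ), rfl⟩
def oneA : ArithmeticFunction ℤ := ⟨fun n => if n = 0 then 0 else 1, rfl⟩

lemma sC_mul {m n : ℕ} (h : m.Coprime n) : sC (m * n) = sC m * sC n := by
  have h1 : chiA.IsMultiplicative := ⟨rfl, fun {m n} _ => chi_mul m n⟩
  have h2 : idA.IsMultiplicative := ⟨rfl, fun {m n} _ => Nat.cast_mul m n⟩
  have h3 := (h1.mul h2).map_mul_of_coprime h
  have h4 : ∀ k, (chiA * idA) k = sC k := fun k => ArithmeticFunction.mul_apply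
  simpa only [h4] using h3

lemma sD_mul {m n : ℕ} (h : m.Coprime n) : sD (m * n) = sD m * sD n := by
  have h1 : oneA.IsMultiplicative := ⟨rfl, fun {m n} _ => by
    show (if m * n = 0 then (0 : ℤ) else 1) = (if m = 0 then 0 else 1) * (if n = 0 then 0 else 1)
    simp only [mul_eq_zero]; split_ifs <;> simp_all⟩
  have h2 : chiIdA.IsMultiplicative := ⟨rfl, fun {m n} _ => by
    show chi (m * n) * ((m * n : ℕ) : ℤ) = (chi m * m) * (chi n * n)
    rw [chi_mul]; push_cast; ring⟩
  have h3 := (h1.mul h2).map_mul_of_coprime h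
  have h4 : ∀ k, (oneA * chiIdA) k = sD k := by
    intro k
    rw [ArithmeticFunction.mul_apply]
    refine Finset.sum_congr rfl fun x hx => ?_
    have : x.1 ≠ 0 := by
      have := Nat.mem_divisorsAntidiagonal.1 hx
      rintro h0; rw [h0] at this; simp at this; omega
    show (if x.1 = 0 then (0 : ℤ) else 1) * (chi x.2 * (x.2 : ℤ)) = _
    rw [if_neg this, one_mul]
  simpa only [h4] using h3

lemma chi_eq_zero {d : ℕ} (h : 5 ∣ d) : chi d = 0 := by
  obtain ⟨k, rfl⟩ := h
  rw [chi_mul]; simp [chi]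

lemma dvd_of_chi {d n : ℕ} (h : d ∣ 5 * n) (h5 : chi d ≠ 0) : d ∣ n := by
  have : ¬ 5 ∣ d := fun h' => h5 (chi_eq_zero h')
  have hc : Nat.Coprime d 5 := ((Nat.Prime.coprime_iff_not_dvd (by norm_num)).2 this).symm
  exact hc.dvd_of_dvd_mul_left h

lemma sC_five (n : ℕ) : sC (5 * n) = 5 * sC n := by
  rcases Nat.eq_zero_or_pos n with rfl | hn
  · simp [sC]
  unfold sC
  rw [Nat.sum_divisorsAntidiagonal (f := fun a b => chi a * (b : ℤ)),
    Nat.sum_divisorsAntidiagonal (f := fun a b => chi a * (b : ℤ)), Finset.mul_sum]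
  symm
  have hsub : n.divisors ⊆ (5 * n).divisors :=
    Nat.divisors_subset_of_dvd (by omega) (Dvd.intro_left _ rfl)
  rw [← Finset.sum_subset hsub]
  · refine Finset.sum_congr rfl fun d hd => ?_
    rw [Nat.mul_div_assoc _ (Nat.dvd_of_mem_divisors hd)]; push_cast; ring
  · intro d hd hd'
    by_contra h
    have h5 : chi d ≠ 0 := fun h' => h (by rw [h', zero_mul])
    exact hd' (Nat.mem_divisors.2 ⟨dvd_of_chi (Nat.dvd_of_mem_divisors hd) h5, by omega⟩)

lemma sD_five (n : ℕ) : sD (5 * n) = sD n := by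
  rcases Nat.eq_zero_or_pos n with rfl | hn
  · simp
  unfold sD
  rw [Nat.sum_divisorsAntidiagonal' (f := fun a b => chi b * (b : ℤ)),
    Nat.sum_divisorsAntidiagonal' (f := fun a b => chi b * (b : ℤ))]
  symm
  have hsub : n.divisors ⊆ (5 * n).divisors :=
    Nat.divisors_subset_of_dvd (by omega) (Dvd.intro_left _ rfl)
  refine Finset.sum_subset hsub ?_
  intro d hd hd'
  by_contra h
  have h5 : chi d ≠ 0 := fun h' => h (by rw [h', zero_mul])
  exact hd' (Nat.mem_divisors.2 ⟨dvd_of_chi (Nat.dvd_of_mem_divisors hd) h5, by omega⟩)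

lemma sC_two_odd (n : ℕ) : sC (2 * (2 * n + 1)) = sC (2 * n + 1) := by
  rw [sC_mul (by simp), show sC 2 = 1 by decide, one_mul]

lemma sD_two_odd (n : ℕ) : sD (2 * (2 * n + 1)) = - sD (2 * n + 1) := by
  rw [sD_mul (by simp), show sD 2 = -1 by decide]; ring

/-! ### Lambert series to power series -/

lemma lambert_summable {q : ℂ} (hq : ‖q‖ < 1) {w : ℕ → ℕ → ℂ} (hw : ∀ a b, ‖w a b‖ ≤ b) :
    Summable (fun c : ℕ+ × ℕ+ => w c.1 c.2 * q ^ (c.1 * c.2 : ℕ)) := by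
  have h := (summable_prod_mul_pow 1 hq).norm
  refine Summable.of_norm_bounded h fun c => ?_
  rw [norm_mul, norm_mul]
  gcongr
  simpa using hw c.1 c.2

lemma lambert_hasSum {q : ℂ} (hq : ‖q‖ < 1) {w : ℕ → ℕ → ℂ} (hw : ∀ a b, ‖w a b‖ ≤ b) :
    HasSum (fun n : ℕ => (∑ x ∈ n.divisorsAntidiagonal, w x.1 x.2) * q ^ n)
      (∑' a : ℕ+, ∑' b : ℕ+, w a b * q ^ (a * b : ℕ)) := by
  have h := lambert_summable hq hw
  rw [← h.tsum_prod]
  have h1 := (sigmaAntidiagonalEquivProd.hasSum_iff).2 h.hasSum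
  have h2 := h1.sigma (g := fun n : ℕ+ =>
    (∑ x ∈ (n : ℕ).divisorsAntidiagonal, w x.1 x.2) * q ^ (n : ℕ)) (fun n => by
      rw [Finset.sum_mul, ← Finset.sum_attach]
      convert! hasSum_fintype _ using 1
      rw [← Finset.attach_eq_univ]
      refine Finset.sum_congr rfl fun x _ => ?_
      have := (Nat.mem_divisorsAntidiagonal.1 x.2).1
      simp only [sigmaAntidiagonalEquivProd, divisorsAntidiagonalFactors, Function.comp,
        Equiv.coe_fn_mk, PNat.mk_coe]
      rw [this])
  rw [← Function.Injective.hasSum_iff PNat.coe_injective (f := fun n : ℕ =>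
    (∑ x ∈ n.divisorsAntidiagonal, w x.1 x.2) * q ^ n)]
  · exact h2
  · intro n hn
    have : n = 0 := by
      by_contra h0
      exact hn ⟨⟨n, Nat.pos_of_ne_zero h0⟩, rfl⟩
    simp [this]

noncomputable def LC (q : ℂ) : ℂ := ∑' n : ℕ, (chi n : ℂ) * lam (q ^ n)

noncomputable def LD (q : ℂ) : ℂ := ∑' k : ℕ, ∑' m : ℕ, (chi m : ℂ) * m * (q ^ (k + 1)) ^ m

lemma tsum_pnat_of_zero {f : ℕ → ℂ} (h0 : f 0 = 0) : ∑' n : ℕ+, f n = ∑' n : ℕ, f n :=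
  PNat.coe_injective.tsum_eq (by
    intro n hn
    have : n ≠ 0 := by rintro rfl; exact hn h0
    exact ⟨⟨n, Nat.pos_of_ne_zero this⟩, rfl⟩)

lemma lam_tsum {x : ℂ} (hx : ‖x‖ < 1) : HasSum (fun n : ℕ => (n : ℂ) * x ^ n) (lam x) :=
  hasSum_coe_mul_geometric_of_norm_lt_one hx

lemma LC_hasSum {q : ℂ} (hq : ‖q‖ < 1) : HasSum (fun n : ℕ => (sC n : ℂ) * q ^ n) (LC q) := by
  have h := lambert_hasSum hq (w := fun a b => (chi a : ℂ) * b) (fun a b => by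
    rw [norm_mul]
    have := chi_norm a
    simp only [Complex.norm_natCast]
    exact mul_le_of_le_one_left (Nat.cast_nonneg b) this)
  convert h using 1
  · funext n; simp [sC]
  · unfold LC
    rw [← tsum_pnat_of_zero (by simp [chi])]
    refine tsum_congr fun a => ?_
    have hqa : ‖q ^ (a : ℕ)‖ < 1 := by
      rw [norm_pow]; exact pow_lt_one₀ (norm_nonneg _) hq a.ne_zero
    rw [← (lam_tsum hqa).tsum_eq, ← tsum_mul_left, ← tsum_pnat_of_zero (by simp)]
    refine tsum_congr fun b => ?_
    rw [pow_mul]; ring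

lemma LD_hasSum {q : ℂ} (hq : ‖q‖ < 1) : HasSum (fun n : ℕ => (sD n : ℂ) * q ^ n) (LD q) := by
  have h := lambert_hasSum hq (w := fun a b => (chi b : ℂ) * b) (fun a b => by
    rw [norm_mul]
    have := chi_norm b
    simp only [Complex.norm_natCast]
    exact mul_le_of_le_one_left (Nat.cast_nonneg b) this)
  convert h using 1
  · funext n; simp [sD]
  · unfold LD
    rw [← tsum_pnat_eq_tsum_succ (f := fun k => ∑' m : ℕ, (chi m : ℂ) * m * (q ^ k) ^ m)]
    refine tsum_congr fun a => ?_
    rw [← tsum_pnat_of_zero (by simp)]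
    refine tsum_congr fun b => ?_
    rw [pow_mul]

lemma LC_summable {q : ℂ} (hq : ‖q‖ < 1) (x : ℂ) :
    Summable (fun n : ℕ => (chi n : ℂ) * lam (x * q ^ n)) := by
  refine Summable.of_norm_bounded (lam_summable hq x).norm fun n => ?_
  rw [norm_mul]
  exact mul_le_of_le_one_left (norm_nonneg _) (chi_norm n)

lemma LC_split {q : ℂ} (hq : ‖q‖ < 1) (hq0 : q ≠ 0) (x : ℂ) (hx : x⁻¹ = x) :
    ∑' n : ℕ, (chi n : ℂ) * lam (x * q ^ n) = Ps (q ^ 5) (x * q) - Ps (q ^ 5) (x * q ^ 2) := by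
  rw [Nat.sumByResidueClasses (LC_summable hq x) 5]
  have key : ∀ r : ℕ, ∑' m : ℕ, (chi (r + 5 * m) : ℂ) * lam (x * q ^ (r + 5 * m)) =
      chi r * Qs (q ^ 5) (x * q ^ r) := by
    intro r
    unfold Qs
    rw [← tsum_mul_left]
    refine tsum_congr fun m => ?_
    rw [chi_add, pow_add, pow_mul, mul_assoc]
  have hs : ∀ F : ZMod 5 → ℂ, ∑ j : ZMod 5, F j = F 0 + F 1 + F 2 + F 3 + F 4 :=
    fun F => Fin.sum_univ_five F
  rw [hs]
  have v0 : (0 : ZMod 5).val = 0 := rfl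
  have v1 : (1 : ZMod 5).val = 1 := rfl
  have v2 : (2 : ZMod 5).val = 2 := rfl
  have v3 : (3 : ZMod 5).val = 3 := rfl
  have v4 : (4 : ZMod 5).val = 4 := rfl
  rw [v0, v1, v2, v3, v4, key, key, key, key, key]
  have c0 : chi 0 = 0 := rfl
  have c1 : chi 1 = 1 := rfl
  have c2 : chi 2 = -1 := rfl
  have c3 : chi 3 = -1 := rfl
  have c4 : chi 4 = 1 := rfl
  rw [c0, c1, c2, c3, c4]
  unfold Ps
  have e1 : q ^ 5 / (x * q) = x * q ^ 4 := by
    rw [div_mul_eq_div_div, div_eq_mul_inv (q ^ 5) x, hx]; field_simp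
  have e2 : q ^ 5 / (x * q ^ 2) = x * q ^ 3 := by
    rw [div_mul_eq_div_div, div_eq_mul_inv (q ^ 5) x, hx]; field_simp
  rw [e1, e2]
  push_cast
  ring

lemma LC_L1 {q : ℂ} (hq : ‖q‖ < 1) (hq0 : q ≠ 0) :
    LC q = Ps (q ^ 5) q - Ps (q ^ 5) (q ^ 2) := by
  have := LC_split hq hq0 1 (by simp)
  simpa [LC] using this

lemma pow_ne_one_of_norm {q : ℂ} (hq : ‖q‖ < 1) {n : ℕ} (hn : n ≠ 0) : ‖q ^ n‖ < 1 := by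
  rw [norm_pow]; exact pow_lt_one₀ (norm_nonneg _) hq hn

lemma lam_neg {x : ℂ} (hx : ‖x‖ < 1) : lam (-x) = 4 * lam (x ^ 2) - lam x := by
  have h1 : 1 - x ≠ 0 := sub_ne_zero.2 (by rintro rfl; simp at hx)
  have h2 : 1 + x ≠ 0 := by
    intro h
    have : x = -1 := by linear_combination h
    rw [this] at hx; simp at hx
  unfold lam
  have h3 : 1 - x ^ 2 = (1 - x) * (1 + x) := by ring
  rw [h3, sub_neg_eq_add]
  field_simp
  ring

lemma sq_norm_lt {q : ℂ} (hq : ‖q‖ < 1) : ‖q ^ 2‖ < 1 := pow_ne_one_of_norm hq two_ne_zero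

lemma LC_L3 {q : ℂ} (hq : ‖q‖ < 1) (hq0 : q ≠ 0) :
    4 * LC (q ^ 2) - LC q = Ps (q ^ 5) (-q) - Ps (q ^ 5) (-q ^ 2) := by
  have := LC_split hq hq0 (-1) (by norm_num)
  rw [neg_one_mul, neg_one_mul] at this
  rw [← this]
  unfold LC
  have s1 := LC_summable hq 1
  have s2 := LC_summable (sq_norm_lt hq) 1
  simp only [one_mul] at s1 s2
  rw [← tsum_mul_left, ← (s2.mul_left 4).tsum_sub s1]
  refine tsum_congr fun n => ?_
  rcases Nat.eq_zero_or_pos n with rfl | hn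
  · simp [chi]
  rw [neg_one_mul, lam_neg (pow_ne_one_of_norm hq hn.ne'), ← pow_mul, ← pow_mul, mul_comm 2 n]
  ring

lemma LC_L2 {q : ℂ} (hq : ‖q‖ < 1) (hq0 : q ≠ 0) :
    LC q + LC (q ^ 2) = Ps (q ^ 10) q - Ps (q ^ 10) (q ^ 3) := by
  have s1 := LC_summable hq 1
  simp only [one_mul] at s1
  have hs2 : ∀ F : ZMod 2 → ℂ, ∑ j : ZMod 2, F j = F 0 + F 1 :=
    fun F => Fin.sum_univ_two F
  have hs : ∀ F : ZMod 5 → ℂ, ∑ j : ZMod 5, F j = F 0 + F 1 + F 2 + F 3 + F 4 :=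
    fun F => Fin.sum_univ_five F
  have h1 : LC q = - LC (q ^ 2) + ∑' m : ℕ, (chi (1 + 2 * m) : ℂ) * lam (q ^ (1 + 2 * m)) := by
    unfold LC
    rw [Nat.sumByResidueClasses s1 2, hs2]
    congr 1
    rw [← tsum_neg]
    refine tsum_congr fun m => ?_
    rw [show (0 : ZMod 2).val = 0 from rfl, zero_add, chi_mul, show chi 2 = -1 from rfl, pow_mul]
    push_cast; ring
  have s3 : Summable (fun m : ℕ => (chi (1 + 2 * m) : ℂ) * lam (q ^ (1 + 2 * m))) :=
    s1.comp_injective (i := fun m => 1 + 2 * m) (fun a b h => by simpa using h)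
  have key : ∀ r : ℕ, ∑' m : ℕ, (chi (1 + 2 * (r + 5 * m)) : ℂ) * lam (q ^ (1 + 2 * (r + 5 * m))) =
      chi (1 + 2 * r) * Qs (q ^ 10) (q ^ (1 + 2 * r)) := by
    intro r
    unfold Qs
    rw [← tsum_mul_left]
    refine tsum_congr fun m => ?_
    rw [show 1 + 2 * (r + 5 * m) = (1 + 2 * r) + 5 * (2 * m) by ring, chi_add, ← pow_mul, ← pow_add]
    congr 3; ring
  rw [h1, Nat.sumByResidueClasses s3 5, hs]
  have v0 : (0 : ZMod 5).val = 0 := rfl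
  have v1 : (1 : ZMod 5).val = 1 := rfl
  have v2 : (2 : ZMod 5).val = 2 := rfl
  have v3 : (3 : ZMod 5).val = 3 := rfl
  have v4 : (4 : ZMod 5).val = 4 := rfl
  rw [v0, v1, v2, v3, v4, key, key, key, key, key]
  have c0 : chi (1 + 2 * 0) = 1 := rfl
  have c1 : chi (1 + 2 * 1) = -1 := rfl
  have c2 : chi (1 + 2 * 2) = 0 := rfl
  have c3 : chi (1 + 2 * 3) = -1 := rfl
  have c4 : chi (1 + 2 * 4) = 1 := rfl
  rw [c0, c1, c2, c3, c4]
  unfold Ps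
  have e1 : q ^ 10 / q = q ^ 9 := by field_simp
  have e2 : q ^ 10 / q ^ 3 = q ^ 7 := by field_simp
  rw [e1, e2]
  norm_num
  ring

/-- the character as a trigonometric sum -/
lemma gauss_chi {ζ : ℂ} (h5 : ζ ^ 5 = 1) (hs : 1 + ζ + ζ ^ 2 + ζ ^ 3 + ζ ^ 4 = 0) (m : ℕ) :
    ζ ^ m + (ζ ^ 4) ^ m - (ζ ^ 2) ^ m - (ζ ^ 3) ^ m = chi m * (ζ + ζ ^ 4 - ζ ^ 2 - ζ ^ 3) := by
  have hm : ∀ j : ℕ, (ζ ^ j) ^ m = (ζ ^ j) ^ (m % 5) := by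
    intro j
    conv_lhs => rw [← Nat.div_add_mod m 5, pow_add, pow_mul, ← pow_mul ζ j 5, mul_comm j 5,
      pow_mul, h5, one_pow, one_pow, one_mul]
  have h1 := hm 1
  rw [pow_one] at h1
  rw [h1, hm 2, hm 3, hm 4]
  unfold chi
  have hlt : m % 5 < 5 := Nat.mod_lt _ (by norm_num)
  generalize m % 5 = a at *
  interval_cases a
  · norm_num
  · norm_num
  · norm_num
    linear_combination (ζ ^ 3 - ζ) * h5
  · norm_num
    linear_combination (ζ ^ 7 + ζ ^ 2 - ζ ^ 4 - ζ) * h5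
  · norm_num
    linear_combination (ζ ^ 11 + ζ ^ 6 + ζ - ζ ^ 3 - ζ ^ 7 - ζ ^ 2) * h5

lemma LD_L4 {q ζ : ℂ} (hq : ‖q‖ < 1) (h5 : ζ ^ 5 = 1) (hs : 1 + ζ + ζ ^ 2 + ζ ^ 3 + ζ ^ 4 = 0) :
    Ps q ζ - Ps q (ζ ^ 2) = lam ζ - lam (ζ ^ 2) + (ζ + ζ ^ 4 - ζ ^ 2 - ζ ^ 3) * LD q := by
  have hn : ‖ζ‖ = 1 := Complex.norm_eq_one_of_pow_eq_one h5 (by norm_num)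
  have hz : ζ ≠ 0 := by rintro rfl; simp at hn
  have e1 : q / ζ = q * ζ ^ 4 := by field_simp; linear_combination -q * h5
  have e2 : q / ζ ^ 2 = q * ζ ^ 3 := by field_simp; linear_combination -q * h5
  unfold Ps
  rw [Qs_rec hq ζ, Qs_rec hq (ζ ^ 2), e1, e2]
  have hL : Qs q (q * ζ) + Qs q (q * ζ ^ 4) - Qs q (q * ζ ^ 2) - Qs q (q * ζ ^ 3) =
      (ζ + ζ ^ 4 - ζ ^ 2 - ζ ^ 3) * LD q := by
    unfold Qs LD
    rw [← (lam_summable hq _).tsum_add (lam_summable hq _),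
      ← ((lam_summable hq _).add (lam_summable hq _)).tsum_sub (lam_summable hq _),
      ← (((lam_summable hq _).add (lam_summable hq _)).sub (lam_summable hq _)).tsum_sub
        (lam_summable hq _), ← tsum_mul_left]
    refine tsum_congr fun k => ?_
    have hb : ∀ j : ℕ, ‖q * ζ ^ j * q ^ k‖ < 1 := by
      intro j
      rw [show q * ζ ^ j * q ^ k = ζ ^ j * q ^ (k + 1) by ring, norm_mul, norm_pow ζ, hn, one_pow,
        one_mul]
      exact pow_ne_one_of_norm hq (Nat.succ_ne_zero k)
    have hb1 := hb 1
    rw [pow_one] at hb1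
    have := (((lam_tsum hb1).add (lam_tsum (hb 4))).sub (lam_tsum (hb 2))).sub (lam_tsum (hb 3))
    rw [← this.tsum_eq, ← tsum_mul_left]
    refine tsum_congr fun m => ?_
    have hg := gauss_chi h5 hs m
    rw [show q * ζ * q ^ k = ζ * q ^ (k + 1) by ring,
      show q * ζ ^ 2 * q ^ k = ζ ^ 2 * q ^ (k + 1) by ring,
      show q * ζ ^ 3 * q ^ k = ζ ^ 3 * q ^ (k + 1) by ring,
      show q * ζ ^ 4 * q ^ k = ζ ^ 4 * q ^ (k + 1) by ring]
    simp only [mul_pow _ (q ^ (k + 1)) m]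
    linear_combination (m * (q ^ (k + 1)) ^ m) * hg
  linear_combination hL

/-! ### Product identities -/

lemma prod_range_mul' (f : ℕ → ℂ) (N M : ℕ) :
    ∏ k ∈ Finset.range (N * M), f k =
      ∏ j ∈ Finset.range N, ∏ i ∈ Finset.range M, f (N * i + j) := by
  induction M with
  | zero => simp
  | succ M ih =>
    rw [Nat.mul_succ, Finset.prod_range_add, ih, ← Finset.prod_mul_distrib]
    refine Finset.prod_congr rfl fun j _ => ?_
    rw [Finset.prod_range_succ]

lemma qpoch_tendsto {q : ℂ} (hq : ‖q‖ < 1) (a : ℂ) :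
    Tendsto (fun M => ∏ k ∈ Finset.range M, (1 - a * q ^ k)) atTop (𝓝 (qpoch a q)) :=
  (multipliable_q hq a).hasProd.tendsto_prod_nat

lemma norm_pow_lt {q : ℂ} (hq : ‖q‖ < 1) {N : ℕ} (hN : 0 < N) : ‖q ^ N‖ < 1 := by
  rw [norm_pow]; exact pow_lt_one₀ (norm_nonneg _) hq hN.ne'

lemma qpoch_split {q : ℂ} (hq : ‖q‖ < 1) (a : ℂ) {N : ℕ} (hN : 0 < N) :
    qpoch a q = ∏ j ∈ Finset.range N, qpoch (a * q ^ j) (q ^ N) := by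
  have h1 : Tendsto (fun M : ℕ => N * M) atTop atTop := tendsto_id.const_mul_atTop' hN
  have h2 := (qpoch_tendsto hq a).comp h1
  have h3 : Tendsto (fun M => ∏ j ∈ Finset.range N, ∏ i ∈ Finset.range M,
      (1 - a * q ^ j * (q ^ N) ^ i)) atTop
      (𝓝 (∏ j ∈ Finset.range N, qpoch (a * q ^ j) (q ^ N))) :=
    tendsto_finsetProd _ fun j _ => qpoch_tendsto (norm_pow_lt hq hN) _
  refine tendsto_nhds_unique h2 (h3.congr fun M => ?_)
  rw [Function.comp_apply, prod_range_mul']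
  refine Finset.prod_congr rfl fun j _ => Finset.prod_congr rfl fun i _ => ?_
  ring

lemma qpoch_neg_mul {q : ℂ} (hq : ‖q‖ < 1) (a : ℂ) :
    qpoch a q * qpoch (-a) q = qpoch (a ^ 2) (q ^ 2) := by
  unfold qpoch
  rw [← Multipliable.tprod_mul (multipliable_q hq a) (multipliable_q hq (-a))]
  refine tprod_congr fun k => ?_
  ring

lemma qpoch_five {q ζ : ℂ} (hq : ‖q‖ < 1) (a : ℂ) (hs : 1 + ζ + ζ ^ 2 + ζ ^ 3 + ζ ^ 4 = 0) :
    qpoch a q * (qpoch (a * ζ) q * (qpoch (a * ζ ^ 2) q * (qpoch (a * ζ ^ 3) q *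
      qpoch (a * ζ ^ 4) q))) = qpoch (a ^ 5) (q ^ 5) := by
  have h5 : ζ ^ 5 = 1 := by linear_combination (ζ - 1) * hs
  have m := fun b => multipliable_q hq b
  unfold qpoch
  rw [← Multipliable.tprod_mul (m _) (m _), ← Multipliable.tprod_mul (m _) ((m _).mul (m _)),
    ← Multipliable.tprod_mul (m _) ((m _).mul ((m _).mul (m _))),
    ← Multipliable.tprod_mul (m _) ((m _).mul ((m _).mul ((m _).mul (m _))))]
  refine tprod_congr fun k => ?_
  rw [← pow_mul, mul_comm 5 k, pow_mul]
  generalize q ^ k = x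
  have : a ^ 5 * x ^ 5 = (a * x) ^ 5 := by ring
  rw [this]
  have e : ∀ ω, a * ω * x = (a * x) * ω := fun ω => by ring
  simp only [e]
  generalize a * x = y
  have h10 : ζ ^ 10 = 1 := by rw [show (10 : ℕ) = 5 * 2 by norm_num, pow_mul, h5, one_pow]
  have h6 : ζ ^ 6 = ζ := by rw [pow_succ, h5, one_mul]
  have h7 : ζ ^ 7 = ζ ^ 2 := by rw [show (7 : ℕ) = 5 + 2 by norm_num, pow_add, h5, one_mul]
  have h8 : ζ ^ 8 = ζ ^ 3 := by rw [show (8 : ℕ) = 5 + 3 by norm_num, pow_add, h5, one_mul]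
  have h9 : ζ ^ 9 = ζ ^ 4 := by rw [show (9 : ℕ) = 5 + 4 by norm_num, pow_add, h5, one_mul]
  have h4 : ζ ^ 4 = -1 - ζ - ζ ^ 2 - ζ ^ 3 := by linear_combination hs
  ring_nf
  simp only [h10, h9, h8, h7, h6, h5, h4]
  ring

/-- Euler product -/
noncomputable def EE (q : ℂ) : ℂ := qpoch q q

lemma EE_ne {q : ℂ} (hq : ‖q‖ < 1) : EE q ≠ 0 := qpoch_ne_zero' hq hq

lemma qp_ne {q : ℂ} (hq : ‖q‖ < 1) {N j : ℕ} (hN : 0 < N) (hj : 0 < j) :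
    qpoch (q ^ j) (q ^ N) ≠ 0 := qpoch_ne_zero' (norm_pow_lt hq hN) (norm_pow_lt hq hj)

lemma qp_ne' {q : ℂ} (hq : ‖q‖ < 1) {N j : ℕ} (hN : 0 < N) (hj : 0 < j) :
    qpoch (-q ^ j) (q ^ N) ≠ 0 :=
  qpoch_ne_zero' (norm_pow_lt hq hN) (by rw [norm_neg]; exact norm_pow_lt hq hj)

lemma pow_mem_Ann {q : ℂ} (hq : ‖q‖ < 1) (hq0 : q ≠ 0) {N j : ℕ} (h : j < N) :
    q ^ j ∈ Ann (q ^ N) := by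
  have hp : 0 < ‖q‖ := norm_pos_iff.2 hq0
  constructor
  · rw [norm_pow, norm_pow]
    exact pow_lt_pow_right_of_lt_one₀ hp hq h
  · rw [norm_pow, norm_pow, ← pow_add]
    exact pow_lt_one₀ hp.le hq (by omega)

lemma neg_mem_Ann {q z : ℂ} (h : z ∈ Ann q) : -z ∈ Ann q := by
  simpa [Ann] using h

lemma ne_one_of_norm {z : ℂ} (h : ‖z‖ < 1) : z ≠ 1 := by
  rintro rfl; simp at h

lemma th_pow {q : ℂ} (hq0 : q ≠ 0) (N j : ℕ) (h : j ≤ N) :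
    th (q ^ N) (q ^ j) = qpoch (q ^ j) (q ^ N) * qpoch (q ^ (N - j)) (q ^ N) := by
  unfold th
  rw [show q ^ N / q ^ j = q ^ (N - j) from (pow_sub₀ q hq0 h).symm ▸ by rw [div_eq_mul_inv]]

lemma th_neg_pow {q : ℂ} (hq0 : q ≠ 0) (N j : ℕ) (h : j ≤ N) :
    th (q ^ N) (-q ^ j) = qpoch (-q ^ j) (q ^ N) * qpoch (-q ^ (N - j)) (q ^ N) := by
  unfold th
  rw [show q ^ N / -q ^ j = -q ^ (N - j) by rw [pow_sub₀ q hq0 h, div_neg, div_eq_mul_inv]]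

lemma EE_five {q : ℂ} (hq : ‖q‖ < 1) : EE q = qpoch (q ^ 1) (q ^ 5) * qpoch (q ^ 2) (q ^ 5) *
    qpoch (q ^ 3) (q ^ 5) * qpoch (q ^ 4) (q ^ 5) * qpoch (q ^ 5) (q ^ 5) := by
  unfold EE
  rw [qpoch_split hq q (N := 5) (by norm_num)]
  simp only [Finset.prod_range_succ, Finset.prod_range_zero, one_mul, ← pow_succ']

theorem T1 {q : ℂ} (hq : ‖q‖ < 1) (hq0 : q ≠ 0) : LC q = q * EE (q ^ 5) ^ 5 / EE q := by
  have hQ := norm_pow_lt hq (N := 5) (by norm_num)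
  have hQ0 : q ^ 5 ≠ 0 := pow_ne_zero _ hq0
  rw [LC_L1 hq hq0]
  have := wp_diff hQ hQ0 (pow_mem_Ann hq hq0 (j := 1) (N := 5) (by norm_num))
    (pow_mem_Ann hq hq0 (j := 2) (N := 5) (by norm_num))
    (ne_one_of_norm (norm_pow_lt hq (by norm_num))) (ne_one_of_norm (norm_pow_lt hq (by norm_num)))
  rw [show q ^ 1 / q ^ 2 = (q ^ 1)⁻¹ by field_simp, th_inv hQ (by simpa using hq0), ← pow_add,
    th_pow hq0 _ _ (by norm_num), th_pow hq0 _ _ (by norm_num), th_pow hq0 _ _ (by norm_num)] at this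
  norm_num only at this
  rw [show q ^ 1 = q from pow_one q] at this
  rw [this, EE_five hq, EE, pow_one]
  have n1 := qp_ne hq (N := 5) (j := 1) (by norm_num) (by norm_num)
  have n2 := qp_ne hq (N := 5) (j := 2) (by norm_num) (by norm_num)
  have n3 := qp_ne hq (N := 5) (j := 3) (by norm_num) (by norm_num)
  have n4 := qp_ne hq (N := 5) (j := 4) (by norm_num) (by norm_num)
  have n5 := qp_ne hq (N := 5) (j := 5) (by norm_num) (by norm_num)
  rw [pow_one] at n1
  generalize qpoch q (q ^ 5) = x1 at *
  generalize qpoch (q ^ 2) (q ^ 5) = x2 at *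
  generalize qpoch (q ^ 3) (q ^ 5) = x3 at *
  generalize qpoch (q ^ 4) (q ^ 5) = x4 at *
  generalize qpoch (q ^ 5) (q ^ 5) = x5 at *
  field_simp

theorem T3 {q : ℂ} (hq : ‖q‖ < 1) (hq0 : q ≠ 0) :
    LC q - 4 * LC (q ^ 2) = q * EE q ^ 3 * EE (q ^ 5) * EE (q ^ 10) ^ 2 / EE (q ^ 2) ^ 2 := by
  have hQ := norm_pow_lt hq (N := 5) (by norm_num)
  have hQ0 : q ^ 5 ≠ 0 := pow_ne_zero _ hq0
  have hz := neg_mem_Ann (pow_mem_Ann hq hq0 (j := 1) (N := 5) (by norm_num))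
  have hb := neg_mem_Ann (pow_mem_Ann hq hq0 (j := 2) (N := 5) (by norm_num))
  have := wp_diff hQ hQ0 hz hb
    (ne_one_of_norm (by rw [norm_neg]; exact norm_pow_lt hq (by norm_num)))
    (ne_one_of_norm (by rw [norm_neg]; exact norm_pow_lt hq (by norm_num)))
  rw [show -q ^ 1 / -q ^ 2 = (q ^ 1)⁻¹ by field_simp, th_inv hQ (by simpa using hq0), neg_mul_neg,
    ← pow_add,
    th_pow hq0 _ _ (by norm_num), th_pow hq0 _ _ (by norm_num), th_neg_pow hq0 _ _ (by norm_num),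
    th_neg_pow hq0 _ _ (by norm_num)] at this
  norm_num only at this
  rw [show q ^ 1 = q from pow_one q] at this
  have key : EE (q ^ 2) = (qpoch (q ^ 1) (q ^ 5) * qpoch (-q ^ 1) (q ^ 5)) *
      (qpoch (q ^ 2) (q ^ 5) * qpoch (-q ^ 2) (q ^ 5)) *
      (qpoch (q ^ 3) (q ^ 5) * qpoch (-q ^ 3) (q ^ 5)) *
      (qpoch (q ^ 4) (q ^ 5) * qpoch (-q ^ 4) (q ^ 5)) *
      (qpoch (q ^ 5) (q ^ 5) * qpoch (-q ^ 5) (q ^ 5)) := by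
    rw [EE_five (sq_norm_lt hq)]
    simp only [qpoch_neg_mul hQ]
    simp only [← pow_mul]
  have key2 : EE (q ^ 10) = qpoch (q ^ 5) (q ^ 5) * qpoch (-q ^ 5) (q ^ 5) := by
    rw [qpoch_neg_mul hQ, EE, ← pow_mul]
  rw [show LC q - 4 * LC (q ^ 2) = -(4 * LC (q ^ 2) - LC q) by ring, LC_L3 hq hq0, this, EE_five hq,
    key, key2, EE, pow_one]
  have n1 := qp_ne hq (N := 5) (j := 1) (by norm_num) (by norm_num)
  have n2 := qp_ne hq (N := 5) (j := 2) (by norm_num) (by norm_num)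
  have n3 := qp_ne hq (N := 5) (j := 3) (by norm_num) (by norm_num)
  have n4 := qp_ne hq (N := 5) (j := 4) (by norm_num) (by norm_num)
  have n5 := qp_ne hq (N := 5) (j := 5) (by norm_num) (by norm_num)
  have m1 := qp_ne' hq (N := 5) (j := 1) (by norm_num) (by norm_num)
  have m2 := qp_ne' hq (N := 5) (j := 2) (by norm_num) (by norm_num)
  have m3 := qp_ne' hq (N := 5) (j := 3) (by norm_num) (by norm_num)
  have m4 := qp_ne' hq (N := 5) (j := 4) (by norm_num) (by norm_num)
  have m5 := qp_ne' hq (N := 5) (j := 5) (by norm_num) (by norm_num)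
  rw [pow_one] at n1 m1
  generalize qpoch q (q ^ 5) = x1 at *
  generalize qpoch (q ^ 2) (q ^ 5) = x2 at *
  generalize qpoch (q ^ 3) (q ^ 5) = x3 at *
  generalize qpoch (q ^ 4) (q ^ 5) = x4 at *
  generalize qpoch (q ^ 5) (q ^ 5) = x5 at *
  generalize qpoch (-q) (q ^ 5) = y1 at *
  generalize qpoch (-q ^ 2) (q ^ 5) = y2 at *
  generalize qpoch (-q ^ 3) (q ^ 5) = y3 at *
  generalize qpoch (-q ^ 4) (q ^ 5) = y4 at *
  generalize qpoch (-q ^ 5) (q ^ 5) = y5 at *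
  field_simp

theorem T2 {q : ℂ} (hq : ‖q‖ < 1) (hq0 : q ≠ 0) :
    LC q + LC (q ^ 2) = q * EE (q ^ 2) ^ 3 * EE (q ^ 5) ^ 2 * EE (q ^ 10) / EE q ^ 2 := by
  have hQ := norm_pow_lt hq (N := 10) (by norm_num)
  have hQ0 : q ^ 10 ≠ 0 := pow_ne_zero _ hq0
  have := wp_diff hQ hQ0 (pow_mem_Ann hq hq0 (j := 1) (N := 10) (by norm_num))
    (pow_mem_Ann hq hq0 (j := 3) (N := 10) (by norm_num))
    (ne_one_of_norm (norm_pow_lt hq (by norm_num))) (ne_one_of_norm (norm_pow_lt hq (by norm_num)))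
  rw [show q ^ 1 / q ^ 3 = (q ^ 2)⁻¹ by field_simp, th_inv hQ (by simpa using hq0), ← pow_add,
    th_pow hq0 _ _ (by norm_num), th_pow hq0 _ _ (by norm_num), th_pow hq0 _ _ (by norm_num),
    th_pow hq0 _ _ (by norm_num)] at this
  norm_num only at this
  rw [show q ^ 1 = q from pow_one q] at this
  have k1 : EE q = qpoch q (q ^ 10) * qpoch (q ^ 2) (q ^ 10) * qpoch (q ^ 3) (q ^ 10) *
      qpoch (q ^ 4) (q ^ 10) * qpoch (q ^ 5) (q ^ 10) * qpoch (q ^ 6) (q ^ 10) *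
      qpoch (q ^ 7) (q ^ 10) * qpoch (q ^ 8) (q ^ 10) * qpoch (q ^ 9) (q ^ 10) *
      qpoch (q ^ 10) (q ^ 10) := by
    unfold EE
    rw [qpoch_split hq q (N := 10) (by norm_num)]
    simp only [Finset.prod_range_succ, Finset.prod_range_zero, one_mul, ← pow_succ']
    norm_num only [pow_one]
  have k2 : EE (q ^ 2) = qpoch (q ^ 2) (q ^ 10) * qpoch (q ^ 4) (q ^ 10) * qpoch (q ^ 6) (q ^ 10) *
      qpoch (q ^ 8) (q ^ 10) * qpoch (q ^ 10) (q ^ 10) := by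
    rw [EE_five (sq_norm_lt hq)]
    simp only [← pow_mul]
  have k3 : EE (q ^ 5) = qpoch (q ^ 5) (q ^ 10) * qpoch (q ^ 10) (q ^ 10) := by
    unfold EE
    rw [qpoch_split (norm_pow_lt hq (by norm_num)) _ (N := 2) (by norm_num)]
    simp only [Finset.prod_range_succ, Finset.prod_range_zero, one_mul, ← pow_mul, ← pow_add]
  rw [LC_L2 hq hq0, this, k1, k2, k3, EE]
  have n1 := qp_ne hq (N := 10) (j := 1) (by norm_num) (by norm_num)
  have n2 := qp_ne hq (N := 10) (j := 2) (by norm_num) (by norm_num)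
  have n3 := qp_ne hq (N := 10) (j := 3) (by norm_num) (by norm_num)
  have n4 := qp_ne hq (N := 10) (j := 4) (by norm_num) (by norm_num)
  have n5 := qp_ne hq (N := 10) (j := 5) (by norm_num) (by norm_num)
  have n6 := qp_ne hq (N := 10) (j := 6) (by norm_num) (by norm_num)
  have n7 := qp_ne hq (N := 10) (j := 7) (by norm_num) (by norm_num)
  have n8 := qp_ne hq (N := 10) (j := 8) (by norm_num) (by norm_num)
  have n9 := qp_ne hq (N := 10) (j := 9) (by norm_num) (by norm_num)
  have n10 := qp_ne hq (N := 10) (j := 10) (by norm_num) (by norm_num)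
  rw [pow_one] at n1
  generalize qpoch q (q ^ 10) = x1 at *
  generalize qpoch (q ^ 2) (q ^ 10) = x2 at *
  generalize qpoch (q ^ 3) (q ^ 10) = x3 at *
  generalize qpoch (q ^ 4) (q ^ 10) = x4 at *
  generalize qpoch (q ^ 5) (q ^ 10) = x5 at *
  generalize qpoch (q ^ 6) (q ^ 10) = x6 at *
  generalize qpoch (q ^ 7) (q ^ 10) = x7 at *
  generalize qpoch (q ^ 8) (q ^ 10) = x8 at *
  generalize qpoch (q ^ 9) (q ^ 10) = x9 at *
  generalize qpoch (q ^ 10) (q ^ 10) = x10 at *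
  field_simp

theorem T4 {q : ℂ} (hq : ‖q‖ < 1) (hq0 : q ≠ 0) :
    1 - 5 * LD q = EE q ^ 5 / EE (q ^ 5) := by
  obtain ⟨ζ, hζ⟩ : ∃ ζ : ℂ, IsPrimitiveRoot ζ 5 :=
    ⟨_, Complex.isPrimitiveRoot_exp 5 (by norm_num)⟩
  have h5 : ζ ^ 5 = 1 := hζ.pow_eq_one
  have hn : ∀ j : ℕ, 0 < j → j < 5 → ζ ^ j ≠ 1 := fun j h0 h1 h => by
    have := hζ.dvd_of_pow_eq_one j h
    exact absurd (Nat.le_of_dvd h0 this) (by omega)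
  have h1 : ζ ≠ 1 := by simpa using hn 1 (by norm_num) (by norm_num)
  have h2 := hn 2 (by norm_num) (by norm_num)
  have h3 := hn 3 (by norm_num) (by norm_num)
  have h4 := hn 4 (by norm_num) (by norm_num)
  have z0 : ζ ≠ 0 := by rintro rfl; simp at h5
  have hs : 1 + ζ + ζ ^ 2 + ζ ^ 3 + ζ ^ 4 = 0 := by
    have : (ζ - 1) * (1 + ζ + ζ ^ 2 + ζ ^ 3 + ζ ^ 4) = 0 := by linear_combination h5
    exact (mul_eq_zero.1 this).resolve_left (sub_ne_zero.2 h1)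
  have nz : ‖ζ‖ = 1 := hζ.norm'_eq_one (by norm_num)
  have mem : ∀ j : ℕ, ζ ^ j ∈ Ann q := fun j => by
    simp [Ann, nz, hq]
  have W := wp_diff hq hq0 (mem 1) (mem 2) h2 (by simpa using h1)
  rw [pow_one, LD_L4 hq h5 hs] at W
  have five := qpoch_five hq q hs
  have e1 : th q ζ = (1 - ζ) * (qpoch (q * ζ) q * qpoch (q * ζ ^ 4) q) := by
    rw [th_eq hq, th1, show q / ζ = q * ζ ^ 4 by field_simp; linear_combination -h5]
  have e2 : th q (ζ ^ 2) = (1 - ζ ^ 2) * (qpoch (q * ζ ^ 2) q * qpoch (q * ζ ^ 3) q) := by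
    rw [th_eq hq, th1, show q / ζ ^ 2 = q * ζ ^ 3 by field_simp; linear_combination -h5]
  have e3 : th q (ζ * ζ ^ 2) = (1 - ζ ^ 3) * (qpoch (q * ζ ^ 3) q * qpoch (q * ζ ^ 2) q) := by
    rw [← pow_succ', th_eq hq, th1,
      show q / ζ ^ (2 + 1) = q * ζ ^ 2 by field_simp; linear_combination -h5]
  have e4 : th q (ζ / ζ ^ 2) = (1 - ζ ^ 4) * (qpoch (q * ζ ^ 4) q * qpoch (q * ζ) q) := by
    rw [show ζ / ζ ^ 2 = ζ ^ 4 by field_simp; linear_combination -h5, th_eq hq, th1,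
      show q / ζ ^ 4 = q * ζ by field_simp; linear_combination -h5]
  rw [e1, e2, e3, e4] at W
  have w : ∀ j : ℕ, qpoch (q * ζ ^ j) q ≠ 0 := fun j =>
    qpoch_ne_zero' hq (by rw [norm_mul, norm_pow, nz]; simpa using hq)
  have w1 := w 1
  have w2 := w 2
  have w3 := w 3
  have w4 := w 4
  have w0 := EE_ne hq
  rw [pow_one] at w1
  unfold EE at *
  rw [← five]
  unfold lam at W
  generalize qpoch (q * ζ) q = x1 at *
  generalize qpoch (q * ζ ^ 2) q = x2 at *
  generalize qpoch (q * ζ ^ 3) q = x3 at *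
  generalize qpoch (q * ζ ^ 4) q = x4 at *
  generalize qpoch q q = x0 at *
  have s1 : 1 - ζ ≠ 0 := sub_ne_zero.2 h1.symm
  have s2 : 1 - ζ ^ 2 ≠ 0 := sub_ne_zero.2 h2.symm
  have s3 : 1 - ζ ^ 3 ≠ 0 := sub_ne_zero.2 h3.symm
  have s4 : 1 - ζ ^ 4 ≠ 0 := sub_ne_zero.2 h4.symm
  have R : -ζ ^ 2 * x0 ^ 4 * ((1 - ζ ^ 3) * (x3 * x2)) * ((1 - ζ ^ 4) * (x4 * x1)) /
      (((1 - ζ) * (x1 * x4)) ^ 2 * ((1 - ζ ^ 2) * (x2 * x3)) ^ 2) =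
      -(ζ ^ 2 * (1 - ζ ^ 3) * (1 - ζ ^ 4)) * (x0 ^ 5 / (x0 * (x1 * (x2 * (x3 * x4))))) /
        ((1 - ζ) ^ 2 * (1 - ζ ^ 2) ^ 2) := by
    field_simp
  rw [R] at W
  generalize x0 ^ 5 / (x0 * (x1 * (x2 * (x3 * x4)))) = D at *
  have k0 : ζ ^ 2 * (1 - ζ ^ 3) * (1 - ζ ^ 4) ≠ 0 :=
    mul_ne_zero (mul_ne_zero (pow_ne_zero _ z0) s3) s4
  have c1 : ζ / (1 - ζ) ^ 2 - ζ ^ 2 / (1 - ζ ^ 2) ^ 2 =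
      -(ζ ^ 2 * (1 - ζ ^ 3) * (1 - ζ ^ 4)) / ((1 - ζ) ^ 2 * (1 - ζ ^ 2) ^ 2) := by
    rw [div_sub_div _ _ (pow_ne_zero _ s1) (pow_ne_zero _ s2)]
    congr 1
    linear_combination (ζ ^ 4 - ζ - 1 + 1) * h5
  have c2 : ζ + ζ ^ 4 - ζ ^ 2 - ζ ^ 3 =
      5 * (ζ ^ 2 * (1 - ζ ^ 3) * (1 - ζ ^ 4)) / ((1 - ζ) ^ 2 * (1 - ζ ^ 2) ^ 2) := by
    rw [eq_div_iff (mul_ne_zero (pow_ne_zero _ s1) (pow_ne_zero _ s2))]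
    linear_combination ((1) * ζ ^ 1 + (-9) * ζ ^ 2 + (8) * ζ ^ 3 + (8) * ζ ^ 4 + (-9) * ζ ^ 5 + (1) * ζ ^ 6) * hs
  rw [c1, c2, ← sub_eq_zero] at W
  have W2 : (ζ ^ 2 * (1 - ζ ^ 3) * (1 - ζ ^ 4)) / ((1 - ζ) ^ 2 * (1 - ζ ^ 2) ^ 2) *
      (1 - 5 * LD q - D) = 0 := by linear_combination -W
  exact sub_eq_zero.1 ((mul_eq_zero.1 W2).resolve_left (div_ne_zero k0
    (mul_ne_zero (pow_ne_zero _ s1) (pow_ne_zero _ s2))))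

/-! ### Algebraic consequences -/

lemma LC_ne {q : ℂ} (hq : ‖q‖ < 1) (hq0 : q ≠ 0) : LC q ≠ 0 := by
  rw [T1 hq hq0]
  exact div_ne_zero (mul_ne_zero hq0 (pow_ne_zero _ (EE_ne (norm_pow_lt hq (by norm_num)))))
    (EE_ne hq)

lemma D1_eq {q : ℂ} (hq : ‖q‖ < 1) (hq0 : q ≠ 0) :
    (1 - 5 * LD q) * (LC q * LC (q ^ 2)) =
      (LC q + LC (q ^ 2)) * (LC q - 4 * LC (q ^ 2)) ^ 2 := by
  have hq2 := sq_norm_lt hq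
  have hq20 : q ^ 2 ≠ 0 := pow_ne_zero _ hq0
  rw [T2 hq hq0, T3 hq hq0, T4 hq hq0, T1 hq hq0, T1 hq2 hq20, ← pow_mul]
  have e1 := EE_ne hq
  have e2 := EE_ne hq2
  have f1 := EE_ne (norm_pow_lt hq (N := 5) (by norm_num))
  have f2 := EE_ne (norm_pow_lt hq (N := 10) (by norm_num))
  norm_num only
  field_simp

lemma D2_eq {q : ℂ} (hq : ‖q‖ < 1) (hq0 : q ≠ 0) :
    (1 - 5 * LD (q ^ 2)) * (LC q * LC (q ^ 2)) =
      (LC q + LC (q ^ 2)) ^ 2 * (LC q - 4 * LC (q ^ 2)) := by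
  have hq2 := sq_norm_lt hq
  have hq20 : q ^ 2 ≠ 0 := pow_ne_zero _ hq0
  rw [T2 hq hq0, T3 hq hq0, T4 hq2 hq20, T1 hq hq0, T1 hq2 hq20, ← pow_mul]
  have e1 := EE_ne hq
  have e2 := EE_ne hq2
  have f1 := EE_ne (norm_pow_lt hq (N := 5) (by norm_num))
  have f2 := EE_ne (norm_pow_lt hq (N := 10) (by norm_num))
  norm_num only
  field_simp

lemma A_eq {q : ℂ} (hq : ‖q‖ < 1) (hq0 : q ≠ 0) :
    phiNeg (q ^ 5) ^ 5 / phiNeg q * LC (q ^ 2) = LC q ^ 2 := by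
  have hq2 := sq_norm_lt hq
  have hq20 : q ^ 2 ≠ 0 := pow_ne_zero _ hq0
  have e1 := EE_ne hq
  have e2 := EE_ne hq2
  have f1 := EE_ne (norm_pow_lt hq (N := 5) (by norm_num))
  have f2 := EE_ne (norm_pow_lt hq (N := 10) (by norm_num))
  rw [T1 hq hq0, T1 hq2 hq20]
  unfold phiNeg
  simp only [← pow_mul]
  norm_num only
  unfold EE at *
  field_simp

lemma B_eq {q : ℂ} (hq : ‖q‖ < 1) (hq0 : q ≠ 0) :
    q ^ 3 * (psiNeg (q ^ 5) ^ 5 / psiNeg q) * LC (q ^ 2) = LC q * LC (q ^ 4) := by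
  have hq2 := sq_norm_lt hq
  have hq20 : q ^ 2 ≠ 0 := pow_ne_zero _ hq0
  have hq4 := norm_pow_lt hq (N := 4) (by norm_num)
  have hq40 : q ^ 4 ≠ 0 := pow_ne_zero _ hq0
  have e1 := EE_ne hq
  have e2 := EE_ne hq2
  have e4 := EE_ne hq4
  have f1 := EE_ne (norm_pow_lt hq (N := 5) (by norm_num))
  have f2 := EE_ne (norm_pow_lt hq (N := 10) (by norm_num))
  have f4 := EE_ne (norm_pow_lt hq (N := 20) (by norm_num))
  rw [T1 hq hq0, T1 hq2 hq20, T1 hq4 hq40]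
  unfold psiNeg
  simp only [← pow_mul]
  norm_num only
  unfold EE at *
  field_simp

theorem I2 {q : ℂ} (hq : ‖q‖ < 1) (hq0 : q ≠ 0) :
    5 * (phiNeg (q ^ 5) ^ 5 / phiNeg q) =
      5 - 5 * LD q - 20 * LD (q ^ 2) + 15 * LC q + 20 * LC (q ^ 2) := by
  have n1 := LC_ne hq hq0
  have n2 := LC_ne (sq_norm_lt hq) (pow_ne_zero _ hq0)
  have hA := A_eq hq hq0
  have h1 := D1_eq hq hq0
  have h2 := D2_eq hq hq0
  apply mul_right_cancel₀ (mul_ne_zero n1 n2)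
  linear_combination 5 * LC q * hA - h1 - 4 * h2

theorem I3 {q : ℂ} (hq : ‖q‖ < 1) (hq0 : q ≠ 0) (hne : LC q + 4 * LC (q ^ 4) ≠ 0) :
    20 * (q ^ 3 * (psiNeg (q ^ 5) ^ 5 / psiNeg q)) =
      - 5 * LD q - 15 * LD (q ^ 2) + 20 * LD (q ^ 4) + 5 * LC q + 5 * LC (q ^ 2)
        - 20 * LC (q ^ 4) := by
  have hq2 := sq_norm_lt hq
  have hq20 : q ^ 2 ≠ 0 := pow_ne_zero _ hq0
  have n1 := LC_ne hq hq0
  have n2 := LC_ne hq2 hq20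
  have n4 := LC_ne (sq_norm_lt hq2) (pow_ne_zero _ hq20)
  have hB := B_eq hq hq0
  have h1 := D1_eq hq hq0
  have h2 := D2_eq hq hq0
  have h2' := D1_eq hq2 hq20
  have h4 := D2_eq hq2 hq20
  rw [show (q ^ 2) ^ 2 = q ^ 4 by ring] at h2' h4 n4
  have R0 : (LC q + 4 * LC (q ^ 4)) * (LC (q ^ 2) ^ 3 + 2 * LC q * LC (q ^ 2) * LC (q ^ 4) +
      4 * LC q * LC (q ^ 4) ^ 2 - LC q ^ 2 * LC (q ^ 4)) = 0 := by
    linear_combination LC (q ^ 4) * h2 - LC q * h2'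
  have R := (mul_eq_zero.1 R0).resolve_left hne
  apply mul_right_cancel₀ (mul_ne_zero (mul_ne_zero n1 n2) n4)
  linear_combination 20 * LC q * LC (q ^ 4) * hB - LC (q ^ 4) * h1 - 3 * LC (q ^ 4) * h2
    + 4 * LC q * h4 + (4 * LC q - 4 * LC (q ^ 4)) * R

/-! ### Coefficients -/

lemma hs_congr {f g : ℕ → ℂ} {s t : ℂ} (h : HasSum g t) (hfg : ∀ n, f n = g n) (hst : s = t) :
    HasSum f s := by
  rw [hst, show f = g from funext hfg]; exact h

lemma coeff_unique {w : ℕ → ℂ} (h : ∀ᶠ q : ℂ in 𝓝[≠] 0, HasSum (fun n => w n * q ^ n) 0) :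
    ∀ n, w n = 0 := by
  classical
  set f : ℂ → ℂ := Function.update 0 0 (w 0) with hf
  have h1 : HasFPowerSeriesAt f (FormalMultilinearSeries.ofScalars ℂ w) 0 := by
    rw [hasFPowerSeriesAt_iff]
    rw [eventually_nhdsWithin_iff] at h
    filter_upwards [h] with z hz
    simp only [zero_add, FormalMultilinearSeries.coeff_ofScalars, smul_eq_mul]
    by_cases hz0 : z = 0
    · subst hz0
      have := hasSum_ite_eq (0 : ℕ) (w 0)
      simp only [hf, Function.update_self]
      refine hs_congr this (fun n => ?_) rfl
      rcases n with _ | n <;> simp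
    · simp only [hf, Function.update_of_ne hz0, Pi.zero_apply]
      simpa [mul_comm] using hz hz0
  have hc := h1.continuousAt
  have hfe : f =ᶠ[𝓝[≠] 0] 0 := by
    filter_upwards [self_mem_nhdsWithin] with z hz
    simp [hf, Function.update_of_ne hz]
  have hf0 : f 0 = 0 := by
    have t1 : Tendsto f (𝓝[≠] 0) (𝓝 (f 0)) := hc.tendsto.mono_left nhdsWithin_le_nhds
    have t2 : Tendsto f (𝓝[≠] 0) (𝓝 0) := (tendsto_congr' hfe).2 tendsto_const_nhds
    exact tendsto_nhds_unique t1 t2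
  have hfz : f = 0 := by
    have : w 0 = 0 := by simpa [hf] using hf0
    simp [hf, this]
  rw [hfz] at h1
  have h2 := h1.eq_zero
  intro n
  rw [← FormalMultilinearSeries.coeff_ofScalars (𝕜 := ℂ) (p := w) (n := n), h2]
  simp [FormalMultilinearSeries.coeff]

/-- dilation of a coefficient sequence -/
def dil (k : ℕ) (u : ℕ → ℤ) (n : ℕ) : ℤ := if k ∣ n then u (n / k) else 0

lemma dil_hasSum {k : ℕ} (hk : 0 < k) {u : ℕ → ℤ} {q s : ℂ}
    (h : HasSum (fun n => (u n : ℂ) * (q ^ k) ^ n) s) :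
    HasSum (fun n => (dil k u n : ℂ) * q ^ n) s := by
  have inj : Function.Injective (fun n : ℕ => k * n) := fun a b hab =>
    Nat.eq_of_mul_eq_mul_left hk hab
  rw [← inj.hasSum_iff]
  · convert h using 2 with n
    simp [dil, Nat.mul_div_cancel_left _ hk, pow_mul]
  · intro n hn
    have : ¬ k ∣ n := fun ⟨m, hm⟩ => hn ⟨m, hm.symm⟩
    simp [dil, this]

lemma summable_of_tsum_ne {f : ℕ → ℂ} {s : ℂ} (h : ∑' n, f n = s) (hs : s ≠ 0) : HasSum f s := by
  by_cases hf : Summable f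
  · exact h ▸ hf.hasSum
  · rw [tsum_eq_zero_of_not_summable hf] at h; exact absurd h.symm hs

lemma ev_small : ∀ᶠ q : ℂ in 𝓝[≠] 0, ‖q‖ < 1 ∧ q ≠ 0 := by
  have h1 : ∀ᶠ q : ℂ in 𝓝[≠] 0, ‖q‖ < 1 := by
    apply eventually_nhdsWithin_of_eventually_nhds
    filter_upwards [Metric.ball_mem_nhds (0 : ℂ) one_pos] with q hq
    simpa using hq
  filter_upwards [h1, self_mem_nhdsWithin] with q h h'
  exact ⟨h, h'⟩

lemma ev_ne : ∀ᶠ q : ℂ in 𝓝[≠] 0, LC q + 4 * LC (q ^ 4) ≠ 0 := by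
  have hs : ∀ q : ℂ, ‖q‖ < 1 →
      HasSum (fun n => ((sC n : ℂ) + 4 * dil 4 sC n) * q ^ n) (LC q + 4 * LC (q ^ 4)) := by
    intro q hq
    have := (LC_hasSum hq).add
      ((dil_hasSum (k := 4) (by norm_num) (LC_hasSum (norm_pow_lt hq (by norm_num)))).mul_left 4)
    convert this using 2 with n
    ring
  have han : AnalyticAt ℂ (fun q => LC q + 4 * LC (q ^ 4)) 0 := by
    refine ⟨FormalMultilinearSeries.ofScalars ℂ (fun n => (sC n : ℂ) + 4 * dil 4 sC n), ?_⟩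
    rw [hasFPowerSeriesAt_iff]
    filter_upwards [Metric.ball_mem_nhds (0 : ℂ) one_pos] with q hq
    have := hs q (by simpa using hq)
    simpa [FormalMultilinearSeries.coeff_ofScalars, mul_comm] using this
  rcases han.eventually_eq_zero_or_eventually_ne_zero with h | h
  · exfalso
    have := coeff_unique (w := fun n => (sC n : ℂ) + 4 * dil 4 sC n) (by
      filter_upwards [ev_small, eventually_nhdsWithin_of_eventually_nhds h] with q hq h0
      have := hs q hq.1
      rwa [h0] at this) 1
    have e : sC 1 = 1 := by decide
    simp [dil, e] at this
  · exact h

theorem main_c (c : ℕ → ℤ) (hc : ∀ q : ℂ, ‖q‖ < 1 →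
      ∑' n : ℕ, (c n : ℂ) * q ^ n = qpoch (q ^ 5) (q ^ 5) ^ 5 / qpoch q q) (n : ℕ) :
    c n = sC (n + 1) := by
  have := coeff_unique (w := fun n => (c n : ℂ) - sC (n + 1)) (by
    filter_upwards [ev_small] with q hq
    have hn : qpoch (q ^ 5) (q ^ 5) ^ 5 / qpoch q q ≠ 0 :=
      div_ne_zero (pow_ne_zero _ (EE_ne (norm_pow_lt hq.1 (by norm_num)))) (EE_ne hq.1)
    have h1 := summable_of_tsum_ne (hc q hq.1) hn
    have h2 := LC_hasSum hq.1
    rw [← hasSum_nat_add_iff' 1] at h2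
    have e : sC 0 = 0 := by decide
    have h3 := h2.mul_left q⁻¹
    have h4 := h1.sub h3
    rw [T1 hq.1 hq.2] at h4
    have q0 := hq.2
    refine hs_congr h4 (fun n => ?_) ?_
    · field_simp; ring
    · simp only [Finset.range_one, Finset.sum_singleton, e]
      unfold EE
      field_simp; simp) n
  have h := sub_eq_zero.1 this
  exact_mod_cast h

theorem main_a (a : ℕ → ℤ) (ha : ∀ q : ℂ, ‖q‖ < 1 →
      ∑' n : ℕ, (a n : ℂ) * q ^ n = phiNeg (q ^ 5) ^ 5 / phiNeg q) (n : ℕ) :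
    5 * a n = (if n = 0 then 5 else 0) - 5 * sD n - 20 * dil 2 sD n + 15 * sC n
      + 20 * dil 2 sC n := by
  have := coeff_unique (w := fun n => 5 * (a n : ℂ) - ((if n = 0 then 5 else 0) - 5 * sD n
      - 20 * dil 2 sD n + 15 * sC n + 20 * dil 2 sC n)) (by
    filter_upwards [ev_small] with q hq
    have hq2 := sq_norm_lt hq.1
    have hn : phiNeg (q ^ 5) ^ 5 / phiNeg q ≠ 0 := by
      intro h0
      have := A_eq hq.1 hq.2
      rw [h0, zero_mul] at this
      exact LC_ne hq.1 hq.2 (pow_eq_zero_iff (by norm_num) |>.1 this.symm)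
    have h1 := (summable_of_tsum_ne (ha q hq.1) hn).mul_left 5
    have h2 := (LC_hasSum hq.1).mul_left 15
    have h3 := (dil_hasSum (k := 2) (by norm_num) (LC_hasSum hq2)).mul_left 20
    have h4 := (LD_hasSum hq.1).mul_left 5
    have h5 := (dil_hasSum (k := 2) (by norm_num) (LD_hasSum hq2)).mul_left 20
    have h6 := hasSum_ite_eq (0 : ℕ) (5 : ℂ)
    have H := h1.sub ((((h6.sub h4).sub h5).add h2).add h3)
    rw [I2 hq.1 hq.2, sub_self] at H
    refine hs_congr H (fun n => ?_) rfl
    rcases n with _ | n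
    · simp
    · simp; ring) n
  have h := sub_eq_zero.1 this
  exact_mod_cast h

theorem main_b (b : ℕ → ℤ) (hb : ∀ q : ℂ, ‖q‖ < 1 →
      ∑' n : ℕ, (b n : ℂ) * q ^ n = psiNeg (q ^ 5) ^ 5 / psiNeg q) (n : ℕ) :
    20 * b n = - 5 * sD (n + 3) - 15 * dil 2 sD (n + 3) + 20 * dil 4 sD (n + 3)
      + 5 * sC (n + 3) + 5 * dil 2 sC (n + 3) - 20 * dil 4 sC (n + 3) := by
  have := coeff_unique (w := fun n => (if n < 3 then 0 else 20 * (b (n - 3) : ℂ)) -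
      (- 5 * sD n - 15 * dil 2 sD n + 20 * dil 4 sD n
      + 5 * sC n + 5 * dil 2 sC n - 20 * dil 4 sC n)) (by
    filter_upwards [ev_small, ev_ne] with q hq hne
    have hq2 := sq_norm_lt hq.1
    have hq4 := norm_pow_lt hq.1 (N := 4) (by norm_num)
    have hn : psiNeg (q ^ 5) ^ 5 / psiNeg q ≠ 0 := by
      intro h0
      have := B_eq hq.1 hq.2
      rw [h0, mul_zero, zero_mul] at this
      exact mul_ne_zero (LC_ne hq.1 hq.2) (LC_ne hq4 (pow_ne_zero _ hq.2)) this.symm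
    have h1 := ((summable_of_tsum_ne (hb q hq.1) hn).mul_left (q ^ 3)).mul_left 20
    have h1' : HasSum (fun n => (if n < 3 then 0 else 20 * (b (n - 3) : ℂ)) * q ^ n)
        (20 * (q ^ 3 * (psiNeg (q ^ 5) ^ 5 / psiNeg q))) := by
      rw [← hasSum_nat_add_iff' 3]
      refine hs_congr h1 (fun n => ?_) ?_
      · simp; ring
      · simp [Finset.sum_range_succ]
    have h2 := (LC_hasSum hq.1).mul_left 5
    have h3 := (dil_hasSum (k := 2) (by norm_num) (LC_hasSum hq2)).mul_left 5
    have h3' := (dil_hasSum (k := 4) (by norm_num) (LC_hasSum hq4)).mul_left 20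
    have h4 := (LD_hasSum hq.1).mul_left (-5)
    have h5 := (dil_hasSum (k := 2) (by norm_num) (LD_hasSum hq2)).mul_left 15
    have h5' := (dil_hasSum (k := 4) (by norm_num) (LD_hasSum hq4)).mul_left 20
    have H := h1'.sub (((((h4.sub h5).add h5').add h2).add h3).sub h3')
    rw [I3 hq.1 hq.2 hne, sub_self] at H
    refine hs_congr H (fun n => ?_) rfl
    ring) (n + 3)
  have h := sub_eq_zero.1 this
  simp only [Nat.add_sub_cancel, if_neg (show ¬ n + 3 < 3 by omega)] at h
  exact_mod_cast h

theorem stmt_18 (c a b : ℕ → ℤ)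
    (hc : ∀ q : ℂ, ‖q‖ < 1 →
      ∑' n : ℕ, (c n : ℂ) * q ^ n = qpoch (q ^ 5) (q ^ 5) ^ 5 / qpoch q q)
    (ha : ∀ q : ℂ, ‖q‖ < 1 →
      ∑' n : ℕ, (a n : ℂ) * q ^ n = phiNeg (q ^ 5) ^ 5 / phiNeg q)
    (hb : ∀ q : ℂ, ‖q‖ < 1 →
      ∑' n : ℕ, (b n : ℂ) * q ^ n = psiNeg (q ^ 5) ^ 5 / psiNeg q) :
    ∀ n : ℕ, 2 * b (20 * n + 7) = a (2 * n + 1) + 2 * c (2 * n) := by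
  intro n
  have h1 := main_c c hc (2 * n)
  have h2 := main_a a ha (2 * n + 1)
  have h3 := main_b b hb (20 * n + 7)
  have d2 : ∀ u, dil 2 u (2 * n + 1) = 0 := fun u => if_neg (by omega)
  have d4 : ∀ u, dil 4 u (20 * n + 7 + 3) = 0 := fun u => if_neg (by omega)
  have d2' : ∀ u, dil 2 u (20 * n + 7 + 3) = u (5 * (2 * n + 1)) := fun u => by
    rw [dil, if_pos (by omega)]; congr 1; omega
  have e1 : sC (20 * n + 7 + 3) = 5 * sC (2 * n + 1) := by
    rw [show 20 * n + 7 + 3 = 5 * (2 * (2 * n + 1)) by ring, sC_five, sC_two_odd]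
  have e2 : sD (20 * n + 7 + 3) = - sD (2 * n + 1) := by
    rw [show 20 * n + 7 + 3 = 5 * (2 * (2 * n + 1)) by ring, sD_five, sD_two_odd]
  rw [d2, d2, if_neg (by omega)] at h2
  rw [d4, d4, d2', d2', e1, e2, sC_five, sD_five] at h3
  omega
end
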